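/- Assume the Sathe–Selberg analogue hypothesis: there exist constants C₀, C > 0 such that #{n ∈ 𝒩 : n ≤ x, ω₁(n) = k} = (C₀ + o(1))·(x/log x)·(log log x)^{k−1}/(2^{k−1}·(k−1)!) uniformly for 1 ≤ k ≤ C·log log x. Let q > 3/2 and let (λ_j) be a sequence interlacing with 𝒩 for which there is a sequence ε_j → 0 with Δ_j ≤ (log ñ_j)^{1/2 + ε_j} for all j (rigid quantization). Then there exists a full density set of indices J ⊆ ℕ such that ½ log 2 ≤ lim sup_{j∈J, j→∞} log m_q(λ_j)/log log ñ_j ≤ ½ log 2 + f(q), where f(q) = (½ log 2)·(exp(log 2/(q − 1/2)) − 1). -/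

import Mathlib

open Filter Topology

noncomputable section

/-- The set of natural numbers expressible as a sum of two squares. -/
def SOS : Set ℕ := {n | ∃ x y : ℤ, (n : ℤ) = x ^ 2 + y ^ 2}

/-- `r₂(n)`, the number of representations of `n` as a sum of two squares. -/
def r2 (n : ℕ) : ℕ := Nat.card {p : ℤ × ℤ // p.1 ^ 2 + p.2 ^ 2 = (n : ℤ)}

/-- `ω₁(n)`, the number of distinct prime factors of `n` congruent to `1` mod `4`. -/
def omega1 (n : ℕ) : ℕ := (n.primeFactors.filter fun p => p % 4 = 1).card

/-- A set `J` of indices has full density if `#(J ∩ [1,k])/k → 1`. -/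
def FullDensityIdx (J : Set ℕ) : Prop :=
  Tendsto (fun k : ℕ => (Nat.card ↥(J ∩ Set.Icc 1 k) : ℝ) / (k : ℝ)) atTop (𝓝 1)

/-- The moment `m_q(λ) = Δ^{2q} ∑_{n ∈ 𝒩} r₂(n) |n − λ|^{−2q}`. -/
def mq (q lam Δ : ℝ) : ℝ :=
  Δ ^ (2 * q) * ∑' n : ℕ, (r2 n : ℝ) * |(n : ℝ) - lam| ^ (-(2 * q))

/-- The Sathe–Selberg analogue hypothesis for `ω₁` on `𝒩`. -/
def SatheSelberg : Prop :=
  ∃ C₀ C : ℝ, 0 < C₀ ∧ 0 < C ∧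
    ∀ δ : ℝ, 0 < δ → ∃ x₀ : ℕ, ∀ x : ℕ, x₀ ≤ x → ∀ k : ℕ, 1 ≤ k →
      (k : ℝ) ≤ C * Real.log (Real.log x) →
      |(Nat.card {n : ℕ // n ∈ SOS ∧ n ≤ x ∧ omega1 n = k} : ℝ) -
          C₀ * ((x : ℝ) / Real.log x * Real.log (Real.log x) ^ (k - 1) /
            (2 ^ (k - 1) * (Nat.factorial (k - 1) : ℝ)))| ≤
        δ * ((x : ℝ) / Real.log x * Real.log (Real.log x) ^ (k - 1) /
          (2 ^ (k - 1) * (Nat.factorial (k - 1) : ℝ)))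

/-- `f(q) = (½ log 2)(exp(log 2/(q − 1/2)) − 1)`. -/
def fq (q : ℝ) : ℝ := 1 / 2 * Real.log 2 * (Real.exp (Real.log 2 / (q - 1 / 2)) - 1)

section Mertens

open Finset ArithmeticFunction

/-- Partial summation: a sum with bounded partial sums against an antitone weight is bounded. -/
lemma abs_sum_mul_le_of_antitone {e g : ℕ → ℝ} {M : ℕ} {K : ℝ}
    (hK : ∀ n, M ≤ n → |∑ i ∈ Ioc M n, e i| ≤ K)
    (hg0 : ∀ n, M < n → 0 ≤ g n) (hg : ∀ n, M < n → g (n + 1) ≤ g n) {N : ℕ} (hMN : M ≤ N) :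
    |∑ i ∈ Ioc M N, e i * g i| ≤ K * g (M + 1) := by
  have key : ∀ n, M ≤ n → |∑ i ∈ Ioc M n, e i * g i - (∑ i ∈ Ioc M n, e i) * g (n + 1)| ≤
      K * (g (M + 1) - g (n + 1)) := by
    intro n hn
    induction n, hn using Nat.le_induction with
    | base => simp
    | succ n hn ih =>
      rw [sum_Ioc_succ_top hn, sum_Ioc_succ_top hn]
      have h1 := hK (n + 1) (by lia)
      rw [sum_Ioc_succ_top hn] at h1
      have h2 := hg (n + 1) (by lia)
      set T := ∑ i ∈ Ioc M n, e i * g i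
      set X := ∑ i ∈ Ioc M n, e i
      have : T + e (n + 1) * g (n + 1) - (X + e (n + 1)) * g (n + 1 + 1) =
        (T - X * g (n + 1)) + (X + e (n + 1)) * (g (n + 1) - g (n + 1 + 1)) := by ring
      rw [this]
      refine (abs_add_le _ _).trans ?_
      rw [abs_mul, abs_of_nonneg (sub_nonneg.2 h2)]
      have h3 := mul_le_mul_of_nonneg_right h1 (sub_nonneg.2 h2)
      linarith
  have h := key N hMN
  have h1 := hK N hMN
  have h2 := hg0 (N + 1) (by lia)
  set X := ∑ i ∈ Ioc M N, e i
  set T := ∑ i ∈ Ioc M N, e i * g i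
  have h3 : |X * g (N + 1)| ≤ K * g (N + 1) := by
    rw [abs_mul, abs_of_nonneg h2]; gcongr
  calc |T| = |(T - X * g (N + 1)) + X * g (N + 1)| := by ring_nf
    _ ≤ _ := abs_add_le _ _
    _ ≤ _ := by linarith

/-- The nontrivial character modulo `4` with real values. -/
def chiFour (n : ℕ) : ℝ := ((ZMod.χ₄ (n : ZMod 4) : ℤ) : ℝ)

lemma chiFour_eq (n : ℕ) :
    chiFour n = if n % 2 = 0 then 0 else if n % 4 = 1 then 1 else -1 := by
  unfold chiFour
  rw [ZMod.χ₄_nat_eq_if_mod_four]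
  split_ifs <;> simp

lemma chiFour_mul (m n : ℕ) : chiFour (m * n) = chiFour m * chiFour n := by
  unfold chiFour
  rw [Nat.cast_mul, map_mul, Int.cast_mul]

lemma abs_chiFour_le (n : ℕ) : |chiFour n| ≤ 1 := by
  rw [chiFour_eq]; split_ifs <;> simp

lemma sum_chiFour_Ioc_zero (n : ℕ) :
    ∑ i ∈ Ioc 0 n, chiFour i = if n % 4 = 1 ∨ n % 4 = 2 then 1 else 0 := by
  induction n with
  | zero => simp
  | succ n ih =>
    rw [sum_Ioc_succ_top (Nat.zero_le n), ih, chiFour_eq]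
    have : n % 4 < 4 := Nat.mod_lt _ (by norm_num)
    split_ifs <;> first | (exfalso; lia) | norm_num

lemma abs_sum_chiFour_le (M n : ℕ) (h : M ≤ n) : |∑ i ∈ Ioc M n, chiFour i| ≤ 1 := by
  have h1 := sum_Ioc_consecutive chiFour (Nat.zero_le M) h
  rw [sum_chiFour_Ioc_zero, sum_chiFour_Ioc_zero] at h1
  have : ∑ i ∈ Ioc M n, chiFour i = (if n % 4 = 1 ∨ n % 4 = 2 then (1 : ℝ) else 0) -
    (if M % 4 = 1 ∨ M % 4 = 2 then (1 : ℝ) else 0) := by linarith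
  rw [this]
  split_ifs <;> simp

lemma log_factorial_eq_sum (N : ℕ) :
    Real.log (N.factorial : ℝ) = ∑ n ∈ Ioc 0 N, vonMangoldt n * ((N / n : ℕ) : ℝ) := by
  rw [← sum_Ioc_mul_zeta_eq_sum vonMangoldt N, vonMangoldt_mul_zeta]
  induction N with
  | zero => simp
  | succ n ih =>
    rw [sum_Ioc_succ_top (Nat.zero_le n), ← ih,
      Nat.factorial_succ, Nat.cast_mul, Real.log_mul (by positivity) (by positivity)]
    simp [add_comm]

lemma le_log_factorial (N : ℕ) : N * Real.log N - N ≤ Real.log (N.factorial : ℝ) := by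
  rcases Nat.eq_zero_or_pos N with rfl | h
  · simp
  have h1 := Stirling.le_log_factorial_stirling h.ne'
  have h2 : 0 ≤ Real.log N := Real.log_natCast_nonneg N
  have h3 : 0 ≤ Real.log (2 * Real.pi) := Real.log_nonneg (by linarith [Real.pi_gt_three])
  linarith

lemma log_factorial_le (N : ℕ) : Real.log (N.factorial : ℝ) ≤ N * Real.log N := by
  have : (N.factorial : ℝ) ≤ (N : ℝ) ^ N := by exact_mod_cast Nat.factorial_le_pow N
  calc _ ≤ Real.log ((N : ℝ) ^ N) := Real.log_le_log (by positivity) this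
    _ = _ := by rw [Real.log_pow]

lemma sum_vonMangoldt_le (N : ℕ) : ∑ n ∈ Ioc 0 N, vonMangoldt n ≤ 6 * N := by
  have h := Chebyshev.psi_le_const_mul_self (x := N) (by positivity)
  have h4 : Real.log 4 ≤ 2 := by
    rw [show (4 : ℝ) = 2 ^ 2 by norm_num, Real.log_pow]
    have := Real.log_two_lt_d9
    push_cast; linarith
  unfold Chebyshev.psi at h
  rw [Nat.floor_natCast] at h
  nlinarith [Nat.cast_nonneg (α := ℝ) N]

lemma natCast_div_bounds (N n : ℕ) :
    (N : ℝ) / n - 1 ≤ ((N / n : ℕ) : ℝ) ∧ ((N / n : ℕ) : ℝ) ≤ (N : ℝ) / n := by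
  refine ⟨?_, Nat.cast_div_le⟩
  have := Nat.lt_floor_add_one ((N : ℝ) / n)
  rw [Nat.floor_div_eq_div] at this
  linarith

lemma abs_sum_vonMangoldt_div_sub_log_le (N : ℕ) (hN : 0 < N) :
    |∑ n ∈ Ioc 0 N, vonMangoldt n / n - Real.log N| ≤ 7 := by
  have hN' : (0 : ℝ) < N := by exact_mod_cast hN
  have h1 := log_factorial_eq_sum N
  have h2 := le_log_factorial N
  have h3 := log_factorial_le N
  have h4 := sum_vonMangoldt_le N
  have h5 : ∑ n ∈ Ioc 0 N, vonMangoldt n * ((N / n : ℕ) : ℝ) ≤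
      N * ∑ n ∈ Ioc 0 N, vonMangoldt n / n := by
    rw [mul_sum]
    refine sum_le_sum fun n hn => ?_
    have := (natCast_div_bounds N n).2
    have h0 : 0 ≤ vonMangoldt n := vonMangoldt_nonneg
    calc _ ≤ vonMangoldt n * ((N : ℝ) / n) := by gcongr
      _ = _ := by ring
  have h6 : N * ∑ n ∈ Ioc 0 N, vonMangoldt n / n - ∑ n ∈ Ioc 0 N, vonMangoldt n ≤
      ∑ n ∈ Ioc 0 N, vonMangoldt n * ((N / n : ℕ) : ℝ) := by
    rw [mul_sum, ← sum_sub_distrib]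
    refine sum_le_sum fun n hn => ?_
    have := (natCast_div_bounds N n).1
    have h0 : 0 ≤ vonMangoldt n := vonMangoldt_nonneg
    calc _ = vonMangoldt n * ((N : ℝ) / n - 1) := by ring
      _ ≤ _ := by gcongr
  set S := ∑ n ∈ Ioc 0 N, vonMangoldt n / n
  rw [abs_le]
  constructor
  · have : N * (-7 : ℝ) ≤ N * (S - Real.log N) := by nlinarith
    exact le_of_mul_le_mul_left this hN'
  · have : N * (S - Real.log N) ≤ N * (7 : ℝ) := by nlinarith
    exact le_of_mul_le_mul_left this hN'

lemma abs_sum_chiFour_div_le (M N : ℕ) (h : M ≤ N) :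
    |∑ n ∈ Ioc M N, chiFour n / n| ≤ 1 / ((M : ℝ) + 1) := by
  have := abs_sum_mul_le_of_antitone (e := chiFour) (g := fun n => 1 / (n : ℝ)) (M := M) (K := 1)
    (fun n hn => abs_sum_chiFour_le M n hn) (fun n _ => by positivity)
    (fun n hn => by
      have : (0 : ℝ) < n := by exact_mod_cast (by lia : 0 < n)
      push_cast; gcongr; linarith) h
  simpa [div_eq_mul_inv] using this

lemma sum_chiFour_div_ge (N : ℕ) (h : 0 < N) : 1 / 3 ≤ ∑ n ∈ Ioc 0 N, chiFour n / n := by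
  rcases lt_or_ge N 3 with h3 | h3
  · interval_cases N
    · norm_num [chiFour_eq]
    · norm_num [sum_Ioc_succ_top, chiFour_eq]
  · have h1 := sum_Ioc_consecutive (fun n : ℕ => chiFour n / n) (Nat.zero_le 3) h3
    have h2 := abs_sum_chiFour_div_le 3 N h3
    have h4 : ∑ n ∈ Ioc 0 3, chiFour n / (n : ℝ) = 2 / 3 := by
      norm_num [sum_Ioc_succ_top, chiFour_eq]
    rw [← h1, h4]
    have := (abs_le.1 h2).1
    norm_num at this ⊢
    linarith

lemma abs_sum_chiFour_log_div_le (N : ℕ) :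
    |∑ n ∈ Ioc 0 N, chiFour n * (Real.log n / n)| ≤ 3 := by
  have hb : ∀ n : ℕ, |chiFour n * (Real.log n / n)| ≤ 1 := by
    intro n
    have h0 : 0 ≤ Real.log n / n := div_nonneg (Real.log_natCast_nonneg n) (by positivity)
    have h1 : Real.log n / n ≤ 1 :=
      div_le_one_of_le₀ (Real.log_le_self (by positivity)) (by positivity)
    rw [abs_mul, abs_of_nonneg h0]
    exact mul_le_one₀ (abs_chiFour_le n) h0 h1
  rcases le_or_gt N 2 with h2 | h2
  · refine (abs_sum_le_sum_abs _ _).trans ((sum_le_sum fun n _ => hb n).trans ?_)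
    simp
    have : (N : ℝ) ≤ 2 := by exact_mod_cast h2
    linarith
  · have h1 := sum_Ioc_consecutive (fun n : ℕ => chiFour n * (Real.log n / n))
      (Nat.zero_le 2) h2.le
    rw [← h1]
    refine (abs_add_le _ _).trans ?_
    have h3 : |∑ n ∈ Ioc 0 2, chiFour n * (Real.log n / n)| ≤ 2 := by
      refine (abs_sum_le_sum_abs _ _).trans ((sum_le_sum fun n _ => hb n).trans ?_)
      simp
    have h4 := abs_sum_mul_le_of_antitone (e := chiFour) (g := fun n => Real.log n / (n : ℝ))
      (M := 2) (K := 1)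
      (fun n hn => abs_sum_chiFour_le 2 n hn)
      (fun n _ => div_nonneg (Real.log_natCast_nonneg n) (by positivity))
      (fun n hn => by
        have h3 : (3 : ℝ) ≤ n := by exact_mod_cast hn
        have := Real.exp_one_lt_d9
        exact Real.log_div_self_antitoneOn (by simp; linarith)
          (by simp; linarith) (by simp)) h2.le
    have h5 : Real.log ((2 + 1 : ℕ) : ℝ) / ((2 + 1 : ℕ) : ℝ) ≤ 1 :=
      div_le_one_of_le₀ (Real.log_le_self (by positivity)) (by positivity)
    linarith

lemma sum_chiFour_log_div_eq (N : ℕ) :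
    ∑ n ∈ Ioc 0 N, chiFour n * (Real.log n / n) =
      ∑ d ∈ Ioc 0 N, chiFour d * vonMangoldt d / d * ∑ m ∈ Ioc 0 (N / d), chiFour m / m := by
  obtain ⟨f, hf⟩ : ∃ f : ArithmeticFunction ℝ, ∀ d, f d = chiFour d * vonMangoldt d / d :=
    ⟨⟨fun d => chiFour d * vonMangoldt d / d, by simp⟩, fun _ => rfl⟩
  obtain ⟨g, hg⟩ : ∃ g : ArithmeticFunction ℝ, ∀ d, g d = chiFour d / d :=
    ⟨⟨fun d => chiFour d / d, by simp⟩, fun _ => rfl⟩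
  simp only [← hf, ← hg]
  rw [← sum_Ioc_mul_eq_sum_sum f g N]
  refine sum_congr rfl fun n hn => ?_
  rw [mul_apply]
  have hn0 : (n : ℝ) ≠ 0 := by exact_mod_cast (mem_Ioc.1 hn).1.ne'
  have hsum : ∑ d ∈ n.divisors, vonMangoldt d = ∑ x ∈ n.divisorsAntidiagonal, vonMangoldt x.1 := by
    rw [Nat.sum_divisorsAntidiagonal fun d _ => vonMangoldt d]
  rw [← vonMangoldt_sum, hsum, sum_div, mul_sum]
  refine sum_congr rfl fun x hx => ?_
  obtain ⟨hx, _⟩ := Nat.mem_divisorsAntidiagonal.1 hx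
  subst hx
  have h1 : (x.1 : ℝ) ≠ 0 := by rintro h; simp [h] at hn0
  have h2 : (x.2 : ℝ) ≠ 0 := by rintro h; simp [h] at hn0
  simp only [hf, hg, chiFour_mul]
  push_cast
  field_simp

lemma abs_sum_chiFour_vonMangoldt_div_le (N : ℕ) :
    |∑ n ∈ Ioc 0 N, chiFour n * vonMangoldt n / n| ≤ 27 := by
  rcases Nat.eq_zero_or_pos N with rfl | hN
  · simp
  have hN' : (0 : ℝ) < N := by exact_mod_cast hN
  set S := ∑ n ∈ Ioc 0 N, chiFour n / n with hS
  set A := ∑ n ∈ Ioc 0 N, chiFour n * vonMangoldt n / n with hA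
  have h1 := abs_sum_chiFour_log_div_le N
  have h2 : |S * A - ∑ n ∈ Ioc 0 N, chiFour n * (Real.log n / n)| ≤ 6 := by
    rw [sum_chiFour_log_div_eq, hA, mul_sum, ← sum_sub_distrib]
    have h3 : ∀ d ∈ Ioc 0 N, |S * (chiFour d * vonMangoldt d / d) -
        chiFour d * vonMangoldt d / d * ∑ m ∈ Ioc 0 (N / d), chiFour m / m| ≤
        vonMangoldt d / N := by
      intro d hd
      obtain ⟨hd0, hdN⟩ := mem_Ioc.1 hd
      have hd0' : (0 : ℝ) < d := by exact_mod_cast hd0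
      have h4 := sum_Ioc_consecutive (fun n : ℕ => chiFour n / n) (Nat.zero_le (N / d))
        (Nat.div_le_self N d)
      have h5 := abs_sum_chiFour_div_le (N / d) N (Nat.div_le_self N d)
      have h6 : S * (chiFour d * vonMangoldt d / d) -
        chiFour d * vonMangoldt d / d * ∑ m ∈ Ioc 0 (N / d), chiFour m / m =
        chiFour d * vonMangoldt d / d * ∑ n ∈ Ioc (N / d) N, chiFour n / n := by
        rw [hS, ← h4]; ring
      rw [h6, abs_mul, abs_div, abs_mul, abs_of_nonneg (vonMangoldt_nonneg (n := d)),
        abs_of_pos hd0']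
      have h7 : 1 / (((N / d : ℕ) : ℝ) + 1) ≤ d / N := by
        rw [div_le_div_iff₀ (by positivity) hN']
        have := (natCast_div_bounds N d).1
        have h8 : (N : ℝ) / d ≤ ((N / d : ℕ) : ℝ) + 1 := by linarith
        rw [div_le_iff₀ hd0'] at h8
        linarith
      calc |chiFour d| * vonMangoldt d / d * |∑ n ∈ Ioc (N / d) N, chiFour n / n|
          ≤ 1 * vonMangoldt d / d * (d / N) := by
            have := vonMangoldt_nonneg (n := d)
            have := abs_chiFour_le d
            gcongr
            exact h5.trans h7
        _ = vonMangoldt d / N := by field_simp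
    calc _ ≤ _ := abs_sum_le_sum_abs _ _
      _ ≤ _ := sum_le_sum h3
      _ = (∑ n ∈ Ioc 0 N, vonMangoldt n) / N := by rw [sum_div]
      _ ≤ 6 := by rw [div_le_iff₀ hN']; exact sum_vonMangoldt_le N
  have h3 := sum_chiFour_div_ge N hN
  have h4 : |S * A| ≤ 9 := by
    have := abs_sub_abs_le_abs_sub (S * A) (∑ n ∈ Ioc 0 N, chiFour n * (Real.log n / n))
    linarith
  rw [abs_mul, abs_of_nonneg (by linarith)] at h4
  nlinarith [abs_nonneg A]

end Mertens

section PrimesModFour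

open Finset ArithmeticFunction

/-- The primes `p ≤ N` with `p % 4 = a`. -/
def primesMod (a N : ℕ) : Finset ℕ := (Ioc 0 N).filter fun p => p.Prime ∧ p % 4 = a

lemma mem_primesMod {a N p : ℕ} : p ∈ primesMod a N ↔ p ≤ N ∧ p.Prime ∧ p % 4 = a := by
  simp only [primesMod, mem_filter, mem_Ioc]
  exact ⟨fun h => ⟨h.1.2, h.2⟩, fun h => ⟨⟨h.2.1.pos, h.1⟩, h.2⟩⟩

/-- The contribution of proper prime powers to `∑ Λ n / n` is bounded. -/
lemma exists_sum_nonprime_vonMangoldt_le :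
    ∃ K : ℝ, 0 ≤ K ∧ ∀ N : ℕ,
      ∑ n ∈ Ioc 0 N, (if n.Prime then 0 else vonMangoldt n) / (n : ℝ) ≤ K := by
  have h := vonMangoldt.summable_residueClass_non_primes_div (q := 1) 0
  have h' : Summable fun n : ℕ => (if n.Prime then 0 else vonMangoldt n) / (n : ℝ) := by
    refine h.congr fun n => ?_
    congr 2
    simp [Subsingleton.elim (n : ZMod 1) 0]
  have h0 : ∀ n : ℕ, 0 ≤ (if n.Prime then 0 else vonMangoldt n) / (n : ℝ) := fun n => by
    split_ifs
    · simp
    · exact div_nonneg vonMangoldt_nonneg (by positivity)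
  exact ⟨_, tsum_nonneg h0, fun N => h'.sum_le_tsum _ fun n _ => h0 n⟩

lemma exists_abs_sum_primesMod_log_div_sub_le {a : ℕ} (ha : a = 1 ∨ a = 3) :
    ∃ K : ℝ, 0 ≤ K ∧ ∀ N : ℕ, 0 < N →
      |∑ p ∈ primesMod a N, Real.log p / p - 1 / 2 * Real.log N| ≤ K := by
  obtain ⟨K, hK0, hK⟩ := exists_sum_nonprime_vonMangoldt_le
  obtain ⟨σ, hσ, hσa⟩ : ∃ σ : ℝ, |σ| = 1 ∧ ∀ n : ℕ, (if n % 4 = a then 1 else 0) =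
      1 / 2 * (1 + σ * chiFour n) - (if n % 2 = 0 then 1 / 2 else 0) := by
    rcases ha with rfl | rfl
    · refine ⟨1, by simp, fun n => ?_⟩
      rw [chiFour_eq]
      split_ifs <;> first | (exfalso; lia) | norm_num
    · refine ⟨-1, by simp, fun n => ?_⟩
      rw [chiFour_eq]
      split_ifs <;> first | (exfalso; lia) | norm_num
  refine ⟨1 / 2 * 7 + 1 / 2 * 27 + K + 1, by positivity, fun N hN => ?_⟩
  have h1 := abs_sum_vonMangoldt_div_sub_log_le N hN
  have h2 := abs_sum_chiFour_vonMangoldt_div_le N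
  have hE : |∑ n ∈ Ioc 0 N, 1 / 2 * (1 + σ * chiFour n) *
      ((if n.Prime then 0 else vonMangoldt n) / (n : ℝ))| ≤ K := by
    refine (abs_sum_le_sum_abs _ _).trans ((sum_le_sum fun n _ => ?_).trans (hK N))
    have h0 : 0 ≤ (if n.Prime then 0 else vonMangoldt n) / (n : ℝ) := by
      split_ifs
      · simp
      · exact div_nonneg vonMangoldt_nonneg (by positivity)
    rw [abs_mul, abs_of_nonneg h0]
    refine mul_le_of_le_one_left h0 ?_
    rw [abs_mul, abs_of_pos (by norm_num : (0 : ℝ) < 1 / 2)]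
    have h3 : |1 + σ * chiFour n| ≤ 2 := by
      refine (abs_add_le _ _).trans ?_
      rw [abs_mul, hσ, one_mul, abs_one]
      linarith [abs_chiFour_le n]
    linarith
  have hT : |∑ n ∈ Ioc 0 N, (if n % 2 = 0 then 1 / 2 else 0) *
      ((if n.Prime then Real.log n else 0) / (n : ℝ))| ≤ 1 := by
    have : ∑ n ∈ Ioc 0 N, (if n % 2 = 0 then (1 / 2 : ℝ) else 0) *
      ((if n.Prime then Real.log n else 0) / (n : ℝ)) =
      ∑ n ∈ (Ioc 0 N).filter (· = 2), 1 / 2 * (Real.log n / n) := by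
      rw [sum_filter]
      refine sum_congr rfl fun n hn => ?_
      by_cases hn2 : n = 2
      · subst hn2; simp [Nat.prime_two]
      · rw [if_neg hn2]
        by_cases hp : n.Prime
        · have := hp.mod_two_eq_one_iff_ne_two.2 hn2
          simp [this]
        · simp [hp]
    rw [this, filter_eq']
    split_ifs
    · rw [sum_singleton, abs_of_nonneg (by positivity)]
      have := Real.log_two_lt_d9
      push_cast
      linarith
    · simp
  have hmain : ∑ p ∈ primesMod a N, Real.log p / p =
      1 / 2 * ∑ n ∈ Ioc 0 N, vonMangoldt n / n
      + 1 / 2 * σ * ∑ n ∈ Ioc 0 N, chiFour n * vonMangoldt n / n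
      - ∑ n ∈ Ioc 0 N, 1 / 2 * (1 + σ * chiFour n) *
        ((if n.Prime then 0 else vonMangoldt n) / (n : ℝ))
      - ∑ n ∈ Ioc 0 N, (if n % 2 = 0 then 1 / 2 else 0) *
        ((if n.Prime then Real.log n else 0) / (n : ℝ)) := by
    rw [primesMod, sum_filter, mul_sum, mul_sum, ← sum_add_distrib, ← sum_sub_distrib,
      ← sum_sub_distrib]
    refine sum_congr rfl fun n _ => ?_
    have hn := hσa n
    by_cases hp : n.Prime
    · have : (if n.Prime ∧ n % 4 = a then Real.log n / n else 0) =
          (if n % 4 = a then (1 : ℝ) else 0) * (Real.log n / n) := by simp [hp]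
      rw [this, hn, vonMangoldt_apply_prime hp]
      simp only [hp, if_true]
      ring
    · simp only [hp, if_false, false_and]
      ring
  rw [hmain]
  have h3 : |1 / 2 * σ * ∑ n ∈ Ioc 0 N, chiFour n * vonMangoldt n / n| ≤ 1 / 2 * 27 := by
    rw [abs_mul, abs_mul, hσ, abs_of_pos (by norm_num : (0 : ℝ) < 1 / 2), mul_one]
    linarith
  rw [abs_le] at *
  constructor <;> linarith

/-- The primes `p ≡ 1 mod 4` satisfy a Chebyshev lower bound. -/
lemma exists_le_sum_primesMod_log :
    ∃ c : ℝ, 0 < c ∧ ∃ k₀ : ℕ, 0 < k₀ ∧ ∀ k : ℕ, k₀ ≤ k →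
      c * k ≤ ∑ p ∈ primesMod 1 k, Real.log p := by
  obtain ⟨K, hK0, hK⟩ := exists_abs_sum_primesMod_log_div_sub_le (a := 1) (Or.inl rfl)
  obtain ⟨A, hA⟩ := exists_nat_gt (Real.exp (2 * (2 * K + 1)))
  have hA0 : (0 : ℝ) < A := (Real.exp_pos _).trans hA
  have hA0' : 0 < A := by exact_mod_cast hA0
  refine ⟨1 / (2 * A), by positivity, 2 * A, by lia, fun k hk => ?_⟩
  have hm0 : 0 < k / A := Nat.div_pos (by lia) hA0'
  have hk0 : (0 : ℝ) < k := by exact_mod_cast (by lia : 0 < k)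
  have h1 := abs_le.1 (hK k (by lia))
  have h2 := abs_le.1 (hK (k / A) hm0)
  have hsub : primesMod 1 (k / A) ⊆ primesMod 1 k := fun p hp => by
    rw [mem_primesMod] at *
    exact ⟨hp.1.trans (Nat.div_le_self _ _), hp.2⟩
  have h3 := sum_sdiff (f := fun p : ℕ => Real.log p / p) hsub
  have hm0' : (0 : ℝ) < ((k / A : ℕ) : ℝ) := by exact_mod_cast hm0
  have hlog : Real.log ((k / A : ℕ) : ℝ) ≤ Real.log k - 2 * (2 * K + 1) := by
    calc _ ≤ Real.log ((k : ℝ) / A) := Real.log_le_log hm0' Nat.cast_div_le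
      _ = Real.log k - Real.log A := Real.log_div hk0.ne' hA0.ne'
      _ ≤ _ := by
        have := (Real.lt_log_iff_exp_lt hA0).2 hA
        linarith
  have h4 : 1 ≤ ∑ p ∈ primesMod 1 k \ primesMod 1 (k / A), Real.log p / p := by linarith
  have hk2 : (k : ℝ) / (2 * A) ≤ ((k / A : ℕ) : ℝ) := by
    have h5 := (natCast_div_bounds k A).1
    have h6 : (1 : ℝ) ≤ k / A / 2 := by
      rw [le_div_iff₀ (by norm_num), le_div_iff₀ hA0]
      have : ((2 * A : ℕ) : ℝ) ≤ k := by exact_mod_cast hk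
      push_cast at this
      linarith
    have h7 : (k : ℝ) / (2 * A) = k / A / 2 := by field_simp
    linarith
  calc 1 / (2 * (A : ℝ)) * k = k / (2 * A) * 1 := by ring
    _ ≤ ((k / A : ℕ) : ℝ) * ∑ p ∈ primesMod 1 k \ primesMod 1 (k / A), Real.log p / p := by
        gcongr
    _ ≤ ∑ p ∈ primesMod 1 k \ primesMod 1 (k / A), Real.log p := by
        rw [mul_sum]
        refine sum_le_sum fun p hp => ?_
        rw [Finset.mem_sdiff, mem_primesMod, mem_primesMod] at hp
        have hpl : k / A < p := by
          by_contra hcon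
          exact hp.2 ⟨by lia, hp.1.2⟩
        have hp0 : (0 : ℝ) < p := by exact_mod_cast hp.1.2.1.pos
        have hpl' : ((k / A : ℕ) : ℝ) ≤ p := by exact_mod_cast hpl.le
        have := Real.log_natCast_nonneg p
        calc _ ≤ (p : ℝ) * (Real.log p / p) := by gcongr
          _ = _ := by field_simp
    _ ≤ ∑ p ∈ primesMod 1 k, Real.log p :=
        sum_le_sum_of_subset_of_nonneg sdiff_subset fun p _ _ => Real.log_natCast_nonneg p

lemma log_log_sub_le {a b : ℝ} (ha : 1 < a) (hb : 1 < b) :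
    Real.log (Real.log b) - Real.log (Real.log a) ≤ (Real.log b - Real.log a) / Real.log a := by
  have h1 := Real.log_pos ha
  have h2 := Real.log_pos hb
  rw [← Real.log_div h2.ne' h1.ne']
  refine (Real.log_le_sub_one_of_pos (by positivity)).trans (le_of_eq ?_)
  field_simp

lemma abs_sum_log_sub_div_log_sub_le (N : ℕ) (hN : 2 ≤ N) :
    |∑ n ∈ Ioc 2 N, (Real.log n - Real.log (n - 1 : ℕ)) / Real.log n
      - Real.log (Real.log N)| ≤ 1 := by
  have hl2 := Real.log_two_gt_d9
  have hl2' := Real.log_two_lt_d9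
  have hl3 : Real.log 3 ≤ 1.4 := by
    have : Real.log 3 ≤ Real.log (2 ^ 2) := Real.log_le_log (by norm_num) (by norm_num)
    rw [Real.log_pow] at this
    push_cast at this; linarith
  have hll2 : -1 / 2 ≤ Real.log (Real.log 2) := by
    have := Real.one_sub_inv_le_log_of_pos (x := Real.log 2) (by linarith)
    have h : (Real.log 2)⁻¹ ≤ 3 / 2 := by
      rw [inv_le_comm₀ (by linarith) (by norm_num)]
      norm_num; linarith
    linarith
  have hll2' : Real.log (Real.log 2) ≤ 0 :=
    Real.log_nonpos (by linarith) (by linarith)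
  have hll3 : Real.log (Real.log 3) ≤ 0.4 := by
    have := Real.log_le_sub_one_of_pos (x := Real.log 3) (Real.log_pos (by norm_num))
    linarith
  have hup : ∑ n ∈ Ioc 2 N, (Real.log n - Real.log (n - 1 : ℕ)) / Real.log n ≤
      Real.log (Real.log N) - Real.log (Real.log 2) := by
    induction N, hN using Nat.le_induction with
    | base => simp
    | succ n hn ih =>
      rw [sum_Ioc_succ_top hn]
      have hn' : (1 : ℝ) < n := by exact_mod_cast hn
      have hn1 : (1 : ℝ) < (n + 1 : ℕ) := by push_cast; linarith
      have := log_log_sub_le hn1 hn'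
      simp only [Nat.add_sub_cancel]
      have h3 : (Real.log (n + 1 : ℕ) - Real.log n) / Real.log (n + 1 : ℕ) =
        - ((Real.log n - Real.log (n + 1 : ℕ)) / Real.log (n + 1 : ℕ)) := by ring
      rw [h3]
      linarith
  have hlow : Real.log (Real.log (N + 1 : ℕ)) - Real.log (Real.log 3) ≤
      ∑ n ∈ Ioc 2 N, (Real.log n - Real.log (n - 1 : ℕ)) / Real.log n := by
    clear hup
    induction N, hN using Nat.le_induction with
    | base => norm_num
    | succ n hn ih =>
      rw [sum_Ioc_succ_top hn]
      have hn' : (1 : ℝ) < n := by exact_mod_cast hn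
      have hn1 : (1 : ℝ) < (n + 1 : ℕ) := by push_cast; linarith
      have hn2 : (1 : ℝ) < (n + 1 + 1 : ℕ) := by push_cast; linarith
      have h3 := log_log_sub_le hn1 hn2
      simp only [Nat.add_sub_cancel]
      have h4 : Real.log (n + 1 + 1 : ℕ) - Real.log (n + 1 : ℕ) ≤
          Real.log (n + 1 : ℕ) - Real.log n := by
        rw [← Real.log_div (by positivity) (by positivity),
          ← Real.log_div (by positivity) (by positivity)]
        refine Real.log_le_log (by positivity) ?_
        rw [div_le_div_iff₀ (by positivity) (by positivity)]
        push_cast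
        nlinarith
      have h5 : 0 < Real.log (n + 1 : ℕ) := Real.log_pos hn1
      have h6 := div_le_div_of_nonneg_right h4 h5.le
      linarith
  have hmono : Real.log (Real.log N) ≤ Real.log (Real.log (N + 1 : ℕ)) := by
    have hN' : (1 : ℝ) < N := by exact_mod_cast hN
    refine Real.log_le_log (Real.log_pos hN') (Real.log_le_log (by linarith) ?_)
    push_cast; linarith
  rw [abs_le]
  constructor <;> linarith

lemma exists_abs_sum_primesMod_inv_sub_le {a : ℕ} (ha : a = 1 ∨ a = 3) :
    ∃ K : ℝ, 0 ≤ K ∧ ∀ N : ℕ, 2 ≤ N →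
      |∑ p ∈ primesMod a N, 1 / (p : ℝ) - 1 / 2 * Real.log (Real.log N)| ≤ K := by
  obtain ⟨K, hK0, hK⟩ := exists_abs_sum_primesMod_log_div_sub_le ha
  have hl2 := Real.log_two_gt_d9
  have hl2' := Real.log_two_lt_d9
  let c : ℕ → ℝ := fun n => if n.Prime ∧ n % 4 = a then Real.log n / n else 0
  let e : ℕ → ℝ := fun n => c n - 1 / 2 * (Real.log n - Real.log (n - 1 : ℕ))
  have hc : ∀ n, 2 ≤ n → ∑ i ∈ Ioc 2 n, c i = ∑ p ∈ primesMod a n, Real.log p / p := by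
    intro n hn
    rw [primesMod, sum_filter, ← sum_Ioc_consecutive _ (Nat.zero_le 2) hn]
    have : ∑ i ∈ Ioc 0 2, (if i.Prime ∧ i % 4 = a then Real.log i / i else 0) = 0 := by
      rcases ha with rfl | rfl <;> norm_num [sum_Ioc_succ_top]
    rw [this, zero_add]
  have htel : ∀ n : ℕ, 2 ≤ n → ∑ i ∈ Ioc 2 n, (Real.log i - Real.log (i - 1 : ℕ)) =
      Real.log n - Real.log 2 := by
    intro n hn
    induction n, hn using Nat.le_induction with
    | base => simp
    | succ n hn ih => rw [sum_Ioc_succ_top hn, ih]; simp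
  have he : ∀ n, 2 ≤ n → |∑ i ∈ Ioc 2 n, e i| ≤ K + 1 := by
    intro n hn
    simp only [e]
    rw [sum_sub_distrib, ← mul_sum, hc n hn, htel n hn]
    have := abs_le.1 (hK n (by lia))
    rw [abs_le]
    constructor <;> linarith
  refine ⟨(K + 1) * (1 / Real.log 3) + 1, by positivity, fun N hN => ?_⟩
  have h1 := abs_sum_mul_le_of_antitone (e := e) (g := fun n => 1 / Real.log n) he
    (fun n _ => by
      have := Real.log_natCast_nonneg n
      positivity)
    (fun n hn => by
      have hn' : (1 : ℝ) < n := by exact_mod_cast (by lia : 1 < n)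
      have := Real.log_pos hn'
      have h2 : Real.log n ≤ Real.log (n + 1 : ℕ) :=
        Real.log_le_log (by linarith) (by push_cast; linarith)
      gcongr) hN
  have h2 := abs_sum_log_sub_div_log_sub_le N hN
  have h3 : ∑ p ∈ primesMod a N, 1 / (p : ℝ) = ∑ i ∈ Ioc 2 N, e i * (1 / Real.log i) +
      1 / 2 * ∑ n ∈ Ioc 2 N, (Real.log n - Real.log (n - 1 : ℕ)) / Real.log n := by
    rw [mul_sum, ← sum_add_distrib, primesMod, sum_filter,
      ← sum_Ioc_consecutive _ (Nat.zero_le 2) hN]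
    have : ∑ i ∈ Ioc 0 2, (if i.Prime ∧ i % 4 = a then 1 / (i : ℝ) else 0) = 0 := by
      rcases ha with rfl | rfl <;> norm_num [sum_Ioc_succ_top]
    rw [this, zero_add]
    refine sum_congr rfl fun n hn => ?_
    have hn' : (1 : ℝ) < n := by exact_mod_cast (by have := mem_Ioc.1 hn; lia : 1 < n)
    have := Real.log_pos hn'
    simp only [e, c]
    split_ifs
    · field_simp; ring
    · field_simp; ring
  rw [h3]
  have h4 : ((2 + 1 : ℕ) : ℝ) = 3 := by norm_num
  simp only [h4] at h1
  rw [abs_le] at *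
  constructor <;> linarith

end PrimesModFour

section MultiplicativeMeans

open Finset ArithmeticFunction

/-- Non-negative multiplicative functions with `f (p ^ a) ≤ (63 / 50) ^ a`. -/
structure IsTameMul (f : ℕ → ℝ) : Prop where
  nonneg : ∀ n, 0 ≤ f n
  one : f 1 = 1
  mul : ∀ {m n : ℕ}, m.Coprime n → f (m * n) = f m * f n
  prime_pow_le : ∀ {p : ℕ}, p.Prime → ∀ a : ℕ, f (p ^ a) ≤ (63 / 50) ^ a

lemma sum_le_sum_of_injOn_of_le {α β : Type*} [DecidableEq β] {s : Finset α} {t : Finset β}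
    {g : α → ℝ} {h : β → ℝ} (i : α → β) (hi : ∀ x ∈ s, i x ∈ t) (hinj : Set.InjOn i s)
    (hle : ∀ x ∈ s, g x ≤ h (i x)) (h0 : ∀ y ∈ t, 0 ≤ h y) :
    ∑ x ∈ s, g x ≤ ∑ y ∈ t, h y := by
  calc _ ≤ ∑ x ∈ s, h (i x) := sum_le_sum hle
    _ = ∑ y ∈ s.image i, h y := (sum_image hinj).symm
    _ ≤ _ := sum_le_sum_of_subset_of_nonneg (image_subset_iff.2 hi) fun y hy _ => h0 y hy

lemma sum_Icc_two_pow_le {t : ℝ} (h0 : 0 ≤ t) (h1 : t ≤ 7 / 10) (N : ℕ) :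
    ∑ v ∈ Icc 2 N, t ^ v ≤ 10 / 3 * t ^ 2 := by
  have h := geom_sum_Ico_le_of_lt_one (x := t) (m := 2) (n := N + 1) h0 (by linarith)
  have h2 : Ico 2 (N + 1) = Icc 2 N := by ext; simp
  rw [h2] at h
  refine h.trans ?_
  rw [div_le_iff₀ (by linarith)]
  nlinarith [sq_nonneg t]

lemma one_div_sq_sum_le (N : ℕ) : ∑ p ∈ N.primesBelow, 1 / (p : ℝ) ^ 2 ≤ 1 := by
  have key : ∀ M : ℕ, ∑ n ∈ Ioc 1 (M + 1), 1 / (n : ℝ) ^ 2 ≤ 1 - 1 / ((M : ℝ) + 1) := by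
    intro M
    induction M with
    | zero => simp
    | succ M ih =>
      rw [sum_Ioc_succ_top (by lia)]
      have : 1 / ((M + 1 + 1 : ℕ) : ℝ) ^ 2 ≤ 1 / ((M : ℝ) + 1) - 1 / ((M + 1 : ℕ) + 1) := by
        push_cast
        rw [div_sub_div _ _ (by positivity) (by positivity),
          div_le_div_iff₀ (by positivity) (by positivity)]
        nlinarith
      linarith
  calc _ ≤ ∑ n ∈ Ioc 1 (N + 1), 1 / (n : ℝ) ^ 2 := by
        refine sum_le_sum_of_subset_of_nonneg (fun p hp => ?_) fun _ _ _ => by positivity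
        have := Nat.mem_primesBelow.1 hp
        exact mem_Ioc.2 ⟨this.2.one_lt, by lia⟩
    _ ≤ 1 - 1 / ((N : ℝ) + 1) := key N
    _ ≤ 1 := by
      have : (0 : ℝ) ≤ 1 / ((N : ℝ) + 1) := by positivity
      linarith

lemma IsTameMul.sum_div_le {f : ℕ → ℝ} (hf : IsTameMul f) (N : ℕ) :
    ∑ n ∈ Ioc 0 N, f n / n ≤
      Real.exp 6 * Real.exp (∑ p ∈ (N + 1).primesBelow, f p / p) := by
  let F : ℕ → ℝ := fun n => f n / n
  have hF0 : ∀ n, 0 ≤ F n := fun n => div_nonneg (hf.nonneg n) (by positivity)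
  have hFp : ∀ {p : ℕ}, p.Prime → ∀ a : ℕ, F (p ^ a) ≤ (63 / 50 / (p : ℝ)) ^ a := by
    intro p hp a
    simp only [F]
    rw [div_pow]
    push_cast
    have := hf.prime_pow_le hp a
    gcongr
  have ht : ∀ {p : ℕ}, p.Prime → 0 ≤ 63 / 50 / (p : ℝ) ∧ 63 / 50 / (p : ℝ) ≤ 7 / 10 := by
    intro p hp
    have h2 : (2 : ℝ) ≤ p := by exact_mod_cast hp.two_le
    refine ⟨by positivity, ?_⟩
    rw [div_le_iff₀ (by linarith)]
    linarith
  have hsum : ∀ {p : ℕ}, p.Prime → Summable fun n => F (p ^ n) := fun {p} hp =>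
    Summable.of_nonneg_of_le (fun n => hF0 _) (hFp hp)
      (summable_geometric_of_lt_one (ht hp).1 (by linarith [(ht hp).2]))
  have hE := EulerProduct.summable_and_hasSum_smoothNumbers_prod_primesBelow_tsum (f := F)
    (by simp [F, hf.one]) (fun {m n} hmn => by
      simp only [F]
      rw [hf.mul hmn]
      push_cast
      rw [mul_div_mul_comm])
    (fun {p} hp => (hsum hp).norm) (N + 1)
  have h1 : ∑ n ∈ Ioc 0 N, f n / n ≤ ∏ p ∈ (N + 1).primesBelow, ∑' n : ℕ, F (p ^ n) := by
    rw [← hE.2.tsum_eq]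
    have hsub : ∀ n ∈ Ioc 0 N, n ∈ (N + 1).smoothNumbers := fun n hn =>
      Nat.mem_smoothNumbers_of_lt (mem_Ioc.1 hn).1 (by have := (mem_Ioc.1 hn).2; lia)
    have h2 := hE.2.summable.sum_le_tsum ((Ioc 0 N).subtype fun n => n ∈ (N + 1).smoothNumbers)
      fun i _ => hF0 _
    refine le_trans (le_of_eq ?_) h2
    exact (Finset.sum_subtype_of_mem (fun n : ℕ => F n) hsub).symm
  refine h1.trans ?_
  have h3 : ∀ p ∈ (N + 1).primesBelow, ∑' n : ℕ, F (p ^ n) ≤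
      Real.exp (f p / p + 6 * (1 / (p : ℝ) ^ 2)) := by
    intro p hp
    have hp' := (Nat.mem_primesBelow.1 hp).2
    refine (hsum hp').tsum_le_of_sum_range_le fun n => ?_
    have h4 : ∑ i ∈ range n, F (p ^ i) ≤ 1 + f p / p + ∑ i ∈ Icc 2 (n + 1), F (p ^ i) := by
      calc _ ≤ ∑ i ∈ range (n + 2), F (p ^ i) :=
            sum_le_sum_of_subset_of_nonneg (range_subset_range.2 (by lia)) fun _ _ _ => hF0 _
        _ = ∑ i ∈ range 2, F (p ^ i) + ∑ i ∈ Ico 2 (n + 2), F (p ^ i) :=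
            (sum_range_add_sum_Ico _ (by lia)).symm
        _ = _ := by
          rw [sum_range_succ, sum_range_one]
          have : Ico 2 (n + 2) = Icc 2 (n + 1) := by ext; simp; lia
          rw [this]
          simp [F, hf.one]
    have h5 := (sum_le_sum fun i (_ : i ∈ Icc 2 (n + 1)) => hFp hp' i).trans
      (sum_Icc_two_pow_le (ht hp').1 (ht hp').2 (n + 1))
    have h6 : 10 / 3 * (63 / 50 / (p : ℝ)) ^ 2 ≤ 6 * (1 / (p : ℝ) ^ 2) := by
      rw [div_pow]
      have : 0 ≤ 1 / (p : ℝ) ^ 2 := by positivity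
      calc _ = 10 / 3 * (63 / 50) ^ 2 * (1 / (p : ℝ) ^ 2) := by ring
        _ ≤ _ := by gcongr; norm_num
    have := Real.add_one_le_exp (f p / p + 6 * (1 / (p : ℝ) ^ 2))
    linarith
  refine (prod_le_prod (fun p _ => tsum_nonneg fun n => hF0 _) h3).trans ?_
  rw [← Real.exp_sum, ← Real.exp_add, sum_add_distrib, ← mul_sum]
  refine Real.exp_le_exp.2 ?_
  linarith [one_div_sq_sum_le (N + 1)]

lemma natCast_mul_pow_le (v : ℕ) : (v : ℝ) * (63 / 50) ^ v ≤ 9 * (7 / 5) ^ v := by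
  have h := one_add_mul_le_pow (a := (1 / 9 : ℝ)) (by norm_num) v
  have h1 : (7 / 5 : ℝ) ^ v = (1 + 1 / 9) ^ v * (63 / 50) ^ v := by
    rw [← mul_pow]; norm_num
  rw [h1, ← mul_assoc]
  gcongr
  linarith

lemma exists_sum_primesBelow_prime_pow_le :
    ∃ C : ℝ, 0 ≤ C ∧ ∀ N M : ℕ, ∑ p ∈ N.primesBelow, ∑ v ∈ Icc 2 M,
      (63 / 50 : ℝ) ^ v * (v * Real.log p) / (p : ℝ) ^ v ≤ C := by
  have hs : Summable fun n : ℕ => 1 / (n : ℝ) ^ (3 / 2 : ℝ) :=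
    Real.summable_one_div_nat_rpow.2 (by norm_num)
  have h0 : ∀ n : ℕ, 0 ≤ 1 / (n : ℝ) ^ (3 / 2 : ℝ) := fun n => by positivity
  refine ⟨120 * ∑' n : ℕ, 1 / (n : ℝ) ^ (3 / 2 : ℝ), mul_nonneg (by norm_num) (tsum_nonneg h0), fun N M => ?_⟩
  refine le_trans ?_ (mul_le_mul_of_nonneg_left
    (hs.sum_le_tsum N.primesBelow fun n _ => h0 n) (by norm_num))
  rw [mul_sum]
  refine sum_le_sum fun p hp => ?_
  have hp' := (Nat.mem_primesBelow.1 hp).2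
  have h2 : (2 : ℝ) ≤ p := by exact_mod_cast hp'.two_le
  have hp0 : (0 : ℝ) < p := by linarith
  have hlog := Real.log_natCast_nonneg p
  have hlog2 : Real.log p ≤ 2 * (p : ℝ) ^ (1 / 2 : ℝ) := by
    have := Real.log_le_rpow_div hp0.le (ε := 1 / 2) (by norm_num)
    linarith
  have ht : 7 / 5 / (p : ℝ) ≤ 7 / 10 := by
    rw [div_le_iff₀ hp0]; linarith
  calc _ ≤ ∑ v ∈ Icc 2 M, 9 * Real.log p * (7 / 5 / (p : ℝ)) ^ v := by
        refine sum_le_sum fun v _ => ?_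
        have := natCast_mul_pow_le v
        rw [div_pow (7 / 5 : ℝ)]
        calc (63 / 50 : ℝ) ^ v * (v * Real.log p) / (p : ℝ) ^ v
            = (v * (63 / 50) ^ v) * Real.log p / (p : ℝ) ^ v := by ring
          _ ≤ (9 * (7 / 5) ^ v) * Real.log p / (p : ℝ) ^ v := by gcongr
          _ = _ := by ring
    _ = 9 * Real.log p * ∑ v ∈ Icc 2 M, (7 / 5 / (p : ℝ)) ^ v := by rw [mul_sum]
    _ ≤ 9 * (2 * (p : ℝ) ^ (1 / 2 : ℝ)) * (10 / 3 * (7 / 5 / (p : ℝ)) ^ 2) := by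
        have := sum_Icc_two_pow_le (by positivity) ht M
        gcongr
    _ = (9 * 2 * (10 / 3) * (7 / 5) ^ 2) * ((p : ℝ) ^ (1 / 2 : ℝ) / (p : ℝ) ^ 2) := by ring
    _ ≤ 120 * ((p : ℝ) ^ (1 / 2 : ℝ) / (p : ℝ) ^ 2) := by gcongr; norm_num
    _ = _ := by
      rw [← Real.rpow_natCast, ← Real.rpow_sub hp0, one_div ((p : ℝ) ^ (3 / 2 : ℝ)),
        ← Real.rpow_neg hp0.le]
      norm_num

/-- Upper bound for mean values of tame multiplicative functions. -/
lemma exists_isTameMul_sum_le : ∃ K : ℝ, 0 < K ∧ ∀ f : ℕ → ℝ, IsTameMul f → ∀ N : ℕ, 2 ≤ N →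
    ∑ n ∈ Ioc 0 N, f n ≤
      K * (N / Real.log N) * Real.exp (∑ p ∈ (N + 1).primesBelow, f p / p) := by
  obtain ⟨C, hC0, hC⟩ := exists_sum_primesBelow_prime_pow_le
  refine ⟨(63 / 50 * 6 + C + 1) * Real.exp 6, by positivity, fun f hf N hN => ?_⟩
  have hN' : (1 : ℝ) < N := by exact_mod_cast hN
  have hlN := Real.log_pos hN'
  have hS := hf.sum_div_le N
  let h : ℕ × ℕ × ℕ → ℝ := fun x => if x.1 * x.2.1 ^ x.2.2 ≤ N then
    f x.1 * f (x.2.1 ^ x.2.2) * (x.2.2 * Real.log x.2.1) else 0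
  have hh0 : ∀ x, 0 ≤ h x := fun x => by
    simp only [h]
    split_ifs
    · have := hf.nonneg x.1
      have := hf.nonneg (x.2.1 ^ x.2.2)
      have := Real.log_natCast_nonneg x.2.1
      positivity
    · rfl
  have h1 : ∑ n ∈ Ioc 0 N, f n * Real.log n ≤
      ∑ x ∈ Ioc 0 N ×ˢ (N + 1).primesBelow ×ˢ Icc 1 N, h x := by
    have : ∀ n ∈ Ioc 0 N, f n * Real.log n =
        ∑ p ∈ n.primeFactors, f n * (n.factorization p * Real.log p) := fun n _ => by
      rw [Real.log_nat_eq_sum_factorization, Finsupp.sum, mul_sum]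
      rfl
    rw [sum_congr rfl this, sum_sigma']
    refine sum_le_sum_of_injOn_of_le
      (fun x : (_ : ℕ) × ℕ => (x.1 / x.2 ^ x.1.factorization x.2, x.2, x.1.factorization x.2))
      ?_ ?_ ?_ fun y _ => hh0 y
    · rintro ⟨n, p⟩ hx
      simp only [mem_sigma, mem_Ioc, Nat.mem_primeFactors] at hx
      obtain ⟨⟨hn0, hnN⟩, hp, hpn, -⟩ := hx
      simp only [mem_product, mem_Ioc, Nat.mem_primesBelow, mem_Icc]
      refine ⟨⟨?_, (Nat.div_le_self _ _).trans hnN⟩, ⟨?_, hp⟩, ?_, ?_⟩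
      · exact Nat.div_pos (Nat.ordProj_le p hn0.ne') (pow_pos hp.pos _)
      · have := Nat.le_of_dvd hn0 hpn
        lia
      · exact hp.factorization_pos_of_dvd hn0.ne' hpn
      · exact (Nat.factorization_lt p hn0.ne').le.trans hnN
    · rintro ⟨n, p⟩ hx ⟨n', p'⟩ hx' heq
      simp only [Prod.mk.injEq] at heq
      obtain ⟨e1, rfl, e3⟩ := heq
      have := Nat.ordProj_mul_ordCompl_eq_self n p
      rw [e1, e3, Nat.ordProj_mul_ordCompl_eq_self] at this
      rw [this]
    · rintro ⟨n, p⟩ hx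
      simp only [mem_sigma, mem_Ioc, Nat.mem_primeFactors] at hx
      obtain ⟨⟨hn0, hnN⟩, hp, hpn, -⟩ := hx
      have e := Nat.ordProj_mul_ordCompl_eq_self n p
      simp only [h]
      rw [if_pos (by rw [mul_comm, e]; exact hnN)]
      have hc : (p ^ n.factorization p).Coprime (n / p ^ n.factorization p) :=
        (Nat.coprime_ordCompl hp hn0.ne').pow_left _
      have : f n = f (n / p ^ n.factorization p) * f (p ^ n.factorization p) := by
        rw [mul_comm, ← hf.mul hc, e]
      rw [this]
  have h2 : ∀ m ∈ Ioc 0 N, ∑ y ∈ (N + 1).primesBelow ×ˢ Icc 1 N, h (m, y) ≤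
      (63 / 50 * 6 + C) * N * (f m / m) := by
    intro m hm
    have hm0 : 0 < m := (mem_Ioc.1 hm).1
    have hm0' : (0 : ℝ) < m := by exact_mod_cast hm0
    have hfm := hf.nonneg m
    rw [sum_product]
    have h3 : ∀ p ∈ (N + 1).primesBelow, ∑ v ∈ Icc 1 N, h (m, p, v) ≤
        (if p ≤ N / m then f m * (63 / 50 * Real.log p) else 0) +
          f m * (N / m) * ∑ v ∈ Icc 2 N, (63 / 50 : ℝ) ^ v * (v * Real.log p) / (p : ℝ) ^ v := by
      intro p hp
      have hp' := (Nat.mem_primesBelow.1 hp).2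
      have hp0 : (0 : ℝ) < p := by exact_mod_cast hp'.pos
      have hlp := Real.log_natCast_nonneg p
      have hsplit : Icc 1 N = insert 1 (Icc 2 N) := by
        ext v; simp only [mem_Icc, mem_insert]; lia
      rw [hsplit, sum_insert (by simp)]
      refine add_le_add ?_ ?_
      · simp only [h, pow_one]
        by_cases hc : m * p ≤ N
        · rw [if_pos hc, if_pos ((Nat.le_div_iff_mul_le hm0).2 (by rw [mul_comm]; exact hc))]
          have h4 := hf.prime_pow_le hp' 1
          simp only [pow_one] at h4
          rw [mul_assoc, Nat.cast_one, one_mul]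
          gcongr
        · rw [if_neg hc]
          split_ifs <;> positivity
      · rw [mul_sum]
        refine sum_le_sum fun v _ => ?_
        simp only [h]
        have h4 := hf.prime_pow_le hp' v
        split_ifs with hc
        · have h5 : (1 : ℝ) ≤ N / (m * (p : ℝ) ^ v) := by
            rw [le_div_iff₀ (by positivity), one_mul]
            exact_mod_cast hc
          calc f m * f (p ^ v) * (v * Real.log p)
              ≤ f m * (63 / 50) ^ v * (v * Real.log p) * 1 := by rw [mul_one]; gcongr
            _ ≤ f m * (63 / 50) ^ v * (v * Real.log p) * (N / (m * (p : ℝ) ^ v)) := by gcongr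
            _ = _ := by field_simp
        · positivity
    refine (sum_le_sum h3).trans ?_
    rw [sum_add_distrib, ← mul_sum]
    have h6 : ∑ p ∈ (N + 1).primesBelow, (if p ≤ N / m then f m * (63 / 50 * Real.log p) else 0)
        ≤ f m * (63 / 50 * (6 * (N / m))) := by
      rw [← sum_filter, ← mul_sum, ← mul_sum]
      have h7 : ∑ p ∈ (N + 1).primesBelow with p ≤ N / m, Real.log p ≤
          ∑ n ∈ Ioc 0 (N / m), vonMangoldt n := by
        calc _ = ∑ p ∈ (N + 1).primesBelow with p ≤ N / m, vonMangoldt p := by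
              refine sum_congr rfl fun p hp => ?_
              rw [vonMangoldt_apply_prime (Nat.mem_primesBelow.1 (mem_filter.1 hp).1).2]
          _ ≤ _ := by
              refine sum_le_sum_of_subset_of_nonneg (fun p hp => ?_)
                fun _ _ _ => vonMangoldt_nonneg
              have := mem_filter.1 hp
              exact mem_Ioc.2 ⟨(Nat.mem_primesBelow.1 this.1).2.pos, this.2⟩
      have h8 := sum_vonMangoldt_le (N / m)
      have h9 : ((N / m : ℕ) : ℝ) ≤ N / m := Nat.cast_div_le
      gcongr
      linarith
    have h10 : f m * (N / m) * ∑ p ∈ (N + 1).primesBelow, ∑ v ∈ Icc 2 N,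
        (63 / 50 : ℝ) ^ v * (v * Real.log p) / (p : ℝ) ^ v ≤ f m * (N / m) * C := by
      have := hC (N + 1) N
      gcongr
    calc _ ≤ f m * (63 / 50 * (6 * (N / m))) + f m * (N / m) * C := add_le_add h6 h10
      _ = _ := by ring
  rw [sum_product] at h1
  have h3 := h1.trans (sum_le_sum h2)
  rw [← mul_sum] at h3
  have h4 : ∑ n ∈ Ioc 0 N, f n * (Real.log N - Real.log n) ≤ N * ∑ n ∈ Ioc 0 N, f n / n := by
    rw [mul_sum]
    refine sum_le_sum fun n hn => ?_
    have hn0 : (0 : ℝ) < n := by exact_mod_cast (mem_Ioc.1 hn).1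
    have hfn := hf.nonneg n
    rw [← Real.log_div (by linarith) hn0.ne']
    have := Real.log_le_self (x := N / n) (by positivity)
    calc _ ≤ f n * (N / n) := by gcongr
      _ = _ := by ring
  have h5 : Real.log N * ∑ n ∈ Ioc 0 N, f n ≤
      (63 / 50 * 6 + C + 1) * N * ∑ n ∈ Ioc 0 N, f n / n := by
    have : Real.log N * ∑ n ∈ Ioc 0 N, f n = ∑ n ∈ Ioc 0 N, f n * Real.log n +
        ∑ n ∈ Ioc 0 N, f n * (Real.log N - Real.log n) := by
      rw [← sum_add_distrib, mul_sum]
      exact sum_congr rfl fun n _ => by ring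
    rw [this]
    linarith
  have h6 : Real.log N * ∑ n ∈ Ioc 0 N, f n ≤ (63 / 50 * 6 + C + 1) * N *
      (Real.exp 6 * Real.exp (∑ p ∈ (N + 1).primesBelow, f p / p)) := by
    refine h5.trans ?_
    gcongr
  rw [mul_comm, ← le_div_iff₀ hlN] at h6
  refine h6.trans (le_of_eq ?_)
  ring

end MultiplicativeMeans

noncomputable section SumsOfTwoSquares

open Finset
open scoped Classical

lemma mem_SOS_iff_exists_nat {n : ℕ} : n ∈ SOS ↔ ∃ x y : ℕ, n = x ^ 2 + y ^ 2 := by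
  constructor
  · rintro ⟨x, y, h⟩
    refine ⟨x.natAbs, y.natAbs, ?_⟩
    zify
    simpa using h
  · rintro ⟨x, y, h⟩
    exact ⟨x, y, by exact_mod_cast h⟩

lemma mem_SOS_iff_even {n : ℕ} :
    n ∈ SOS ↔ ∀ {q : ℕ}, q ∈ n.primeFactors → q % 4 = 3 → Even (padicValNat q n) := by
  rw [mem_SOS_iff_exists_nat]
  exact Nat.eq_sq_add_sq_iff

lemma SOS_mul_mem {m n : ℕ} (hm : m ∈ SOS) (hn : n ∈ SOS) : m * n ∈ SOS := by
  rw [mem_SOS_iff_exists_nat] at *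
  obtain ⟨a, b, h1⟩ := hm
  obtain ⟨c, d, h2⟩ := hn
  exact Nat.sq_add_sq_mul h1 h2

lemma one_mem_SOS : 1 ∈ SOS := ⟨1, 0, by norm_num⟩

lemma zero_mem_SOS : 0 ∈ SOS := ⟨0, 0, by norm_num⟩

lemma prime_mem_SOS {p : ℕ} (hp : p.Prime) (h : p % 4 ≠ 3) : p ∈ SOS := by
  have := Fact.mk hp
  obtain ⟨a, b, hab⟩ := Nat.Prime.sq_add_sq h
  exact mem_SOS_iff_exists_nat.2 ⟨a, b, hab.symm⟩

lemma even_padicValNat_of_mem_SOS {n q : ℕ} (hn : n ∈ SOS) (hq : q.Prime) (h3 : q % 4 = 3) :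
    Even (padicValNat q n) := by
  by_cases h : q ∈ n.primeFactors
  · exact mem_SOS_iff_even.1 hn h h3
  · by_cases h0 : n = 0
    · simp [h0]
    · rw [padicValNat.eq_zero_of_not_dvd fun hd => h (Nat.mem_primeFactors.2 ⟨hq, hd, h0⟩)]
      simp

lemma prime_notMem_SOS {p : ℕ} (hp : p.Prime) (h : p % 4 = 3) : p ∉ SOS := by
  intro hm
  have := Fact.mk hp
  have := even_padicValNat_of_mem_SOS hm hp h
  rw [padicValNat_self] at this
  exact absurd this (by decide)

lemma coprime_mul_mem_SOS_iff {m n : ℕ} (hm : m ≠ 0) (hn : n ≠ 0) (h : m.Coprime n) :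
    m * n ∈ SOS ↔ m ∈ SOS ∧ n ∈ SOS := by
  refine ⟨fun hmn => ?_, fun h => SOS_mul_mem h.1 h.2⟩
  have key : ∀ q : ℕ, q.Prime → q % 4 = 3 →
      Even (padicValNat q m) ∧ Even (padicValNat q n) := by
    intro q hq h3
    have := Fact.mk hq
    have h1 := even_padicValNat_of_mem_SOS hmn hq h3
    rw [padicValNat.mul hm hn] at h1
    by_cases hd : q ∣ m
    · have hd' : ¬ q ∣ n := fun hd' => hq.one_lt.ne' (Nat.eq_one_of_dvd_coprimes h hd hd')
      rw [padicValNat.eq_zero_of_not_dvd hd'] at *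
      simpa using h1
    · rw [padicValNat.eq_zero_of_not_dvd hd] at *
      simpa using h1
  exact ⟨mem_SOS_iff_even.2 fun hq h3 => (key _ (Nat.prime_of_mem_primeFactors hq) h3).1,
    mem_SOS_iff_even.2 fun hq h3 => (key _ (Nat.prime_of_mem_primeFactors hq) h3).2⟩

/-- The weight `z ^ e n` on positive sums of two squares, zero elsewhere. -/
def sosWeight (e : ℕ → ℕ) (z : ℝ) (n : ℕ) : ℝ := if n ∈ SOS ∧ n ≠ 0 then z ^ e n else 0

/-- Additive functions behaving like `ω₁` on primes. -/
structure IsOmegaLike (e : ℕ → ℕ) : Prop where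
  mul : ∀ {m n : ℕ}, m ≠ 0 → n ≠ 0 → m.Coprime n → e (m * n) = e m + e n
  pow_le : ∀ {p : ℕ}, p.Prime → ∀ a : ℕ, e (p ^ a) ≤ a
  prime : ∀ {p : ℕ}, p.Prime → p % 4 = 1 → e p = 1

lemma sosWeight_nonneg (e : ℕ → ℕ) {z : ℝ} (hz : 0 ≤ z) (n : ℕ) : 0 ≤ sosWeight e z n := by
  unfold sosWeight
  split_ifs <;> positivity

lemma IsOmegaLike.isTameMul {e : ℕ → ℕ} (he : IsOmegaLike e) {z : ℝ} (hz : 0 ≤ z)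
    (hz' : z ≤ 63 / 50) : IsTameMul (sosWeight e z) where
  nonneg := sosWeight_nonneg e hz
  one := by
    have := he.pow_le Nat.prime_two 0
    simp only [pow_zero] at this
    rw [sosWeight, if_pos ⟨one_mem_SOS, one_ne_zero⟩, Nat.le_zero.1 this, pow_zero]
  mul := by
    intro m n h
    unfold sosWeight
    by_cases hm : m = 0
    · simp [hm]
    by_cases hn : n = 0
    · simp [hn]
    rw [coprime_mul_mem_SOS_iff hm hn h, he.mul hm hn h, pow_add]
    by_cases h1 : m ∈ SOS <;> by_cases h2 : n ∈ SOS <;> simp [h1, h2, hm, hn]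
  prime_pow_le := by
    intro p hp a
    unfold sosWeight
    split_ifs
    · calc z ^ e (p ^ a) ≤ (63 / 50) ^ e (p ^ a) := by gcongr
        _ ≤ _ := pow_le_pow_right₀ (by norm_num) (he.pow_le hp a)
    · positivity

lemma exp_mul_log_log {N : ℕ} (hN : 2 ≤ N) (c : ℝ) :
    Real.exp (c * Real.log (Real.log N)) = Real.log N ^ c := by
  have hN' : (1 : ℝ) < N := by exact_mod_cast hN
  rw [Real.rpow_def_of_pos (Real.log_pos hN'), mul_comm]

lemma exists_sum_sosWeight_le : ∃ K : ℝ, 0 < K ∧ ∀ e : ℕ → ℕ, IsOmegaLike e → ∀ z : ℝ, 0 ≤ z →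
    z ≤ 63 / 50 → ∀ N : ℕ, 2 ≤ N →
      ∑ n ∈ Ioc 0 N, sosWeight e z n ≤ K * N * Real.log N ^ (z / 2 - 1) := by
  obtain ⟨K, hK0, hK⟩ := exists_isTameMul_sum_le
  obtain ⟨K₁, hK₁0, hK₁⟩ := exists_abs_sum_primesMod_inv_sub_le (a := 1) (Or.inl rfl)
  refine ⟨K * Real.exp (1 + 63 / 50 * K₁), by positivity, fun e he z hz hz' N hN => ?_⟩
  have hN' : (1 : ℝ) < N := by exact_mod_cast hN
  have hlN := Real.log_pos hN'
  have hf := he.isTameMul hz hz'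
  have h1 : ∑ p ∈ (N + 1).primesBelow, sosWeight e z p / p ≤
      1 + ∑ p ∈ primesMod 1 N, z * (1 / (p : ℝ)) := by
    have hsub : (N + 1).primesBelow ⊆ insert 2 (primesMod 1 N ∪ primesMod 3 N) := by
      intro p hp
      obtain ⟨h2, h3⟩ := Nat.mem_primesBelow.1 hp
      simp only [mem_insert, mem_union, mem_primesMod]
      rcases h3.eq_two_or_odd with h | h
      · exact Or.inl h
      · have : p % 4 = 1 ∨ p % 4 = 3 := by lia
        rcases this with h | h
        · exact Or.inr (Or.inl ⟨by lia, h3, h⟩)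
        · exact Or.inr (Or.inr ⟨by lia, h3, h⟩)
    have hnn : ∀ p : ℕ, 0 ≤ sosWeight e z p / p := fun p =>
      div_nonneg (hf.nonneg p) (by positivity)
    refine (sum_le_sum_of_subset_of_nonneg hsub fun p _ _ => hnn p).trans ?_
    rw [sum_insert (by simp [mem_primesMod]), sum_union (disjoint_left.2 fun p h h' => by
      rw [mem_primesMod] at h h'; lia)]
    have h2 : sosWeight e z 2 / (2 : ℕ) ≤ 1 := by
      have := hf.prime_pow_le Nat.prime_two 1
      norm_num at this ⊢
      linarith
    have h3 : ∑ p ∈ primesMod 3 N, sosWeight e z p / p = 0 := by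
      refine sum_eq_zero fun p hp => ?_
      rw [mem_primesMod] at hp
      simp [sosWeight, prime_notMem_SOS hp.2.1 hp.2.2]
    have h4 : ∑ p ∈ primesMod 1 N, sosWeight e z p / p =
        ∑ p ∈ primesMod 1 N, z * (1 / (p : ℝ)) := by
      refine sum_congr rfl fun p hp => ?_
      rw [mem_primesMod] at hp
      rw [sosWeight, if_pos ⟨prime_mem_SOS hp.2.1 (by lia), hp.2.1.ne_zero⟩,
        he.prime hp.2.1 hp.2.2, pow_one]
      ring
    rw [h3, h4]
    linarith
  rw [← mul_sum] at h1
  have h2 := (abs_le.1 (hK₁ N hN)).2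
  have h3 : ∑ p ∈ (N + 1).primesBelow, sosWeight e z p / p ≤
      (1 + 63 / 50 * K₁) + z / 2 * Real.log (Real.log N) := by
    have : z * (∑ p ∈ primesMod 1 N, 1 / (p : ℝ) - 1 / 2 * Real.log (Real.log N)) ≤
        63 / 50 * K₁ := by
      calc _ ≤ z * K₁ := by gcongr
        _ ≤ _ := by gcongr
    nlinarith
  calc _ ≤ K * (N / Real.log N) * Real.exp (∑ p ∈ (N + 1).primesBelow, sosWeight e z p / p) :=
        hK _ hf N hN
    _ ≤ K * (N / Real.log N) *
        Real.exp ((1 + 63 / 50 * K₁) + z / 2 * Real.log (Real.log N)) := by gcongr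
    _ = _ := by
      rw [Real.exp_add, exp_mul_log_log hN, Real.rpow_sub hlN, Real.rpow_one]
      ring

/-- The positive sums of two squares up to `N`. -/
def sosIoc (N : ℕ) : Finset ℕ := (Ioc 0 N).filter (· ∈ SOS)

lemma mem_sosIoc {N n : ℕ} : n ∈ sosIoc N ↔ (0 < n ∧ n ≤ N) ∧ n ∈ SOS := by
  simp [sosIoc]

lemma exists_mul_eq_SOS_three (n : ℕ) (hn : n ≠ 0) :
    ∃ m t : ℕ, m * t = n ∧ m ∈ SOS ∧ ∀ p : ℕ, p.Prime → p ∣ t → p % 4 = 3 := by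
  induction n using induction_on_primes with
  | zero => exact absurd rfl hn
  | one => exact ⟨1, 1, rfl, one_mem_SOS, fun p hp h => absurd (Nat.dvd_one.1 h) hp.one_lt.ne'⟩
  | prime_mul p a hp ih =>
    obtain ⟨m, t, rfl, h1, h2⟩ := ih (by rintro rfl; simp at hn)
    by_cases h3 : p % 4 = 3
    · refine ⟨m, p * t, by ring, h1, fun q hq hqt => ?_⟩
      rcases (Nat.Prime.dvd_mul hq).1 hqt with h | h
      · rwa [(Nat.prime_dvd_prime_iff_eq hq hp).1 h]
      · exact h2 q hq h
    · exact ⟨p * m, t, by ring, SOS_mul_mem (prime_mem_SOS hp h3) h1, h2⟩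

lemma exists_le_sum_sosIoc_inv : ∃ c : ℝ, 0 < c ∧ ∀ N : ℕ, 2 ≤ N →
    c * Real.log N ^ (1 / 2 : ℝ) ≤ ∑ m ∈ sosIoc N, 1 / (m : ℝ) := by
  obtain ⟨K, hK0, hK⟩ := exists_abs_sum_primesMod_inv_sub_le (a := 3) (Or.inr rfl)
  let T : ℕ → ℝ := fun t => if t ≠ 0 ∧ ∀ p : ℕ, p.Prime → p ∣ t → p % 4 = 3 then 1 else 0
  have hT0 : ∀ t, 0 ≤ T t := fun t => by simp only [T]; split_ifs <;> norm_num
  have hT : IsTameMul T :=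
    { nonneg := hT0
      one := if_pos ⟨one_ne_zero, fun p hp h => absurd (Nat.dvd_one.1 h) hp.one_lt.ne'⟩
      mul := by
        intro m n h
        have : (m * n ≠ 0 ∧ ∀ p : ℕ, p.Prime → p ∣ m * n → p % 4 = 3) ↔
            (m ≠ 0 ∧ ∀ p : ℕ, p.Prime → p ∣ m → p % 4 = 3) ∧
            (n ≠ 0 ∧ ∀ p : ℕ, p.Prime → p ∣ n → p % 4 = 3) := by
          constructor
          · rintro ⟨h0, h1⟩
            exact ⟨⟨left_ne_zero_of_mul h0, fun p hp hd => h1 p hp (hd.mul_right n)⟩,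
              ⟨right_ne_zero_of_mul h0, fun p hp hd => h1 p hp (hd.mul_left m)⟩⟩
          · rintro ⟨⟨h0, h1⟩, h2, h3⟩
            refine ⟨mul_ne_zero h0 h2, fun p hp hd => ?_⟩
            rcases (Nat.Prime.dvd_mul hp).1 hd with h | h
            exacts [h1 p hp h, h3 p hp h]
        simp only [T]
        by_cases h1 : m ≠ 0 ∧ ∀ p : ℕ, p.Prime → p ∣ m → p % 4 = 3
        · by_cases h2 : n ≠ 0 ∧ ∀ p : ℕ, p.Prime → p ∣ n → p % 4 = 3
          · rw [if_pos h1, if_pos h2, if_pos (this.2 ⟨h1, h2⟩), one_mul]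
          · rw [if_neg h2, if_neg fun h3 => h2 (this.1 h3).2, mul_zero]
        · rw [if_neg h1, if_neg fun h3 => h1 (this.1 h3).1, zero_mul]
      prime_pow_le := by
        intro p _ a
        refine le_trans ?_ (one_le_pow₀ (by norm_num))
        simp only [T]
        split_ifs <;> norm_num }
  refine ⟨1 / Real.exp (6 + K), by positivity, fun N hN => ?_⟩
  have hN' : (1 : ℝ) < N := by exact_mod_cast hN
  have hlN := Real.log_pos hN'
  have h1 : Real.log N ≤ (∑ m ∈ sosIoc N, 1 / (m : ℝ)) * ∑ t ∈ Ioc 0 N, T t / t := by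
    have h2 : Real.log N ≤ ∑ n ∈ Ioc 0 N, 1 / (n : ℝ) := by
      have h3 := log_add_one_le_harmonic N
      rw [harmonic_eq_sum_Icc] at h3
      push_cast at h3
      have h4 : Icc 1 N = Ioc 0 N := by ext; simp; lia
      rw [h4] at h3
      refine (Real.log_le_log (by linarith) (by linarith)).trans (h3.trans ?_)
      simp
    refine h2.trans ?_
    rw [sum_mul_sum, ← sum_product']
    choose! m t hmt hm ht using exists_mul_eq_SOS_three
    refine sum_le_sum_of_injOn_of_le (fun n => (m n, t n)) ?_ ?_ ?_ ?_
    · intro n hn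
      have hn' := mem_Ioc.1 hn
      have h := hmt n hn'.1.ne'
      have hm0 : m n ≠ 0 := by rintro h0; rw [h0] at h; lia
      have ht0 : t n ≠ 0 := by rintro h0; rw [h0] at h; lia
      have hle1 : m n ≤ n := Nat.le_of_dvd hn'.1 (Dvd.intro _ h)
      have hle2 : t n ≤ n := Nat.le_of_dvd hn'.1 (Dvd.intro_left _ h)
      simp only [mem_product, mem_sosIoc, mem_Ioc]
      exact ⟨⟨⟨by lia, by lia⟩, hm n hn'.1.ne'⟩, by lia, by lia⟩
    · intro a ha b hb hab
      simp only [Prod.mk.injEq] at hab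
      have ha' := mem_Ioc.1 (mem_coe.1 ha)
      have hb' := mem_Ioc.1 (mem_coe.1 hb)
      rw [← hmt a ha'.1.ne', ← hmt b hb'.1.ne', hab.1, hab.2]
    · intro n hn
      have hn' := mem_Ioc.1 hn
      have h := hmt n hn'.1.ne'
      have ht0 : t n ≠ 0 := by rintro h0; rw [h0] at h; lia
      simp only [T]
      rw [if_pos ⟨ht0, ht n hn'.1.ne'⟩]
      conv_lhs => rw [← h]
      push_cast
      exact le_of_eq (by rw [one_div_mul_one_div])
    · rintro ⟨a, b⟩ _
      have := hT0 b
      positivity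
  have h2 : ∑ t ∈ Ioc 0 N, T t / t ≤ Real.exp (6 + K) * Real.log N ^ (1 / 2 : ℝ) := by
    refine (hT.sum_div_le N).trans ?_
    rw [Real.exp_add, mul_assoc]
    gcongr
    rw [← exp_mul_log_log hN, ← Real.exp_add]
    refine Real.exp_le_exp.2 ?_
    have h3 := (abs_le.1 (hK N hN)).2
    have h4 : ∑ p ∈ (N + 1).primesBelow, T p / p ≤ ∑ p ∈ primesMod 3 N, 1 / (p : ℝ) := by
      rw [← sum_filter_add_sum_filter_not _ (fun p => p % 4 = 3)]
      have h5 : ∑ p ∈ (N + 1).primesBelow with ¬ p % 4 = 3, T p / p = 0 := by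
        refine sum_eq_zero fun p hp => ?_
        rw [mem_filter, Nat.mem_primesBelow] at hp
        have : T p = 0 := if_neg fun h => hp.2 (h.2 p hp.1.2 dvd_rfl)
        simp [this]
      rw [h5, add_zero]
      calc _ ≤ ∑ p ∈ (N + 1).primesBelow with p % 4 = 3, 1 / (p : ℝ) := by
            refine sum_le_sum fun p _ => ?_
            have : T p ≤ 1 := by simp only [T]; split_ifs <;> norm_num
            gcongr
        _ ≤ _ := by
            refine sum_le_sum_of_subset_of_nonneg (fun p hp => ?_) fun _ _ _ => by positivity
            rw [mem_filter, Nat.mem_primesBelow] at hp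
            exact mem_primesMod.2 ⟨by lia, hp.1.2, hp.2⟩
    linarith
  have hS0 : 0 ≤ ∑ m ∈ sosIoc N, 1 / (m : ℝ) := sum_nonneg fun _ _ => by positivity
  have h3 := h1.trans (mul_le_mul_of_nonneg_left h2 hS0)
  have hpow : 0 < Real.log N ^ (1 / 2 : ℝ) := by positivity
  have h4 : Real.log N = Real.log N ^ (1 / 2 : ℝ) * Real.log N ^ (1 / 2 : ℝ) := by
    rw [← Real.rpow_add hlN]; norm_num
  nth_rw 1 [h4] at h3
  rw [← mul_assoc, mul_le_mul_iff_left₀ hpow] at h3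
  rw [one_div, inv_mul_le_iff₀ (Real.exp_pos _), mul_comm]
  exact h3

/-- Landau's lower bound for the number of sums of two squares up to `N`. -/
lemma exists_le_card_sosIoc : ∃ c : ℝ, 0 < c ∧ ∃ N₀ : ℕ, ∀ N : ℕ, N₀ ≤ N →
    c * N * Real.log N ^ (-(1 / 2) : ℝ) ≤ (sosIoc N).card := by
  obtain ⟨c, hc0, k, hk0, hk⟩ := exists_le_sum_primesMod_log
  obtain ⟨c', hc'0, hc'⟩ := exists_le_sum_sosIoc_inv
  refine ⟨c / 2 * (c' * (1 / 2)), by positivity, 4 * k ^ 2 + 2 * k + 2, fun N hN => ?_⟩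
  have hk0' : (0 : ℝ) < k := by exact_mod_cast hk0
  have hN2 : 2 ≤ N := by lia
  have hN' : (1 : ℝ) < N := by exact_mod_cast hN2
  have hlN := Real.log_pos hN'
  set Y := N / k with hY
  have hY2 : 2 ≤ Y := (Nat.le_div_iff_mul_le hk0).2 (by nlinarith)
  have hlogY : 1 / 4 * Real.log N ≤ Real.log Y := by
    have h1 : Real.log N ≤ 2 * Real.log Y := by
      have : (N : ℝ) ≤ (Y : ℝ) ^ 2 := by
        have h3 : N < (Y + 1) * k := by
          rw [hY]; exact (Nat.lt_mul_of_div_lt (Nat.lt_succ_self _) hk0)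
        have h2 : 4 * k ≤ Y := (Nat.le_div_iff_mul_le hk0).2 (by nlinarith)
        have h4 : N ≤ Y ^ 2 := by nlinarith
        exact_mod_cast h4
      have h5 := Real.log_le_log (by linarith) this
      rw [Real.log_pow] at h5
      exact_mod_cast h5
    have := Real.log_natCast_nonneg Y
    linarith
  have hpow : 1 / 2 * Real.log N ^ (1 / 2 : ℝ) ≤ Real.log Y ^ (1 / 2 : ℝ) := by
    calc _ = (1 / 4 * Real.log N) ^ (1 / 2 : ℝ) := by
          rw [Real.mul_rpow (by norm_num) hlN.le]
          congr 1
          rw [← Real.sqrt_eq_rpow, show (1 / 4 : ℝ) = (1 / 2) ^ 2 by norm_num,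
            Real.sqrt_sq (by norm_num)]
      _ ≤ _ := by gcongr
  have h1 : ∑ m ∈ sosIoc Y, ∑ p ∈ primesMod 1 (N / m), Real.log p ≤
      ∑ n ∈ sosIoc N, ∑ p ∈ n.primeFactors, Real.log p := by
    rw [sum_sigma', sum_sigma']
    refine sum_le_sum_of_injOn_of_le (fun x : (_ : ℕ) × ℕ => ⟨x.1 * x.2, x.2⟩) ?_ ?_
      (fun x _ => le_rfl) fun _ _ => Real.log_natCast_nonneg _
    · rintro ⟨m, p⟩ hx
      simp only [mem_sigma, mem_sosIoc, mem_primesMod] at hx ⊢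
      obtain ⟨⟨⟨hm0, hmY⟩, hm⟩, hpN, hp, hp1⟩ := hx
      refine ⟨⟨⟨Nat.mul_pos hm0 hp.pos, ?_⟩, SOS_mul_mem hm (prime_mem_SOS hp (by lia))⟩, ?_⟩
      · rw [mul_comm]; exact (Nat.le_div_iff_mul_le hm0).1 hpN
      · exact Nat.mem_primeFactors.2 ⟨hp, Dvd.intro_left _ rfl, (Nat.mul_pos hm0 hp.pos).ne'⟩
    · rintro ⟨m, p⟩ hx ⟨m', p'⟩ hx' heq
      simp only [Sigma.mk.injEq, heq_eq_eq] at heq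
      obtain ⟨h1, rfl⟩ := heq
      simp only [coe_sigma, Set.mem_sigma_iff, mem_coe, mem_primesMod] at hx
      rw [Nat.eq_of_mul_eq_mul_right hx.2.2.1.pos h1]
  have h2 : ∑ n ∈ sosIoc N, ∑ p ∈ n.primeFactors, Real.log p ≤
      (sosIoc N).card * Real.log N := by
    rw [← nsmul_eq_mul]
    refine sum_le_card_nsmul _ _ _ fun n hn => ?_
    rw [mem_sosIoc] at hn
    rw [← Real.log_prod (fun p hp => by
      have := (Nat.prime_of_mem_primeFactors hp).pos
      positivity)]
    have h3 : ∏ p ∈ n.primeFactors, p ≤ N :=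
      (Nat.le_of_dvd hn.1.1 (Nat.prod_primeFactors_dvd n)).trans hn.1.2
    refine Real.log_le_log ?_ (by rw [← Nat.cast_prod]; exact_mod_cast h3)
    exact prod_pos fun p hp => by
      have := (Nat.prime_of_mem_primeFactors hp).pos
      exact_mod_cast this
  have h3 : c / 2 * N * ∑ m ∈ sosIoc Y, 1 / (m : ℝ) ≤
      ∑ m ∈ sosIoc Y, ∑ p ∈ primesMod 1 (N / m), Real.log p := by
    rw [mul_sum]
    refine sum_le_sum fun m hm => ?_
    rw [mem_sosIoc] at hm
    have hm0 := hm.1.1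
    have hkm : k ≤ N / m := by
      rw [Nat.le_div_iff_mul_le hm0, mul_comm]
      exact (Nat.le_div_iff_mul_le hk0).1 hm.1.2
    refine le_trans ?_ (hk _ hkm)
    have h4 := (natCast_div_bounds N m).1
    have h5 : (1 : ℝ) ≤ (N / m : ℕ) := by exact_mod_cast (by lia : 1 ≤ N / m)
    calc c / 2 * N * (1 / (m : ℝ)) = c * (1 / 2 * (N / m)) := by ring
      _ ≤ _ := by gcongr; linarith
  have h4 := (h3.trans h1).trans h2
  have h5 : c / 2 * (c' * (1 / 2)) * N * Real.log N ^ (1 / 2 : ℝ) ≤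
      (sosIoc N).card * Real.log N := by
    refine le_trans ?_ h4
    calc _ = c / 2 * N * (c' * (1 / 2 * Real.log N ^ (1 / 2 : ℝ))) := by ring
      _ ≤ c / 2 * N * (c' * Real.log Y ^ (1 / 2 : ℝ)) := by gcongr
      _ ≤ _ := by
        have := hc' Y hY2
        gcongr
  rw [← div_le_iff₀ hlN] at h5
  refine le_trans (le_of_eq ?_) h5
  rw [show (-(1 / 2) : ℝ) = 1 / 2 - 1 by norm_num, Real.rpow_sub hlN, Real.rpow_one]
  ring

end SumsOfTwoSquares

noncomputable section BrunSieve

open Finset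
open scoped Classical

variable {ι : Type*}

/-- Elementary symmetric sums of a real function over a finite set. -/
def elemSymm (P : Finset ι) (ρ : ι → ℝ) (k : ℕ) : ℝ :=
  ∑ T ∈ powersetCard k P, ∏ p ∈ T, ρ p

lemma elemSymm_zero (P : Finset ι) (ρ : ι → ℝ) : elemSymm P ρ 0 = 1 := by
  simp [elemSymm]

lemma elemSymm_empty_succ (ρ : ι → ℝ) (k : ℕ) : elemSymm ∅ ρ (k + 1) = 0 := by
  rw [elemSymm, powersetCard_eq_empty.2 (by simp), sum_empty]

lemma elemSymm_insert {P : Finset ι} {a : ι} (ha : a ∉ P) (ρ : ι → ℝ) (k : ℕ) :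
    elemSymm (insert a P) ρ (k + 1) = elemSymm P ρ (k + 1) + ρ a * elemSymm P ρ k := by
  unfold elemSymm
  rw [powersetCard_succ_insert ha, sum_union, sum_image, mul_sum]
  · congr 1
    refine sum_congr rfl fun T hT => prod_insert fun h => ha ?_
    exact (mem_powersetCard.1 hT).1 h
  · intro T hT T' hT' h
    have h1 : a ∉ T := fun h => ha ((mem_powersetCard.1 hT).1 h)
    have h2 : a ∉ T' := fun h => ha ((mem_powersetCard.1 hT').1 h)
    rw [← erase_insert h1, ← erase_insert h2, h]
  · refine disjoint_left.2 fun T hT hT' => ?_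
    obtain ⟨T', -, rfl⟩ := mem_image.1 hT'
    exact ha ((mem_powersetCard.1 hT).1 (mem_insert_self _ _))

/-- Alternating truncations of `∏ (1 - ρ p)`. -/
def altSymm (P : Finset ι) (ρ : ι → ℝ) (k : ℕ) : ℝ :=
  ∑ i ∈ range (k + 1), (-1) ^ i * elemSymm P ρ i

lemma altSymm_insert {P : Finset ι} {a : ι} (ha : a ∉ P) (ρ : ι → ℝ) (k : ℕ) :
    altSymm (insert a P) ρ (k + 1) = altSymm P ρ (k + 1) - ρ a * altSymm P ρ k := by
  unfold altSymm
  rw [sum_range_succ', sum_range_succ' (n := k + 1), mul_sum, elemSymm_zero, elemSymm_zero]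
  simp only [elemSymm_insert ha]
  rw [add_sub_right_comm, ← sum_sub_distrib]
  congr 1
  exact sum_congr rfl fun i _ => by ring

lemma bonferroni {P : Finset ι} {ρ : ι → ℝ} (h0 : ∀ p ∈ P, 0 ≤ ρ p) (h1 : ∀ p ∈ P, ρ p ≤ 1)
    (r : ℕ) : ∏ p ∈ P, (1 - ρ p) ≤ altSymm P ρ (2 * r) ∧
      altSymm P ρ (2 * r + 1) ≤ ∏ p ∈ P, (1 - ρ p) := by
  have hempty : ∀ k, altSymm (∅ : Finset ι) ρ k = 1 := fun k => by
    rw [altSymm, sum_range_succ', elemSymm_zero]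
    simp [elemSymm_empty_succ]
  induction P using Finset.induction_on generalizing r with
  | empty => simp [hempty]
  | insert a P ha ih =>
    have ha0 := h0 a (mem_insert_self _ _)
    have ha1 := h1 a (mem_insert_self _ _)
    have ih' := ih (fun p hp => h0 p (mem_insert_of_mem hp))
      fun p hp => h1 p (mem_insert_of_mem hp)
    have hprod : 0 ≤ ∏ p ∈ P, (1 - ρ p) :=
      prod_nonneg fun p hp => by linarith [h1 p (mem_insert_of_mem hp)]
    rw [prod_insert ha]
    refine ⟨?_, ?_⟩
    · cases r with
      | zero =>
        simp only [altSymm, mul_zero, zero_add, sum_range_one, pow_zero, elemSymm_zero, one_mul]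
        have hP : ∏ p ∈ P, (1 - ρ p) ≤ 1 := by
          have := (ih' 0).1
          simpa [altSymm, elemSymm_zero] using this
        nlinarith
      | succ r =>
        rw [show 2 * (r + 1) = 2 * r + 1 + 1 by ring, altSymm_insert ha]
        have h2 := (ih' (r + 1)).1
        have h3 := (ih' r).2
        rw [show 2 * (r + 1) = 2 * r + 1 + 1 by ring] at h2
        nlinarith
    · rw [altSymm_insert ha]
      have h2 := (ih' r).1
      have h3 := (ih' r).2
      nlinarith

lemma altSymm_even_le {P : Finset ι} {ρ : ι → ℝ} (h0 : ∀ p ∈ P, 0 ≤ ρ p)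
    (h1 : ∀ p ∈ P, ρ p ≤ 1) (r : ℕ) :
    altSymm P ρ (2 * r) ≤ ∏ p ∈ P, (1 - ρ p) + elemSymm P ρ (2 * r + 1) := by
  have h := (bonferroni h0 h1 r).2
  rw [altSymm, sum_range_succ, pow_succ, pow_mul] at h
  unfold altSymm
  norm_num at h
  linarith

lemma elemSymm_le {P : Finset ι} {ρ : ι → ℝ} (h0 : ∀ p ∈ P, 0 ≤ ρ p) (k : ℕ) :
    elemSymm P ρ k ≤ (∑ p ∈ P, ρ p) ^ k / (k.factorial : ℝ) := by
  induction P using Finset.induction_on generalizing k with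
  | empty =>
    cases k with
    | zero => simp [elemSymm_zero]
    | succ k => simp [elemSymm_empty_succ]
  | insert a P ha ih =>
    cases k with
    | zero => simp [elemSymm_zero]
    | succ k =>
      have ha0 := h0 a (mem_insert_self _ _)
      have ih' := ih fun p hp => h0 p (mem_insert_of_mem hp)
      have hS : 0 ≤ ∑ p ∈ P, ρ p := sum_nonneg fun p hp => h0 p (mem_insert_of_mem hp)
      rw [elemSymm_insert ha, sum_insert ha]
      set S := ∑ p ∈ P, ρ p
      have hpow : S ^ (k + 1) + (k + 1) * (S ^ k * ρ a) ≤ (ρ a + S) ^ (k + 1) := by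
        clear ih ih'
        induction k with
        | zero => simp; linarith
        | succ k ihk =>
          have h2 : (ρ a + S) ^ (k + 1 + 1) = (ρ a + S) ^ (k + 1) * (ρ a + S) := pow_succ _ _
          rw [h2]
          have h3 := mul_le_mul_of_nonneg_right ihk (by positivity : 0 ≤ ρ a + S)
          refine le_trans ?_ h3
          push_cast
          have : 0 ≤ ((k : ℝ) + 1) * (S ^ k * ρ a * ρ a) := by positivity
          ring_nf at this ⊢
          nlinarith
      have h1 : (k.factorial : ℝ) ≠ 0 := by positivity
      calc _ ≤ S ^ (k + 1) / ((k + 1).factorial : ℝ) + ρ a * (S ^ k / (k.factorial : ℝ)) :=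
            add_le_add (ih' _) (mul_le_mul_of_nonneg_left (ih' _) ha0)
        _ = (S ^ (k + 1) + (k + 1) * (S ^ k * ρ a)) / ((k + 1).factorial : ℝ) := by
            rw [Nat.factorial_succ]
            push_cast
            field_simp
        _ ≤ _ := by gcongr

lemma card_filter_range_mul {a b : ℕ} (hab : a.Coprime b) (ha : 0 < a) (hb : 0 < b)
    {A B : ℕ → Prop} (hA : ∀ n, A n ↔ A (n % a)) (hB : ∀ n, B n ↔ B (n % b)) :
    ((range (a * b)).filter fun n => A n ∧ B n).card =
      ((range a).filter A).card * ((range b).filter B).card := by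
  rw [← card_product]
  refine card_bij (fun n _ => (n % a, n % b)) ?_ ?_ ?_
  · intro n hn
    simp only [mem_filter, mem_range, mem_product] at hn ⊢
    exact ⟨⟨Nat.mod_lt _ ha, (hA n).1 hn.2.1⟩, Nat.mod_lt _ hb, (hB n).1 hn.2.2⟩
  · intro n hn n' hn' h
    simp only [mem_filter, mem_range, Prod.mk.injEq] at hn hn' h
    have := (Nat.modEq_and_modEq_iff_modEq_mul hab).1 ⟨h.1, h.2⟩
    exact Nat.ModEq.eq_of_lt_of_lt this hn.1 hn'.1
  · rintro ⟨u, v⟩ huv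
    simp only [mem_filter, mem_range, mem_product] at huv
    have hlt := Nat.chineseRemainder_lt_mul hab u v ha.ne' hb.ne'
    obtain ⟨hu, hv⟩ := (Nat.chineseRemainder hab u v).2
    have hu' : (Nat.chineseRemainder hab u v : ℕ) % a = u := by
      rw [hu, Nat.mod_eq_of_lt huv.1.1]
    have hv' : (Nat.chineseRemainder hab u v : ℕ) % b = v := by
      rw [hv, Nat.mod_eq_of_lt huv.2.1]
    refine ⟨Nat.chineseRemainder hab u v, ?_, by rw [hu', hv']⟩
    simp only [mem_filter, mem_range]
    exact ⟨hlt, (hA _).2 (by rw [hu']; exact huv.1.2), (hB _).2 (by rw [hv']; exact huv.2.2)⟩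

lemma card_filter_range_prod {T : Finset ι} {m : ι → ℕ} {A : ι → ℕ → Prop}
    (hm : ∀ p ∈ T, 0 < m p) (hcop : (T : Set ι).Pairwise fun p q => (m p).Coprime (m q))
    (hA : ∀ p ∈ T, ∀ n, A p n ↔ A p (n % m p)) :
    ((range (∏ p ∈ T, m p)).filter fun n => ∀ p ∈ T, A p n).card =
      ∏ p ∈ T, ((range (m p)).filter (A p)).card := by
  induction T using Finset.induction_on with
  | empty => simp
  | insert a T ha ih =>
    rw [prod_insert ha, prod_insert ha, ← ih (fun p hp => hm p (mem_insert_of_mem hp))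
      (hcop.mono (by simp)) fun p hp => hA p (mem_insert_of_mem hp)]
    simp only [forall_mem_insert]
    have key := card_filter_range_mul (A := A a) (B := fun n => ∀ p ∈ T, A p n) (a := m a)
      (b := ∏ p ∈ T, m p) ?_ (hm a (mem_insert_self _ _))
      (prod_pos fun p hp => hm p (mem_insert_of_mem hp)) (hA a (mem_insert_self _ _)) ?_
    · convert key
    · refine Nat.Coprime.prod_right fun p hp => hcop (by simp) (by simp [hp]) ?_
      rintro rfl; exact ha hp
    · intro n
      refine forall₂_congr fun p hp => ?_
      have h := hA p (mem_insert_of_mem hp)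
      rw [h n, h (n % ∏ p ∈ T, m p), Nat.mod_mod_of_dvd _ (dvd_prod_of_mem m hp)]

lemma abs_card_filter_range_sub_le {M : ℕ} (hM : 0 < M) {A : ℕ → Prop}
    [DecidablePred A] (hA : ∀ n, A n ↔ A (n % M)) (N : ℕ) :
    |(((range N).filter A).card : ℝ) - N * (((range M).filter A).card / M)| ≤
      ((range M).filter A).card := by
  have hper : Function.Periodic A M := fun n => propext (by
    rw [hA (n + M), Nat.add_mod_right, ← hA n])
  have hmul : ∀ k : ℕ, ((range (k * M)).filter A).card = k * ((range M).filter A).card := by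
    intro k
    induction k with
    | zero => simp
    | succ k ih =>
      have h1 := Nat.filter_Ico_card_eq_of_periodic (k * M) M A hper
      rw [Nat.count_eq_card_filter_range] at h1
      rw [Nat.succ_mul, Nat.succ_mul, ← ih, ← h1, range_eq_Ico, range_eq_Ico,
        ← Ico_union_Ico_eq_Ico (Nat.zero_le (k * M)) (Nat.le_add_right (k * M) M), filter_union,
        card_union_of_disjoint]
      refine disjoint_filter_filter (p := A) (q := A) ?_
      exact Ico_disjoint_Ico_consecutive _ _ _
  set w := ((range M).filter A).card
  have h1 : (N / M) * w ≤ ((range N).filter A).card := by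
    rw [← hmul]
    refine card_le_card (filter_subset_filter _ (range_subset_range.2 ?_))
    exact Nat.div_mul_le_self N M
  have h2 : ((range N).filter A).card ≤ (N / M + 1) * w := by
    rw [← hmul]
    refine card_le_card (filter_subset_filter _ (range_subset_range.2 ?_))
    exact (Nat.lt_div_mul_add hM).le.trans (by rw [Nat.add_mul, one_mul])
  have hM' : (0 : ℝ) < M := by exact_mod_cast hM
  have h1' : ((N / M : ℕ) : ℝ) * w ≤ ((range N).filter A).card := by
    rw [← Nat.cast_mul]; exact Nat.cast_le.2 h1
  have h2' : (((range N).filter A).card : ℝ) ≤ (((N / M : ℕ) : ℝ) + 1) * w := by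
    rw [← Nat.cast_succ, ← Nat.cast_mul]; exact Nat.cast_le.2 h2
  obtain ⟨h3, h4⟩ := natCast_div_bounds N M
  have hw : (0 : ℝ) ≤ w := Nat.cast_nonneg _
  have h5 : (N : ℝ) * (w / M) = (N / M) * w := by ring
  rw [h5, abs_le]
  constructor <;> nlinarith

/-- Brun's pure sieve. -/
lemma brun_sieve {P : Finset ι} {m : ι → ℕ} {A : ι → ℕ → Prop}
    (hm : ∀ p ∈ P, 0 < m p) (hcop : (P : Set ι).Pairwise fun p q => (m p).Coprime (m q))
    (hA : ∀ p ∈ P, ∀ n, A p n ↔ A p (n % m p)) (N r : ℕ) :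
    (((range N).filter fun n => ∀ p ∈ P, ¬ A p n).card : ℝ) ≤
      N * (∏ p ∈ P, (1 - (((range (m p)).filter (A p)).card : ℝ) / m p) +
        elemSymm P (fun p => (((range (m p)).filter (A p)).card : ℝ) / m p) (2 * r + 1)) +
      ∑ k ∈ range (2 * r + 1), elemSymm P (fun p => (((range (m p)).filter (A p)).card : ℝ)) k := by
  set w : ι → ℝ := fun p => (((range (m p)).filter (A p)).card : ℝ) with hw
  have hw0 : ∀ p, 0 ≤ w p := fun p => Nat.cast_nonneg _
  have h1 : (((range N).filter fun n => ∀ p ∈ P, ¬ A p n).card : ℝ) ≤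
      ∑ n ∈ range N, altSymm P (fun p => if A p n then 1 else 0) (2 * r) := by
    rw [card_filter]
    push_cast
    refine sum_le_sum fun n _ => ?_
    refine le_trans ?_ (bonferroni (ρ := fun p => if A p n then (1 : ℝ) else 0)
      (fun p _ => by split_ifs <;> norm_num) (fun p _ => by split_ifs <;> norm_num) r).1
    split_ifs with h
    · rw [prod_eq_one fun p hp => by rw [if_neg (h p hp), sub_zero]]
    · exact prod_nonneg fun p _ => by split_ifs <;> norm_num
  have h2 : ∑ n ∈ range N, altSymm P (fun p => if A p n then (1 : ℝ) else 0) (2 * r) =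
      ∑ k ∈ range (2 * r + 1), (-1) ^ k * ∑ T ∈ powersetCard k P,
        (((range N).filter fun n => ∀ p ∈ T, A p n).card : ℝ) := by
    unfold altSymm elemSymm
    rw [sum_comm]
    refine sum_congr rfl fun k _ => ?_
    rw [← mul_sum, sum_comm]
    congr 1
    refine sum_congr rfl fun T _ => ?_
    rw [card_filter]
    push_cast
    refine sum_congr rfl fun n _ => ?_
    split_ifs with h
    · exact prod_eq_one fun p hp => if_pos (h p hp)
    · push Not at h
      obtain ⟨p, hp, hpA⟩ := h
      exact prod_eq_zero hp (if_neg hpA)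
  have h3 : ∀ k, |∑ T ∈ powersetCard k P, (((range N).filter fun n => ∀ p ∈ T, A p n).card : ℝ) -
      N * elemSymm P (fun p => w p / m p) k| ≤ elemSymm P w k := by
    intro k
    unfold elemSymm
    rw [mul_sum, ← sum_sub_distrib]
    refine (abs_sum_le_sum_abs _ _).trans (sum_le_sum fun T hT => ?_)
    have hTP := (mem_powersetCard.1 hT).1
    have h4 := card_filter_range_prod (fun p hp => hm p (hTP hp))
      (hcop.mono (by exact_mod_cast hTP)) fun p hp => hA p (hTP hp)
    have h5 := abs_card_filter_range_sub_le (A := fun n => ∀ p ∈ T, A p n)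
      (prod_pos fun p hp => hm p (hTP hp)) (fun n => forall₂_congr fun p hp => by
        rw [hA p (hTP hp) n, hA p (hTP hp) (n % ∏ p ∈ T, m p),
          Nat.mod_mod_of_dvd _ (dvd_prod_of_mem m hp)]) N
    rw [h4] at h5
    push_cast at h5
    rw [prod_div_distrib]
    exact h5
  have h4 : ∑ k ∈ range (2 * r + 1), (-1) ^ k * ∑ T ∈ powersetCard k P,
        (((range N).filter fun n => ∀ p ∈ T, A p n).card : ℝ) ≤
      N * altSymm P (fun p => w p / m p) (2 * r) + ∑ k ∈ range (2 * r + 1), elemSymm P w k := by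
    unfold altSymm
    rw [mul_sum, ← sum_add_distrib]
    refine sum_le_sum fun k _ => ?_
    have h5 := abs_le.1 (h3 k)
    rcases neg_one_pow_eq_or ℝ k with h | h <;> rw [h] <;> linarith
  refine (h1.trans (h2.trans_le h4)).trans ?_
  have h5 := altSymm_even_le (P := P) (ρ := fun p => w p / m p)
    (fun p _ => div_nonneg (hw0 p) (by positivity)) (fun p hp => by
      have hmp : (0 : ℝ) < m p := by exact_mod_cast hm p hp
      rw [div_le_one hmp]
      have h6 := card_filter_le (range (m p)) (A p)
      rw [card_range] at h6
      simp only [hw]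
      exact_mod_cast h6) r
  gcongr

end BrunSieve

noncomputable section PairSieve

open Finset Filter
open scoped Classical

/-- `p` divides `n` exactly once. -/
def ExactDvd (p n : ℕ) : Prop := p ∣ n ∧ ¬ p ^ 2 ∣ n

lemma exactDvd_add_mod (p n h : ℕ) : ExactDvd p (n + h) ↔ ExactDvd p (n % p ^ 2 + h) := by
  unfold ExactDvd
  have h1 : n + h ≡ n % p ^ 2 + h [MOD p ^ 2] := (Nat.mod_modEq n (p ^ 2)).symm.add_right h
  rw [(h1.of_dvd (Dvd.intro p (sq p).symm)).dvd_iff dvd_rfl, h1.dvd_iff dvd_rfl]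

lemma ExactDvd.notMem_SOS {p n : ℕ} (hp : p.Prime) (h3 : p % 4 = 3) (h : ExactDvd p n) :
    n ∉ SOS := by
  intro hn
  have := Fact.mk hp
  have h1 := even_padicValNat_of_mem_SOS hn hp h3
  have hn0 : n ≠ 0 := by rintro rfl; exact h.2 (dvd_zero _)
  have h2 : 1 ≤ padicValNat p n := one_le_padicValNat_of_dvd hn0 h.1
  have h4 : padicValNat p n < 2 := by
    by_contra hc
    exact h.2 ((padicValNat_dvd_iff_le hn0).2 (by lia))
  have h5 : padicValNat p n = 1 := by lia
  rw [h5] at h1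
  exact absurd h1 (by decide)

lemma card_filter_exactDvd {p : ℕ} (hp : p.Prime) :
    ((range (p ^ 2)).filter (ExactDvd p)).card = p - 1 := by
  have : (range (p ^ 2)).filter (ExactDvd p) = (Ico 1 p).image (p * ·) := by
    ext n
    simp only [mem_filter, mem_range, mem_image, mem_Ico, ExactDvd]
    constructor
    · rintro ⟨h1, ⟨k, rfl⟩, h2⟩
      refine ⟨k, ⟨?_, ?_⟩, rfl⟩
      · rcases Nat.eq_zero_or_pos k with rfl | h
        · simp at h2
        · exact h
      · rw [sq] at h1
        exact Nat.lt_of_mul_lt_mul_left h1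
    · rintro ⟨k, ⟨h1, h2⟩, rfl⟩
      refine ⟨?_, Dvd.intro _ rfl, fun h => ?_⟩
      · rw [sq]; exact Nat.mul_lt_mul_of_pos_left h2 hp.pos
      · rw [sq] at h
        have := Nat.le_of_dvd (by lia) (Nat.dvd_of_mul_dvd_mul_left hp.pos h)
        lia
  rw [this, card_image_of_injective _ (fun a b h => Nat.eq_of_mul_eq_mul_left hp.pos h), Nat.card_Ico]

/-- `p` divides `n` or `n + h` exactly once. -/
def PairExactDvd (h p n : ℕ) : Prop := ExactDvd p n ∨ ExactDvd p (n + h)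

lemma card_filter_pairExactDvd {p h : ℕ} (hp : p.Prime) (hph : ¬ p ∣ h) :
    ((range (p ^ 2)).filter fun n => PairExactDvd h p n).card = 2 * (p - 1) := by
  have hun : ((range (p ^ 2)).filter fun n => PairExactDvd h p n) =
      (range (p ^ 2)).filter (ExactDvd p) ∪
        (range (p ^ 2)).filter fun n => ExactDvd p (n + h) := by
    ext n
    simp only [mem_filter, mem_union]
    rw [PairExactDvd]
    tauto
  rw [hun, card_union_of_disjoint, card_filter_exactDvd hp, two_mul]
  · congr 1
    have hper : Function.Periodic (ExactDvd p) (p ^ 2) := fun n => propext (by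
      have := exactDvd_add_mod p (n + p ^ 2) 0
      rw [Nat.add_mod_right, ← exactDvd_add_mod p n 0] at this
      simpa using this)
    have h1 := Nat.filter_Ico_card_eq_of_periodic h (p ^ 2) (ExactDvd p) hper
    rw [Nat.count_eq_card_filter_range, card_filter_exactDvd hp] at h1
    rw [← h1]
    refine card_bij (fun n _ => n + h) ?_ ?_ ?_
    · intro n hn
      simp only [mem_filter, mem_range, mem_Ico] at hn ⊢
      exact ⟨by lia, hn.2⟩
    · intro a _ b _ hab
      simpa using hab
    · intro n hn
      simp only [mem_filter, mem_Ico] at hn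
      refine ⟨n - h, ?_, by lia⟩
      simp only [mem_filter, mem_range]
      rw [Nat.sub_add_cancel hn.1.1]
      exact ⟨by lia, hn.2⟩
  · refine disjoint_filter.2 fun n _ h1 h2 => hph ?_
    exact (Nat.dvd_add_right h1.1).1 h2.1

lemma pow_div_factorial_le_exp_sub {S : ℝ} (hS : 0 ≤ S) (n : ℕ) :
    S ^ n / (n.factorial : ℝ) ≤ Real.exp (3 * S - n) := by
  have h3 := Real.pow_div_factorial_le_exp (Real.exp 1 * S) (by positivity) n
  have he : Real.exp 1 * S ≤ 3 * S := by
    have := Real.exp_one_lt_d9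
    gcongr
    linarith
  rw [mul_pow, ← Real.exp_nat_mul, mul_one, mul_div_assoc] at h3
  rw [Real.exp_sub, le_div_iff₀ (Real.exp_pos _), mul_comm]
  exact h3.trans (Real.exp_le_exp.2 he)

lemma sum_elemSymm_le {P : Finset ℕ} {w : ℕ → ℝ} (hw : ∀ p ∈ P, 0 ≤ w p) {W : ℝ}
    (hW : ∑ p ∈ P, w p ≤ W) (hW1 : 1 ≤ W) (n : ℕ) :
    ∑ k ∈ range (n + 1), elemSymm P w k ≤ ((n : ℝ) + 1) * W ^ n := by
  have hW0 : 0 ≤ ∑ p ∈ P, w p := sum_nonneg hw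
  have h7 : ∀ k ∈ range (n + 1), elemSymm P w k ≤ W ^ n := by
    intro k hk
    have hk' : k ≤ n := by have := mem_range.1 hk; lia
    have hf : (1 : ℝ) ≤ (k.factorial : ℝ) := by
      exact_mod_cast Nat.one_le_iff_ne_zero.2 (Nat.factorial_ne_zero k)
    calc _ ≤ (∑ p ∈ P, w p) ^ k / (k.factorial : ℝ) := elemSymm_le hw k
      _ ≤ (∑ p ∈ P, w p) ^ k := div_le_self (by positivity) hf
      _ ≤ W ^ k := by gcongr
      _ ≤ _ := pow_le_pow_right₀ hW1 hk'
  have h8 := sum_le_card_nsmul _ _ _ h7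
  rw [card_range, nsmul_eq_mul] at h8
  exact_mod_cast h8

/-- An explicit sieve bound for pairs of sums of two squares. -/
lemma card_pairs_SOS_le {h z : ℕ} (hz : 1 ≤ z) (N r : ℕ) {P : Finset ℕ}
    (hP : P = (primesMod 3 z).filter fun p => ¬ p ∣ h) :
    (((range N).filter fun n => n ∈ SOS ∧ n + h ∈ SOS).card : ℝ) ≤
      N * (Real.exp (2 - 2 * ∑ p ∈ P, 1 / (p : ℝ)) +
        Real.exp (3 * (2 * ∑ p ∈ P, 1 / (p : ℝ)) - (2 * r + 1))) +
      (2 * r + 1) * (2 * (z : ℝ) ^ 2) ^ (2 * r) := by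
  have hPp : ∀ p ∈ P, p ≤ z ∧ p.Prime ∧ p % 4 = 3 ∧ ¬ p ∣ h := fun p hp => by
    rw [hP, mem_filter, mem_primesMod] at hp
    exact ⟨hp.1.1, hp.1.2.1, hp.1.2.2, hp.2⟩
  have hb := brun_sieve (P := P) (m := fun p => p ^ 2)
    (A := PairExactDvd h)
    (fun p hp => pow_pos (hPp p hp).2.1.pos 2)
    (fun p hp q hq hpq => Nat.Coprime.pow 2 2
      ((Nat.coprime_primes (hPp p hp).2.1 (hPp q hq).2.1).2 hpq))
    (fun p hp n => by
      have := exactDvd_add_mod p n 0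
      simp only [add_zero] at this
      exact or_congr this (exactDvd_add_mod p n h)) N r
  have hsub : (((range N).filter fun n => n ∈ SOS ∧ n + h ∈ SOS).card : ℝ) ≤
      ((range N).filter fun n => ∀ p ∈ P, ¬ PairExactDvd h p n).card := by
    refine Nat.cast_le.2 (card_le_card fun n hn => ?_)
    simp only [mem_filter] at hn ⊢
    refine ⟨hn.1, fun p hp hor => ?_⟩
    rcases hor with h1 | h1
    · exact h1.notMem_SOS (hPp p hp).2.1 (hPp p hp).2.2.1 hn.2.1
    · exact h1.notMem_SOS (hPp p hp).2.1 (hPp p hp).2.2.1 hn.2.2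
  refine hsub.trans (hb.trans ?_)
  set w : ℕ → ℝ := fun p =>
    (((range (p ^ 2)).filter fun n => PairExactDvd h p n).card : ℝ) with hw
  have hwP : ∀ p ∈ P, w p = 2 * ((p : ℝ) - 1) := fun p hp => by
    simp only [hw]
    rw [card_filter_pairExactDvd (hPp p hp).2.1 (hPp p hp).2.2.2]
    push_cast [Nat.cast_sub (hPp p hp).2.1.one_le]
    ring
  have hp1 : ∀ p ∈ P, (1 : ℝ) < p := fun p hp => by exact_mod_cast (hPp p hp).2.1.one_lt
  have hw0 : ∀ p ∈ P, 0 ≤ w p := fun p hp => by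
    rw [hwP p hp]; linarith [hp1 p hp]
  have hρ : ∀ p ∈ P, w p / ((p ^ 2 : ℕ) : ℝ) = 2 * (1 / (p : ℝ)) - 2 * (1 / (p : ℝ) ^ 2) :=
    fun p hp => by
      have := hp1 p hp
      rw [hwP p hp]
      push_cast
      field_simp
  have hsq : ∑ p ∈ P, 1 / (p : ℝ) ^ 2 ≤ 1 :=
    (sum_le_sum_of_subset_of_nonneg (fun p hp => Nat.mem_primesBelow.2
      ⟨Nat.lt_succ_of_le (hPp p hp).1, (hPp p hp).2.1⟩) fun _ _ _ => by positivity).trans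
      (one_div_sq_sum_le (z + 1))
  have hsq0 : 0 ≤ ∑ p ∈ P, 1 / (p : ℝ) ^ 2 := sum_nonneg fun _ _ => by positivity
  have hS : ∑ p ∈ P, w p / ((p ^ 2 : ℕ) : ℝ) =
      2 * ∑ p ∈ P, 1 / (p : ℝ) - 2 * ∑ p ∈ P, 1 / (p : ℝ) ^ 2 := by
    rw [mul_sum, mul_sum, ← sum_sub_distrib]
    exact sum_congr rfl hρ
  have hρ0 : ∀ p ∈ P, 0 ≤ w p / ((p ^ 2 : ℕ) : ℝ) := fun p hp =>
    div_nonneg (hw0 p hp) (by positivity)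
  have hρ1 : ∀ p ∈ P, 0 ≤ 1 - w p / ((p ^ 2 : ℕ) : ℝ) := fun p hp => by
    have := hp1 p hp
    rw [hwP p hp, sub_nonneg,
      div_le_one (by exact_mod_cast pow_pos (hPp p hp).2.1.pos 2)]
    push_cast
    nlinarith [sq_nonneg ((p : ℝ) - 1)]
  have h1 : ∏ p ∈ P, (1 - w p / ((p ^ 2 : ℕ) : ℝ)) ≤
      Real.exp (2 - 2 * ∑ p ∈ P, 1 / (p : ℝ)) := by
    calc _ ≤ ∏ p ∈ P, Real.exp (-(w p / ((p ^ 2 : ℕ) : ℝ))) := by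
          refine prod_le_prod hρ1 fun p _ => ?_
          have := Real.add_one_le_exp (-(w p / ((p ^ 2 : ℕ) : ℝ)))
          linarith
      _ = Real.exp (-∑ p ∈ P, w p / ((p ^ 2 : ℕ) : ℝ)) := by
          rw [← Real.exp_sum, sum_neg_distrib]
      _ ≤ _ := Real.exp_le_exp.2 (by rw [hS]; linarith)
  have h2 : elemSymm P (fun p => w p / ((p ^ 2 : ℕ) : ℝ)) (2 * r + 1) ≤
      Real.exp (3 * (2 * ∑ p ∈ P, 1 / (p : ℝ)) - (2 * r + 1)) := by
    refine (elemSymm_le hρ0 _).trans ?_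
    refine (pow_div_factorial_le_exp_sub (sum_nonneg hρ0) _).trans (Real.exp_le_exp.2 ?_)
    rw [hS]
    push_cast
    linarith
  have h3 : ∑ k ∈ range (2 * r + 1), elemSymm P w k ≤
      (2 * r + 1) * (2 * (z : ℝ) ^ 2) ^ (2 * r) := by
    have hz' : (1 : ℝ) ≤ z := by exact_mod_cast hz
    have hW : ∑ p ∈ P, w p ≤ 2 * (z : ℝ) ^ 2 := by
      have h5 : ∀ p ∈ P, w p ≤ 2 * z := fun p hp => by
        rw [hwP p hp]
        have : (p : ℝ) ≤ z := by exact_mod_cast (hPp p hp).1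
        linarith
      have h6 : (P.card : ℝ) ≤ z := by
        have : P ⊆ Ioc 0 z := fun p hp => mem_Ioc.2 ⟨(hPp p hp).2.1.pos, (hPp p hp).1⟩
        have := card_le_card this
        rw [Nat.card_Ioc, Nat.sub_zero] at this
        exact_mod_cast this
      calc _ ≤ P.card • (2 * (z : ℝ)) := sum_le_card_nsmul _ _ _ h5
        _ = P.card * (2 * z) := by rw [nsmul_eq_mul]
        _ ≤ z * (2 * z) := by gcongr
        _ = _ := by ring
    have h8 := sum_elemSymm_le hw0 hW (by nlinarith) (2 * r)
    push_cast at h8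
    exact h8
  gcongr

lemma sum_primeFactors_inv_le {h Y : ℕ} (hY : 0 < Y) (h0 : 0 < h) :
    ∑ p ∈ h.primeFactors, 1 / (p : ℝ) ≤ Y + 2 * Real.log h / Y := by
  have hcard : (h.primeFactors.card : ℝ) ≤ 2 * Real.log h := by
    have h1 : 2 ^ h.primeFactors.card ≤ h := by
      refine le_trans ?_ (Nat.le_of_dvd h0 (Nat.prod_primeFactors_dvd h))
      exact pow_card_le_prod _ _ _ fun p hp => (Nat.prime_of_mem_primeFactors hp).two_le
    have h2 : Real.log (2 ^ h.primeFactors.card) ≤ Real.log h :=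
      Real.log_le_log (by positivity) (by exact_mod_cast h1)
    rw [Real.log_pow] at h2
    have := Real.log_two_gt_d9
    have h3 : (0 : ℝ) ≤ h.primeFactors.card := by positivity
    nlinarith
  have hY' : (0 : ℝ) < Y := by exact_mod_cast hY
  rw [← sum_filter_add_sum_filter_not _ (fun p => p ≤ Y)]
  refine add_le_add ?_ ?_
  · calc _ ≤ (h.primeFactors.filter (· ≤ Y)).card • (1 : ℝ) := by
          refine sum_le_card_nsmul _ _ _ fun p hp => ?_
          have := (Nat.prime_of_mem_primeFactors (mem_filter.1 hp).1).one_le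
          have : (1 : ℝ) ≤ p := by exact_mod_cast this
          exact (div_le_one (by linarith)).2 this
      _ ≤ Y := by
          rw [nsmul_eq_mul, mul_one]
          have h1 : h.primeFactors.filter (· ≤ Y) ⊆ Ioc 0 Y := fun p hp => by
            rw [mem_filter] at hp
            exact mem_Ioc.2 ⟨(Nat.prime_of_mem_primeFactors hp.1).pos, hp.2⟩
          have h2 := card_le_card h1
          rw [Nat.card_Ioc, Nat.sub_zero] at h2
          exact_mod_cast h2
  · calc _ ≤ (h.primeFactors.filter (¬ · ≤ Y)).card • (1 / (Y : ℝ)) := by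
          refine sum_le_card_nsmul _ _ _ fun p hp => ?_
          have : Y ≤ p := by have := (mem_filter.1 hp).2; lia
          have : (Y : ℝ) ≤ p := by exact_mod_cast this
          gcongr
      _ ≤ h.primeFactors.card * (1 / (Y : ℝ)) := by
          rw [nsmul_eq_mul]
          gcongr
          exact filter_subset _ _
      _ ≤ 2 * Real.log h * (1 / (Y : ℝ)) := by gcongr
      _ = _ := by ring

lemma tendsto_log_natCast : Tendsto (fun N : ℕ => Real.log N) atTop atTop :=
  Real.tendsto_log_atTop.comp tendsto_natCast_atTop_atTop

lemma eventually_mul_log_le_rpow (C : ℝ) {δ : ℝ} (hδ : 0 < δ) :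
    ∀ᶠ x : ℝ in atTop, C * Real.log x ≤ x ^ δ := by
  have h := (isLittleO_log_rpow_atTop hδ).bound (c := 1 / (|C| + 1)) (by positivity)
  filter_upwards [h, eventually_ge_atTop 1] with x hx hx1
  have hl := Real.log_nonneg hx1
  rw [Real.norm_of_nonneg hl, Real.norm_of_nonneg (by positivity), one_div,
    inv_mul_eq_div, le_div_iff₀ (by positivity)] at hx
  nlinarith [le_abs_self C]

lemma eventually_le_rpow (C : ℝ) {δ : ℝ} (hδ : 0 < δ) : ∀ᶠ x : ℝ in atTop, C ≤ x ^ δ :=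
  (tendsto_rpow_atTop hδ).eventually_ge_atTop C

set_option maxHeartbeats 1000000 in
/-- Pairs of sums of two squares at distance `h` are rare, uniformly in `h ≤ (log N) ^ B`. -/
lemma eventually_card_pairs_SOS_le {ε : ℝ} (hε : 0 < ε) (hε1 : ε < 1) (B : ℝ) :
    ∀ᶠ N : ℕ in atTop, ∀ h : ℕ, 0 < h → (h : ℝ) ≤ Real.log N ^ B →
      (((range (N + 1)).filter fun n => n ∈ SOS ∧ n + h ∈ SOS).card : ℝ) ≤
        N * Real.log N ^ (-1 + ε) := by
  obtain ⟨K, hK0, hK⟩ := exists_abs_sum_primesMod_inv_sub_le (a := 3) (Or.inr rfl)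
  set δ := ε / 4 with hδ
  have hδ0 : 0 < δ := by positivity
  obtain ⟨Y, hY⟩ := exists_nat_gt (2 * |B| / δ)
  have hY0' : (0 : ℝ) < Y := lt_of_le_of_lt (by positivity) hY
  have hY0 : 0 < Y := by exact_mod_cast hY0'
  set C := Real.exp (2 + 1 + 2 * K + 2 * Y) with hC
  have ev : ∀ᶠ L : ℝ in atTop, (1 ≤ L ∧ 1 ≤ Real.log L ∧ 2 * K ≤ Real.log L) ∧
      176 * Real.log L ≤ L ^ δ ∧ 2 * C + 3 ≤ L ^ δ ∧ 4 ≤ L ^ (1 - δ) := by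
    filter_upwards [eventually_ge_atTop 1, Real.tendsto_log_atTop.eventually_ge_atTop 1,
      Real.tendsto_log_atTop.eventually_ge_atTop (2 * K), eventually_mul_log_le_rpow 176 hδ0,
      eventually_le_rpow (2 * C + 3) hδ0, eventually_le_rpow 4 (by linarith : 0 < 1 - δ)]
      with L h1 h2 h3 h4 h5 h6
    exact ⟨⟨h1, h2, h3⟩, h4, h5, h6⟩
  filter_upwards [tendsto_log_natCast.eventually ev, eventually_ge_atTop 2] with N hN hN2 h h0 hB
  set L := Real.log N with hL
  obtain ⟨⟨hL1, hl1, hlK⟩, hE, hCL, hLa⟩ := hN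
  have hL0 : 0 < L := by linarith
  set l := Real.log L with hl
  have hLexp : ∀ c : ℝ, L ^ c = Real.exp (c * l) := fun c => by
    rw [Real.rpow_def_of_pos hL0, mul_comm]
  set z := ⌊Real.exp (L ^ (1 - δ))⌋₊ with hz
  set r := ⌈10 * l⌉₊ with hr
  have hez : Real.exp 4 ≤ Real.exp (L ^ (1 - δ)) := Real.exp_le_exp.2 hLa
  have he4 : (5 : ℝ) ≤ Real.exp 4 := by
    have := Real.add_one_le_exp (4 : ℝ); linarith
  have hzle : (z : ℝ) ≤ Real.exp (L ^ (1 - δ)) := Nat.floor_le (Real.exp_pos _).le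
  have hzge : Real.exp (L ^ (1 - δ)) - 1 ≤ z := by
    have := Nat.lt_floor_add_one (Real.exp (L ^ (1 - δ))); linarith
  have hz4 : (4 : ℝ) ≤ z := by linarith
  have hz2 : 2 ≤ z := by
    have : 4 ≤ z := by exact_mod_cast hz4
    lia
  have hlz_le : Real.log z ≤ L ^ (1 - δ) := by
    rw [← Real.log_exp (L ^ (1 - δ))]
    exact Real.log_le_log (by linarith) hzle
  have hlz_ge : L ^ (1 - δ) / 2 ≤ Real.log z := by
    have h1 : Real.exp (L ^ (1 - δ)) / 2 ≤ z := by linarith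
    have h2 := Real.log_le_log (by positivity) h1
    rw [Real.log_div (by positivity) (by norm_num), Real.log_exp] at h2
    have := Real.log_two_lt_d9
    linarith
  have hlz0 : 0 < Real.log z := by linarith
  have hllz_le : Real.log (Real.log z) ≤ l := by
    refine Real.log_le_log hlz0 (hlz_le.trans ?_)
    calc L ^ (1 - δ) ≤ L ^ (1 : ℝ) := Real.rpow_le_rpow_of_exponent_le hL1 (by linarith)
      _ = L := Real.rpow_one L
  have hllz_ge : (1 - δ) * l - 1 ≤ Real.log (Real.log z) := by
    have h1 := Real.log_le_log (by positivity) hlz_ge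
    rw [Real.log_div (by positivity) (by norm_num), Real.log_rpow hL0] at h1
    have := Real.log_two_lt_d9
    linarith
  have hM := abs_le.1 (hK z hz2)
  have hb := card_pairs_SOS_le (h := h) (z := z) (by lia) (N + 1) r rfl
  set Sg := ∑ p ∈ (primesMod 3 z).filter fun p => ¬ p ∣ h, 1 / (p : ℝ) with hSg
  have hSle : 2 * Sg ≤ 2 * l := by
    have : Sg ≤ ∑ p ∈ primesMod 3 z, 1 / (p : ℝ) :=
      sum_le_sum_of_subset_of_nonneg (filter_subset _ _) fun _ _ _ => by positivity
    linarith
  have hlogh : Real.log h ≤ |B| * l := by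
    have h1 : (0 : ℝ) < h := by exact_mod_cast h0
    have h2 := Real.log_le_log h1 hB
    rw [Real.log_rpow hL0] at h2
    refine h2.trans ?_
    gcongr
    exact le_abs_self B
  have hSge : (1 - δ) * l - 1 - 2 * K - 2 * Y - 2 * δ * l ≤ 2 * Sg := by
    have h1 : ∑ p ∈ primesMod 3 z, 1 / (p : ℝ) ≤ Sg + ∑ p ∈ h.primeFactors, 1 / (p : ℝ) := by
      rw [← sum_filter_not_add_sum_filter (primesMod 3 z) (fun p => p ∣ h)]
      gcongr
      refine fun p hp => ?_
      rw [mem_filter, mem_primesMod] at hp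
      exact Nat.mem_primeFactors.2 ⟨hp.1.2.1, hp.2, h0.ne'⟩
    have h2 := sum_primeFactors_inv_le hY0 h0
    have h3 : 2 * Real.log h / Y ≤ δ * l := by
      rw [div_le_iff₀ hY0']
      rw [div_lt_iff₀ hδ0] at hY
      nlinarith
    nlinarith
  have hmain : Real.exp (2 - 2 * Sg) ≤ C * L ^ (-1 + 3 * δ) := by
    rw [hC, hLexp, ← Real.exp_add]
    refine Real.exp_le_exp.2 ?_
    linarith
  have hrl : 10 * l ≤ r := Nat.le_ceil _
  have hru : (r : ℝ) ≤ 11 * l := by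
    have := Nat.ceil_lt_add_one (by positivity : 0 ≤ 10 * l)
    linarith
  have hsec : Real.exp (3 * (2 * Sg) - (2 * r + 1)) ≤ L ^ (-1 : ℝ) := by
    rw [hLexp]
    refine Real.exp_le_exp.2 ?_
    linarith
  have hNexp : (N : ℝ) = Real.exp L := by
    rw [hL, Real.exp_log (by positivity)]
  have hNL : L * Real.exp (L / 2) ≤ N := by
    rw [hNexp]
    have h1 := Real.add_one_le_exp (L / 4)
    have h2 : Real.exp (L / 2) = Real.exp (L / 4) * Real.exp (L / 4) := by
      rw [← Real.exp_add]; ring_nf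
    have h3 : Real.exp L = Real.exp (L / 2) * Real.exp (L / 2) := by
      rw [← Real.exp_add]; ring_nf
    rw [h3]
    have h4 : L ≤ Real.exp (L / 2) := by
      rw [h2]
      nlinarith [sq_nonneg (L / 4 - 1)]
    gcongr
  have herr : (2 * (r : ℝ) + 1) * (2 * (z : ℝ) ^ 2) ^ (2 * r) ≤ N * L ^ (-1 : ℝ) := by
    have h1 : (2 * (r : ℝ) + 1) ≤ Real.exp (2 * r) := Real.add_one_le_exp _
    have h2 : 2 * (z : ℝ) ^ 2 ≤ Real.exp (1 + 2 * L ^ (1 - δ)) := by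
      rw [Real.exp_add]
      have h3 : (2 : ℝ) ≤ Real.exp 1 := by
        have := Real.add_one_le_exp (1 : ℝ); linarith
      have h4 : (z : ℝ) ^ 2 ≤ Real.exp (2 * L ^ (1 - δ)) := by
        rw [two_mul, Real.exp_add, ← sq]
        gcongr
      gcongr
    calc _ ≤ Real.exp (2 * r) * Real.exp (1 + 2 * L ^ (1 - δ)) ^ (2 * r) := by gcongr
      _ = Real.exp (2 * r + 2 * r * (1 + 2 * L ^ (1 - δ))) := by
          rw [← Real.exp_nat_mul, ← Real.exp_add]
          push_cast
          ring_nf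
      _ ≤ Real.exp (L / 2) := by
          refine Real.exp_le_exp.2 ?_
          have hsplit : L = L ^ (1 - δ) * L ^ δ := by
            rw [← Real.rpow_add hL0]; norm_num
          have h5 : 2 * (r : ℝ) + 2 * r * (1 + 2 * L ^ (1 - δ)) ≤ 8 * r * L ^ (1 - δ) := by
            have : (0 : ℝ) ≤ r := by positivity
            nlinarith
          have h6 : 8 * (r : ℝ) * L ^ (1 - δ) ≤ 88 * l * L ^ (1 - δ) := by
            have : 8 * (r : ℝ) ≤ 88 * l := by linarith
            gcongr
          have h7 : 88 * l * L ^ (1 - δ) ≤ L / 2 := by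
            have h8 : 88 * l ≤ L ^ δ / 2 := by linarith
            calc _ ≤ L ^ δ / 2 * L ^ (1 - δ) := by gcongr
              _ = L / 2 := by conv_rhs => rw [hsplit]
                              ring
          linarith
      _ ≤ N * L ^ (-1 : ℝ) := by
          rw [Real.rpow_neg_one, ← div_eq_mul_inv, le_div_iff₀ hL0, mul_comm]
          exact hNL
  refine hb.trans ?_
  have hN1 : (1 : ℝ) ≤ N := by exact_mod_cast (by lia : 1 ≤ N)
  have hpw : L ^ (-1 : ℝ) ≤ L ^ (-1 + 3 * δ) :=
    Real.rpow_le_rpow_of_exponent_le hL1 (by linarith)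
  have hCpos : 0 < C := Real.exp_pos _
  calc _ ≤ ((N + 1 : ℕ) : ℝ) * (C * L ^ (-1 + 3 * δ) + L ^ (-1 : ℝ)) + N * L ^ (-1 : ℝ) := by
        gcongr
    _ ≤ (2 * N) * (C * L ^ (-1 + 3 * δ) + L ^ (-1 + 3 * δ)) + N * L ^ (-1 + 3 * δ) := by
        gcongr
        push_cast
        linarith
    _ = N * ((2 * C + 3) * L ^ (-1 + 3 * δ)) := by ring
    _ ≤ N * (L ^ δ * L ^ (-1 + 3 * δ)) := by gcongr
    _ = N * L ^ (-1 + ε) := by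
        rw [← Real.rpow_add hL0]
        congr 2
        rw [hδ]; ring

end PairSieve

noncomputable section RepresentationNumbers

open Finset

/-- The finite set of representations of `n` as a sum of two squares. -/
def reps (n : ℕ) : Finset (ℤ × ℤ) :=
  ((Icc (-(n : ℤ)) n) ×ˢ (Icc (-(n : ℤ)) n)).filter fun p => p.1 ^ 2 + p.2 ^ 2 = (n : ℤ)

lemma abs_le_of_sq_le {x : ℤ} {n : ℕ} (h : x ^ 2 ≤ n) : -(n : ℤ) ≤ x ∧ x ≤ n := by
  constructor <;> nlinarith [sq_nonneg (x - 1), sq_nonneg (x + 1), sq_nonneg x]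

lemma mem_reps {n : ℕ} {p : ℤ × ℤ} : p ∈ reps n ↔ p.1 ^ 2 + p.2 ^ 2 = (n : ℤ) := by
  unfold reps
  rw [mem_filter, mem_product, mem_Icc, mem_Icc]
  refine ⟨fun h => h.2, fun h => ⟨⟨abs_le_of_sq_le ?_, abs_le_of_sq_le ?_⟩, h⟩⟩
  · nlinarith [sq_nonneg p.2]
  · nlinarith [sq_nonneg p.1]

lemma r2_eq_card (n : ℕ) : r2 n = (reps n).card := by
  unfold r2
  rw [Nat.card_congr (Equiv.subtypeEquivRight fun p : ℤ × ℤ => (mem_reps (n := n)).symm),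
    Nat.card_eq_fintype_card, Fintype.card_coe]

lemma r2_pos {n : ℕ} (h : n ∈ SOS) : 1 ≤ r2 n := by
  obtain ⟨x, y, hxy⟩ := h
  rw [r2_eq_card]
  exact card_pos.2 ⟨(x, y), mem_reps.2 hxy.symm⟩

lemma r2_eq_zero {n : ℕ} (h : n ∉ SOS) : r2 n = 0 := by
  rw [r2_eq_card, card_eq_zero]
  refine eq_empty_of_forall_notMem fun p hp => h ⟨p.1, p.2, (mem_reps.1 hp).symm⟩

lemma r2_le (n : ℕ) : r2 n ≤ (2 * n + 1) ^ 2 := by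
  rw [r2_eq_card]
  refine (card_filter_le _ _).trans ?_
  rw [card_product, Int.card_Icc, sq]
  have : ((n : ℤ) + 1 - -(n : ℤ)).toNat = 2 * n + 1 := by lia
  rw [this]

lemma sum_r2_le (M : ℕ) (hM : 1 ≤ M) : ∑ n ∈ range (M + 1), r2 n ≤ 9 * M := by
  have h1 : ∑ n ∈ range (M + 1), r2 n ≤
      ((Icc (-(M.sqrt : ℤ)) M.sqrt) ×ˢ (Icc (-(M.sqrt : ℤ)) M.sqrt)).card := by
    simp only [r2_eq_card]
    rw [← card_biUnion]
    · refine card_le_card fun p hp => ?_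
      obtain ⟨n, hn, hp⟩ := mem_biUnion.1 hp
      rw [mem_reps] at hp
      have hn' : (n : ℤ) ≤ M := by exact_mod_cast Nat.lt_succ_iff.1 (mem_range.1 hn)
      have hs : (M : ℤ) < (M.sqrt + 1) * (M.sqrt + 1) := by exact_mod_cast Nat.lt_succ_sqrt M
      rw [mem_product, mem_Icc, mem_Icc, ← abs_le, ← abs_le]
      have key : ∀ x : ℤ, x ^ 2 ≤ M → |x| ≤ M.sqrt := fun x hx => by
        by_contra hc
        push Not at hc
        have h2 : (M.sqrt : ℤ) + 1 ≤ |x| := hc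
        rw [← sq_abs] at hx
        nlinarith
      exact ⟨key _ (by nlinarith [sq_nonneg p.2]), key _ (by nlinarith [sq_nonneg p.1])⟩
    · intro a _ b _ hab
      refine disjoint_left.2 fun p h1 h2 => hab ?_
      rw [mem_reps] at h1 h2
      exact_mod_cast h1.symm.trans h2
  refine h1.trans ?_
  rw [card_product, Int.card_Icc]
  have : ((M.sqrt : ℤ) + 1 - -(M.sqrt : ℤ)).toNat = 2 * M.sqrt + 1 := by lia
  rw [this]
  have h2 := Nat.sqrt_le M
  have h3 : 1 ≤ M.sqrt := Nat.le_sqrt.2 (by lia)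
  nlinarith

lemma r2_one_le : r2 1 ≤ 4 := by
  rw [r2_eq_card]
  decide

lemma r2_two_mul_le (m : ℕ) : r2 (2 * m) ≤ r2 m := by
  rw [r2_eq_card, r2_eq_card]
  have hdvd : ∀ p ∈ reps (2 * m), 2 ∣ p.1 + p.2 ∧ 2 ∣ p.1 - p.2 := fun p hp => by
    rw [mem_reps] at hp
    push_cast at hp
    have h1 : (p.1 + p.2) ^ 2 = 2 * (m + p.1 * p.2) := by linear_combination hp
    have h2 : (2 : ℤ) ∣ p.1 + p.2 := Int.prime_two.dvd_of_dvd_pow (Dvd.intro _ h1.symm)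
    exact ⟨h2, by lia⟩
  refine card_le_card_of_injOn (fun p => ((p.1 + p.2) / 2, (p.1 - p.2) / 2)) ?_ ?_
  · intro p hp
    obtain ⟨⟨a, ha⟩, ⟨b, hb⟩⟩ := hdvd p hp
    rw [mem_coe, mem_reps] at *
    simp only [ha, hb]
    push_cast at hp
    rw [Int.mul_ediv_cancel_left _ two_ne_zero, Int.mul_ediv_cancel_left _ two_ne_zero]
    have h1 : p.1 = a + b := by lia
    have h2 : p.2 = a - b := by lia
    rw [h1, h2] at hp
    linarith
  · intro p hp p' hp' h
    obtain ⟨h1, h2⟩ := hdvd p hp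
    obtain ⟨h3, h4⟩ := hdvd p' hp'
    simp only [Prod.mk.injEq] at h
    exact Prod.ext (by lia) (by lia)

lemma dvd_of_dvd_sq_add_sq {p : ℕ} (hp : p.Prime) (h3 : p % 4 = 3) {x y : ℤ}
    (h : (p : ℤ) ∣ x ^ 2 + y ^ 2) : (p : ℤ) ∣ x ∧ (p : ℤ) ∣ y := by
  have := Fact.mk hp
  have key : ∀ x y : ℤ, (p : ℤ) ∣ x ^ 2 + y ^ 2 → (p : ℤ) ∣ x := by
    intro x y h
    by_contra hx
    have h1 : (x : ZMod p) ^ 2 + (y : ZMod p) ^ 2 = 0 := by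
      have := (ZMod.intCast_zmod_eq_zero_iff_dvd (x ^ 2 + y ^ 2) p).2 h
      exact_mod_cast this
    have h2 : (x : ZMod p) ≠ 0 := fun h => hx ((ZMod.intCast_zmod_eq_zero_iff_dvd x p).1 h)
    refine ZMod.mod_four_ne_three_of_sq_eq_neg_one (p := p) (y := (y : ZMod p) / x) ?_ h3
    field_simp
    linear_combination h1
  exact ⟨key x y h, key y x (by rwa [add_comm])⟩

lemma r2_sq_mul_le {p : ℕ} (hp : p.Prime) (h3 : p % 4 = 3) (m : ℕ) :
    r2 (p ^ 2 * m) ≤ r2 m := by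
  rw [r2_eq_card, r2_eq_card]
  have hp0 : (p : ℤ) ≠ 0 := by exact_mod_cast hp.ne_zero
  have hdvd : ∀ x ∈ reps (p ^ 2 * m), (p : ℤ) ∣ x.1 ∧ (p : ℤ) ∣ x.2 := fun x hx => by
    rw [mem_reps] at hx
    refine dvd_of_dvd_sq_add_sq hp h3 ?_
    rw [hx]
    push_cast
    exact ⟨p * m, by ring⟩
  refine card_le_card_of_injOn (fun x => (x.1 / p, x.2 / p)) ?_ ?_
  · intro x hx
    obtain ⟨⟨a, ha⟩, ⟨b, hb⟩⟩ := hdvd x hx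
    rw [mem_coe, mem_reps] at *
    simp only [ha, hb]
    rw [Int.mul_ediv_cancel_left _ hp0, Int.mul_ediv_cancel_left _ hp0]
    push_cast at hx
    rw [ha, hb] at hx
    have : (p : ℤ) ^ 2 * (a ^ 2 + b ^ 2) = p ^ 2 * m := by linarith
    exact mul_left_cancel₀ (pow_ne_zero 2 hp0) this
  · intro x hx x' hx' h
    obtain ⟨⟨a, ha⟩, ⟨b, hb⟩⟩ := hdvd x hx
    obtain ⟨⟨a', ha'⟩, ⟨b', hb'⟩⟩ := hdvd x' hx'
    simp only [Prod.mk.injEq, ha, hb, ha', hb', Int.mul_ediv_cancel_left _ hp0] at h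
    exact Prod.ext (by rw [ha, ha', h.1]) (by rw [hb, hb', h.2])

lemma r2_prime_mul_le {p : ℕ} (hp : p.Prime) (h1 : p % 4 = 1) (m : ℕ) :
    r2 (p * m) ≤ 2 * r2 m := by
  have := Fact.mk hp
  obtain ⟨a', b', hab⟩ := Nat.Prime.sq_add_sq (p := p) (by lia)
  have hp0 : (p : ℤ) ≠ 0 := by exact_mod_cast hp.ne_zero
  have hpp : Prime (p : ℤ) := Nat.prime_iff_prime_int.1 hp
  obtain ⟨a, b, hab⟩ : ∃ a b : ℤ, a ^ 2 + b ^ 2 = p := ⟨a', b', by exact_mod_cast hab⟩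
  rw [r2_eq_card, r2_eq_card]
  have hsub : reps (p * m) ⊆
      (reps m).image (fun x => (x.1 * a - x.2 * b, x.1 * b + x.2 * a)) ∪
        (reps m).image (fun x => (x.1 * a + x.2 * b, x.2 * a - x.1 * b)) := by
    rintro ⟨x, y⟩ hx
    rw [mem_reps] at hx
    push_cast at hx
    have hdvd : (p : ℤ) ∣ (a * x + b * y) * (a * x - b * y) :=
      ⟨a ^ 2 * m - y ^ 2, by linear_combination a ^ 2 * hx - y ^ 2 * hab⟩
    rw [mem_union, mem_image, mem_image]
    rcases hpp.dvd_or_dvd hdvd with h | h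
    · left
      have h2 : (p : ℤ) ∣ a * y - b * x := by
        refine hpp.dvd_of_dvd_pow (n := 2) ?_
        have : (a * y - b * x) ^ 2 = p * (p * m) - (a * x + b * y) ^ 2 := by
          rw [← hx]
          linear_combination (x ^ 2 + y ^ 2) * hab
        rw [this]
        exact dvd_sub (Dvd.intro _ rfl) (dvd_pow h two_ne_zero)
      obtain ⟨u, hu⟩ := h
      obtain ⟨v, hv⟩ := h2
      have e1 : u * a - v * b = x := mul_left_cancel₀ hp0 (by
        linear_combination (-a) * hu + b * hv + x * hab)
      have e2 : u * b + v * a = y := mul_left_cancel₀ hp0 (by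
        linear_combination (-b) * hu - a * hv + y * hab)
      refine ⟨(u, v), mem_reps.2 (mul_left_cancel₀ hp0 ?_), Prod.ext e1 e2⟩
      rw [← e1, ← e2] at hx
      simp only
      linear_combination hx - (u ^ 2 + v ^ 2) * hab
    · right
      have h2 : (p : ℤ) ∣ a * y + b * x := by
        refine hpp.dvd_of_dvd_pow (n := 2) ?_
        have : (a * y + b * x) ^ 2 = p * (p * m) - (a * x - b * y) ^ 2 := by
          rw [← hx]
          linear_combination (x ^ 2 + y ^ 2) * hab
        rw [this]
        exact dvd_sub (Dvd.intro _ rfl) (dvd_pow h two_ne_zero)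
      obtain ⟨u, hu⟩ := h
      obtain ⟨v, hv⟩ := h2
      have e1 : u * a + v * b = x := mul_left_cancel₀ hp0 (by
        linear_combination (-a) * hu - b * hv + x * hab)
      have e2 : v * a - u * b = y := mul_left_cancel₀ hp0 (by
        linear_combination b * hu - a * hv + y * hab)
      refine ⟨(u, v), mem_reps.2 (mul_left_cancel₀ hp0 ?_), Prod.ext e1 e2⟩
      rw [← e1, ← e2] at hx
      simp only
      linear_combination hx - (u ^ 2 + v ^ 2) * hab
  refine (card_le_card hsub).trans ((card_union_le _ _).trans ?_)
  rw [two_mul]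
  exact add_le_add card_image_le card_image_le

/-- The number of prime factors congruent to `1` mod `4`, counted with multiplicity. -/
def bigOmega1 (n : ℕ) : ℕ := n.primeFactorsList.countP fun p => p % 4 = 1

lemma bigOmega1_mul {m n : ℕ} (hm : m ≠ 0) (hn : n ≠ 0) :
    bigOmega1 (m * n) = bigOmega1 m + bigOmega1 n := by
  unfold bigOmega1
  rw [(Nat.perm_primeFactorsList_mul hm hn).countP_eq, List.countP_append]

lemma bigOmega1_prime {p : ℕ} (hp : p.Prime) : bigOmega1 p = if p % 4 = 1 then 1 else 0 := by
  unfold bigOmega1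
  rw [Nat.primeFactorsList_prime hp]
  simp [List.countP_singleton]

lemma isOmegaLike_bigOmega1 : IsOmegaLike bigOmega1 where
  mul hm hn _ := bigOmega1_mul hm hn
  pow_le := by
    intro p hp a
    unfold bigOmega1
    rw [Nat.Prime.primeFactorsList_pow hp]
    exact List.countP_le_length.trans_eq (List.length_replicate)
  prime hp h := by rw [bigOmega1_prime hp, if_pos h]

lemma isOmegaLike_omega1 : IsOmegaLike omega1 where
  mul hm hn h := by
    unfold omega1
    rw [Nat.primeFactors_mul hm hn, filter_union, card_union_of_disjoint]
    exact disjoint_filter_filter h.disjoint_primeFactors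
  pow_le := by
    intro p hp a
    unfold omega1
    rcases Nat.eq_zero_or_pos a with rfl | ha
    · simp
    · rw [Nat.primeFactors_prime_pow ha.ne' hp]
      exact (card_filter_le _ _).trans (by rw [card_singleton]; exact ha)
  prime hp h := by
    unfold omega1
    rw [hp.primeFactors, filter_singleton, if_pos h, card_singleton]

lemma r2_le_two_pow (n : ℕ) (hn : 0 < n) : r2 n ≤ 4 * 2 ^ bigOmega1 n := by
  induction n using Nat.strong_induction_on with
  | _ n ih =>
    rcases eq_or_ne n 1 with rfl | h1
    · exact r2_one_le.trans (Nat.le_mul_of_pos_right 4 (by positivity))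
    by_cases hS : n ∈ SOS
    swap
    · rw [r2_eq_zero hS]; exact Nat.zero_le _
    have hp := Nat.minFac_prime h1
    obtain ⟨m, hm⟩ := Nat.minFac_dvd n
    set p := n.minFac
    have hm0 : 0 < m := Nat.pos_of_ne_zero (by rintro rfl; lia)
    have hlt : m < n := by nlinarith [hp.two_le]
    have hle := ih m hlt hm0
    have hmul : bigOmega1 n = bigOmega1 p + bigOmega1 m := by
      rw [hm, bigOmega1_mul hp.ne_zero hm0.ne']
    rcases hp.eq_two_or_odd with h2 | hodd
    · have h3 : r2 n ≤ r2 m := by rw [hm, h2]; exact r2_two_mul_le m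
      refine h3.trans (hle.trans ?_)
      gcongr
      · norm_num
      · lia
    · have h4 : p % 4 = 1 ∨ p % 4 = 3 := by lia
      rcases h4 with h4 | h4
      · have h3 : r2 n ≤ 2 * r2 m := by rw [hm]; exact r2_prime_mul_le hp h4 m
        rw [hmul, bigOmega1_prime hp, if_pos h4, pow_add]
        lia
      · have hpd : p ∣ m := by
          by_contra hc
          exact ExactDvd.notMem_SOS hp h4 ⟨⟨m, hm⟩, fun h => hc (by
            rw [hm, sq] at h
            exact Nat.dvd_of_mul_dvd_mul_left hp.pos h)⟩ hS
        obtain ⟨l, hl⟩ := hpd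
        have hl0 : 0 < l := Nat.pos_of_ne_zero (by rintro rfl; lia)
        have hle' := ih l (by nlinarith [hp.two_le]) hl0
        have h3 : r2 n ≤ r2 l := by
          have : n = p ^ 2 * l := by rw [sq, mul_assoc, ← hl]; exact hm
          rw [this]
          exact r2_sq_mul_le hp h4 l
        refine h3.trans (hle'.trans ?_)
        have : bigOmega1 m = bigOmega1 p + bigOmega1 l := by
          rw [hl, bigOmega1_mul hp.ne_zero hl0.ne']
        gcongr
        · norm_num
        · lia

lemma exists_sq_add_sq_eq_prime_pow {p : ℕ} (hp : p.Prime) (h1 : p % 4 = 1) (a : ℕ) :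
    ∃ A B : ℤ, A ^ 2 + B ^ 2 = (p : ℤ) ^ (a + 1) ∧ ¬ (p : ℤ) ∣ A := by
  have := Fact.mk hp
  have hpp : Prime (p : ℤ) := Nat.prime_iff_prime_int.1 hp
  obtain ⟨x', y', hxy⟩ := Nat.Prime.sq_add_sq (p := p) (by lia)
  obtain ⟨x, y, hxy⟩ : ∃ x y : ℤ, x ^ 2 + y ^ 2 = p := ⟨x', y', by exact_mod_cast hxy⟩
  have hx : ¬ (p : ℤ) ∣ x := by
    intro h
    have hy : (p : ℤ) ∣ y := hpp.dvd_of_dvd_pow (n := 2) (by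
      have : y ^ 2 = p - x ^ 2 := by linarith
      rw [this]
      exact dvd_sub dvd_rfl (dvd_pow h two_ne_zero))
    obtain ⟨u, rfl⟩ := h
    obtain ⟨v, rfl⟩ := hy
    have h2 : (p : ℤ) * (u ^ 2 + v ^ 2) = 1 := mul_left_cancel₀ hpp.ne_zero (by
      linear_combination hxy)
    exact hpp.not_dvd_one ⟨_, h2.symm⟩
  have h2 : ¬ (p : ℤ) ∣ 2 := by
    intro h
    have := Int.le_of_dvd (by norm_num) h
    have := hp.two_le
    lia
  induction a with
  | zero => exact ⟨x, y, by simpa using hxy, hx⟩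
  | succ a ih =>
    obtain ⟨A, B, hAB, hA⟩ := ih
    by_cases h : (p : ℤ) ∣ A * x - B * y
    · refine ⟨A * x + B * y, A * y - B * x, ?_, fun h' => ?_⟩
      · rw [pow_succ (p : ℤ), ← hAB, ← hxy]; ring
      · have h3 : (p : ℤ) ∣ 2 * (A * x) := by
          have := dvd_add h h'
          rwa [show A * x - B * y + (A * x + B * y) = 2 * (A * x) by ring] at this
        rcases hpp.dvd_or_dvd h3 with h4 | h4
        · exact h2 h4
        · rcases hpp.dvd_or_dvd h4 with h5 | h5
          exacts [hA h5, hx h5]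
    · exact ⟨A * x - B * y, A * y + B * x, by rw [pow_succ (p : ℤ), ← hAB, ← hxy]; ring, h⟩

lemma two_mul_r2_le {p : ℕ} (hp : p.Prime) (h1 : p % 4 = 1) (a : ℕ) {m : ℕ} (hm : ¬ p ∣ m) :
    2 * r2 m ≤ r2 (p ^ (a + 1) * m) := by
  obtain ⟨A, B, hAB, hA⟩ := exists_sq_add_sq_eq_prime_pow hp h1 a
  have hpp : Prime (p : ℤ) := Nat.prime_iff_prime_int.1 hp
  have hpa : (p : ℤ) ^ (a + 1) ≠ 0 := pow_ne_zero _ hpp.ne_zero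
  have hdv : (p : ℤ) ∣ A ^ 2 + B ^ 2 := by rw [hAB]; exact dvd_pow_self _ (by lia)
  have h2 : ¬ (p : ℤ) ∣ 2 := by
    intro h
    have := Int.le_of_dvd (by norm_num) h
    have := hp.two_le
    lia
  have hinj : ∀ C : ℤ, A ^ 2 + C ^ 2 = (p : ℤ) ^ (a + 1) →
      Function.Injective fun x : ℤ × ℤ => (x.1 * A - x.2 * C, x.1 * C + x.2 * A) := by
    rintro C hC ⟨x, y⟩ ⟨x', y'⟩ h
    simp only [Prod.mk.injEq] at h
    refine Prod.ext (mul_left_cancel₀ hpa ?_) (mul_left_cancel₀ hpa ?_)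
    · rw [← hC]; linear_combination A * h.1 + C * h.2
    · rw [← hC]; linear_combination A * h.2 - C * h.1
  have hmem : ∀ C : ℤ, A ^ 2 + C ^ 2 = (p : ℤ) ^ (a + 1) → ∀ x ∈ reps m,
      (x.1 * A - x.2 * C, x.1 * C + x.2 * A) ∈ reps (p ^ (a + 1) * m) := by
    intro C hC x hx
    rw [mem_reps] at *
    push_cast
    linear_combination (x.1 ^ 2 + x.2 ^ 2) * hC + (p : ℤ) ^ (a + 1) * hx
  have hAB' : A ^ 2 + (-B) ^ 2 = (p : ℤ) ^ (a + 1) := by rw [neg_sq]; exact hAB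
  set s := (reps m).image fun x => (x.1 * A - x.2 * B, x.1 * B + x.2 * A)
  set t := (reps m).image fun x => (x.1 * A - x.2 * (-B), x.1 * (-B) + x.2 * A)
  have hst : Disjoint s t := by
    refine disjoint_left.2 fun w hs ht => ?_
    obtain ⟨x, hx, rfl⟩ := mem_image.1 hs
    obtain ⟨x', hx', h⟩ := mem_image.1 ht
    simp only [Prod.mk.injEq] at h
    rw [mem_reps] at hx
    have e1 : x.1 * (A ^ 2 - B ^ 2) - x.2 * (2 * A * B) = x'.1 * (A ^ 2 + B ^ 2) := by
      linear_combination (-A) * h.1 + B * h.2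
    have e2 : x.1 * (2 * A * B) + x.2 * (A ^ 2 - B ^ 2) = x'.2 * (A ^ 2 + B ^ 2) := by
      linear_combination (-B) * h.1 - A * h.2
    have e3 : (A ^ 2 - B ^ 2) * m = (x'.1 * x.1 + x'.2 * x.2) * (A ^ 2 + B ^ 2) := by
      linear_combination x.1 * e1 + x.2 * e2 - (A ^ 2 - B ^ 2) * hx
    have e4 : (p : ℤ) ∣ (A ^ 2 - B ^ 2) * m := by rw [e3]; exact hdv.mul_left _
    rcases hpp.dvd_or_dvd e4 with h5 | h5
    · have h6 := dvd_add h5 hdv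
      rw [show A ^ 2 - B ^ 2 + (A ^ 2 + B ^ 2) = 2 * A ^ 2 by ring] at h6
      rcases hpp.dvd_or_dvd h6 with h7 | h7
      exacts [h2 h7, hA (hpp.dvd_of_dvd_pow h7)]
    · exact hm (by exact_mod_cast h5)
  have hsub : s ∪ t ⊆ reps (p ^ (a + 1) * m) := by
    refine union_subset ?_ ?_
    · refine image_subset_iff.2 (hmem B hAB)
    · refine image_subset_iff.2 (hmem (-B) hAB')
  have := card_le_card hsub
  rw [card_union_of_disjoint hst, card_image_of_injective _ (hinj B hAB),
    card_image_of_injective _ (hinj (-B) hAB'), ← two_mul] at this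
  rwa [r2_eq_card, r2_eq_card]

lemma two_pow_omega1_le_r2 (n : ℕ) (hn : 0 < n) (hS : n ∈ SOS) : 2 ^ omega1 n ≤ r2 n := by
  induction n using Nat.strong_induction_on with
  | _ n ih =>
    rcases Nat.eq_zero_or_pos (omega1 n) with h0 | h0
    · rw [h0, pow_zero]; exact r2_pos hS
    obtain ⟨p, hp⟩ := card_pos.1 h0
    obtain ⟨hp, h1⟩ := mem_filter.1 hp
    obtain ⟨hp, hpn, _⟩ := Nat.mem_primeFactors.1 hp
    obtain ⟨b, m, hm, hbm⟩ := Nat.exists_eq_pow_mul_and_not_dvd hn.ne' p hp.ne_one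
    obtain ⟨a, rfl⟩ : ∃ a, b = a + 1 := by
      refine ⟨b - 1, (Nat.succ_pred_eq_of_pos (Nat.pos_of_ne_zero ?_)).symm⟩
      rintro rfl
      rw [pow_zero, one_mul] at hbm
      exact hm (hbm ▸ hpn)
    have hm0 : 0 < m := Nat.pos_of_ne_zero (by rintro rfl; exact hm (dvd_zero p))
    have hcop : (p ^ (a + 1)).Coprime m := ((Nat.Prime.coprime_iff_not_dvd hp).2 hm).pow_left _
    have hpa : p ^ (a + 1) ≠ 0 := pow_ne_zero _ hp.ne_zero
    have hmS : m ∈ SOS := by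
      rw [hbm] at hS
      exact ((coprime_mul_mem_SOS_iff hpa hm0.ne' hcop).1 hS).2
    have hlt : m < n := by
      rw [hbm]
      have : 1 < p ^ (a + 1) := Nat.one_lt_pow (by lia) hp.one_lt
      nlinarith
    have ho : omega1 n = 1 + omega1 m := by
      rw [hbm, isOmegaLike_omega1.mul hpa hm0.ne' hcop]
      congr 1
      unfold omega1
      rw [Nat.primeFactors_prime_pow (by lia) hp, filter_singleton, if_pos h1, card_singleton]
    rw [ho, pow_add, pow_one]
    calc _ ≤ 2 * r2 m := by gcongr; exact ih m hlt hm0 hmS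
      _ ≤ r2 n := by rw [hbm]; exact two_mul_r2_le hp h1 a hm

end RepresentationNumbers

noncomputable section Density

open Finset Filter Topology
open scoped Classical

/-- The sequence `ν` enumerates the sums of two squares increasingly. -/
structure IsSOSEnum (ν : ℕ → ℕ) : Prop where
  mono : StrictMono ν
  range : Set.range ν = SOS

namespace IsSOSEnum

lemma mem {ν : ℕ → ℕ} (hν : IsSOSEnum ν) (j : ℕ) : ν j ∈ SOS := hν.range ▸ Set.mem_range_self j

lemma exists_eq {ν : ℕ → ℕ} (hν : IsSOSEnum ν) {n : ℕ} (hn : n ∈ SOS) : ∃ k, ν k = n := by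
  rw [← hν.range] at hn
  exact hn

lemma zero {ν : ℕ → ℕ} (hν : IsSOSEnum ν) : ν 0 = 0 := by
  obtain ⟨k, hk⟩ := hν.exists_eq zero_mem_SOS
  have := hν.mono.monotone (Nat.zero_le k)
  lia

lemma pos {ν : ℕ → ℕ} (hν : IsSOSEnum ν) {j : ℕ} (hj : 1 ≤ j) : 0 < ν j := by
  have := hν.mono (show 0 < j from hj)
  lia

lemma le_apply {ν : ℕ → ℕ} (hν : IsSOSEnum ν) (j : ℕ) : j ≤ ν j := hν.mono.le_apply

lemma add_le {ν : ℕ → ℕ} (hν : IsSOSEnum ν) (j d : ℕ) : ν j + d ≤ ν (j + d) := by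
  have := hν.mono.add_le_nat d j
  rw [add_comm (ν j), add_comm j]
  exact this

lemma tendsto {ν : ℕ → ℕ} (hν : IsSOSEnum ν) : Tendsto ν atTop atTop := hν.mono.tendsto_atTop

lemma image_Icc {ν : ℕ → ℕ} (hν : IsSOSEnum ν) (k : ℕ) : (Icc 1 k).image ν = sosIoc (ν k) := by
  ext n
  rw [mem_image, mem_sosIoc]
  constructor
  · rintro ⟨j, hj, rfl⟩
    rw [mem_Icc] at hj
    exact ⟨⟨hν.pos hj.1, hν.mono.monotone hj.2⟩, hν.mem j⟩
  · rintro ⟨⟨h0, hk⟩, hn⟩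
    obtain ⟨j, rfl⟩ := hν.exists_eq hn
    refine ⟨j, mem_Icc.2 ⟨?_, hν.mono.le_iff_le.1 hk⟩, rfl⟩
    rcases Nat.eq_zero_or_pos j with rfl | h
    · rw [hν.zero] at h0; lia
    · exact h

lemma sum_Icc {ν : ℕ → ℕ} (hν : IsSOSEnum ν) (k : ℕ) (f : ℕ → ℝ) : ∑ j ∈ Icc 1 k, f (ν j) = ∑ n ∈ sosIoc (ν k), f n := by
  rw [← hν.image_Icc, sum_image fun a _ b _ h => hν.mono.injective h]

lemma card_sosIoc {ν : ℕ → ℕ} (hν : IsSOSEnum ν) (k : ℕ) : (sosIoc (ν k)).card = k := by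
  rw [← hν.image_Icc, card_image_of_injective _ hν.mono.injective, Nat.card_Icc]
  lia

lemma _root_.two_mul_mem_SOS {n : ℕ} (hn : n ∈ SOS) : 2 * n ∈ SOS :=
  SOS_mul_mem (prime_mem_SOS Nat.prime_two (by norm_num)) hn

lemma succ_le_two_mul {ν : ℕ → ℕ} (hν : IsSOSEnum ν) {j : ℕ} (hj : 1 ≤ j) : ν (j + 1) ≤ 2 * ν j := by
  obtain ⟨k, hk⟩ := hν.exists_eq (two_mul_mem_SOS (hν.mem j))
  have h0 := hν.pos hj
  have : j < k := hν.mono.lt_iff_lt.1 (by lia)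
  rw [← hk]
  exact hν.mono.monotone this

end IsSOSEnum

/-- The number of elements of `S` in `[1, k]`. -/
def countIn (S : Set ℕ) (k : ℕ) : ℕ := (S ∩ Set.Icc 1 k).ncard

lemma countIn_le_card {S : Set ℕ} {k : ℕ} {T : Finset ℕ}
    (h : ∀ j ∈ S, 1 ≤ j → j ≤ k → j ∈ T) : countIn S k ≤ T.card := by
  unfold countIn
  rw [← Set.ncard_coe_finset T]
  exact Set.ncard_le_ncard (fun j hj => h j hj.1 hj.2.1 hj.2.2) T.finite_toSet

lemma countIn_add_compl (S : Set ℕ) (k : ℕ) : countIn S k + countIn Sᶜ k = k := by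
  unfold countIn
  rw [Set.inter_comm, Set.inter_comm Sᶜ, ← Set.sdiff_eq,
    Set.ncard_inter_add_ncard_sdiff_eq_ncard _ _ (Set.finite_Icc 1 k), ← coe_Icc,
    Set.ncard_coe_finset, Nat.card_Icc]
  lia

/-- The set `S` has natural density zero. -/
def ZeroDens (S : Set ℕ) : Prop :=
  Tendsto (fun k : ℕ => (countIn S k : ℝ) / k) atTop (𝓝 0)

lemma zeroDens_of_le {S : Set ℕ} {u : ℕ → ℝ} (hu : Tendsto u atTop (𝓝 0))
    (h : ∀ᶠ k in atTop, (countIn S k : ℝ) / k ≤ u k) : ZeroDens S :=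
  squeeze_zero' (Eventually.of_forall fun k => by positivity) h hu

lemma ZeroDens.mono {S T : Set ℕ} (hT : ZeroDens T) (h : S ⊆ T) : ZeroDens S :=
  zeroDens_of_le hT (Eventually.of_forall fun k => by
    gcongr
    exact Set.ncard_le_ncard (Set.inter_subset_inter_left _ h) ((Set.finite_Icc 1 k).inter_of_right _))

lemma ZeroDens.union {S T : Set ℕ} (hS : ZeroDens S) (hT : ZeroDens T) : ZeroDens (S ∪ T) := by
  refine zeroDens_of_le (by simpa using Tendsto.add hS hT) (Eventually.of_forall fun k => ?_)
  rw [← add_div]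
  gcongr
  unfold countIn
  rw [Set.union_inter_distrib_right]
  exact_mod_cast Set.ncard_union_le _ _

lemma tendsto_const_div_natCast (C : ℝ) : Tendsto (fun k : ℕ => C / (k : ℝ)) atTop (𝓝 0) :=
  tendsto_const_nhds.div_atTop tendsto_natCast_atTop_atTop

lemma ZeroDens.shift {S : Set ℕ} (hS : ZeroDens S) : ZeroDens {j | j - 1 ∈ S} := by
  have hu : Tendsto (fun k : ℕ => (1 : ℝ) / k + (countIn S k : ℝ) / k) atTop (𝓝 (0 + 0)) :=
    Tendsto.add (tendsto_const_div_natCast 1) hS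
  rw [add_zero] at hu
  refine zeroDens_of_le hu (Eventually.of_forall fun k => ?_)
  rw [← add_div]
  gcongr
  have h : {j | j - 1 ∈ S} ∩ Set.Icc 1 k ⊆ insert 1 ((· + 1) '' (S ∩ Set.Icc 1 k)) := by
    rintro j ⟨hj, hj1, hjk⟩
    rcases eq_or_ne j 1 with h | h
    · exact Or.inl h
    · exact Or.inr ⟨j - 1, ⟨hj, by lia, by lia⟩, by lia⟩
  have hfin : (S ∩ Set.Icc 1 k).Finite := (Set.finite_Icc 1 k).inter_of_right _
  have h2 := (Set.ncard_le_ncard h ((hfin.image _).insert 1)).trans (Set.ncard_insert_le _ _)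
  have h3 := Set.ncard_image_le (f := (· + 1)) hfin
  have h4 : countIn {j | j - 1 ∈ S} k ≤ 1 + countIn S k := by
    unfold countIn
    lia
  exact_mod_cast h4

lemma zeroDens_of_eventually {S : Set ℕ} (h : ∀ᶠ j in atTop, j ∉ S) : ZeroDens S := by
  obtain ⟨M, hM⟩ := eventually_atTop.1 h
  refine zeroDens_of_le (tendsto_const_div_natCast M) (Eventually.of_forall fun k => ?_)
  gcongr
  rw [← card_range M]
  refine countIn_le_card fun j hj _ _ => ?_
  rw [mem_range]
  by_contra hc
  exact hM j (by lia) hj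

lemma ZeroDens.fullDensityIdx_compl {S : Set ℕ} (hS : ZeroDens S) : FullDensityIdx Sᶜ := by
  unfold FullDensityIdx
  have h : Tendsto (fun k : ℕ => 1 - (countIn S k : ℝ) / k) atTop (𝓝 (1 - 0)) :=
    tendsto_const_nhds.sub hS
  rw [sub_zero] at h
  refine h.congr' ?_
  filter_upwards [eventually_ge_atTop 1] with k hk
  have hk' : (0 : ℝ) < k := by exact_mod_cast hk
  rw [Nat.card_coe_set_eq, one_sub_div hk'.ne']
  congr 1
  rw [sub_eq_iff_eq_add, add_comm]
  exact_mod_cast (countIn_add_compl S k).symm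

lemma ZeroDens.frequently_notMem {S : Set ℕ} (hS : ZeroDens S) : ∃ᶠ j in atTop, j ∉ S := by
  intro h
  simp only [not_not] at h
  have h1 : ZeroDens Sᶜ := zeroDens_of_eventually (h.mono fun j hj => by simpa using hj)
  have h2 : Tendsto (fun k : ℕ => (countIn S k : ℝ) / k + (countIn Sᶜ k : ℝ) / k) atTop
    (𝓝 (0 + 0)) := Tendsto.add hS h1
  rw [add_zero] at h2
  have h3 : Tendsto (fun _ : ℕ => (1 : ℝ)) atTop (𝓝 0) := by
    refine h2.congr' ?_
    filter_upwards [eventually_ge_atTop 1] with k hk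
    have hk' : (0 : ℝ) < k := by exact_mod_cast hk
    rw [← add_div, div_eq_one_iff_eq hk'.ne']
    exact_mod_cast countIn_add_compl S k
  exact zero_ne_one (tendsto_nhds_unique h3 tendsto_const_nhds)

lemma half_log_le {N n : ℕ} (hN : 1 ≤ N) (h : N < n ^ 2) : Real.log N / 2 ≤ Real.log n := by
  have h0 : (0 : ℝ) < N := by exact_mod_cast hN
  have h1 : (N : ℝ) ≤ (n : ℝ) ^ 2 := by exact_mod_cast h.le
  have h2 := Real.log_le_log h0 h1
  rw [Real.log_pow] at h2
  push_cast at h2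
  linarith

lemma two_rpow_mul_rpow_le {L l b : ℝ} (hL : 0 < L) (h1 : L / 2 ≤ l) (h2 : l ≤ L) :
    2 ^ (-|b|) * L ^ b ≤ l ^ b := by
  have hl : 0 < l := by linarith
  rcases le_total 0 b with hb | hb
  · rw [abs_of_nonneg hb]
    calc _ = (L / 2) ^ b := by
          rw [Real.div_rpow hL.le (by norm_num), Real.rpow_neg (by norm_num)]
          field_simp
      _ ≤ _ := Real.rpow_le_rpow (by positivity) h1 hb
  · calc _ ≤ 1 * L ^ b := by
          gcongr
          exact Real.rpow_le_one_of_one_le_of_nonpos (by norm_num) (by simp)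
      _ = L ^ b := one_mul _
      _ ≤ _ := Real.rpow_le_rpow_of_nonpos hl h2 hb

/-- A Markov inequality: if `G` is at most `(log n) ^ a` on average over the sums of two squares
`n = ν j`, then for `b > a` it is at most `(log n) ^ b` outside a set of density zero. -/
lemma IsSOSEnum.zeroDens_of_sum_le {ν : ℕ → ℕ} (hν : IsSOSEnum ν) {G : ℕ → ℝ}
    (hG : ∀ j, 0 ≤ G j) {a b : ℝ} (hab : a < b)
    (h : ∃ C, ∀ᶠ k in atTop, ∑ j ∈ (Icc 1 k).filter (fun j => ν k < ν j ^ 2), G j ≤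
      C * (ν k * Real.log (ν k) ^ (-(1 / 2) + a))) :
    ZeroDens {j | Real.log (ν j) ^ b < G j} := by
  obtain ⟨C, h⟩ := h
  obtain ⟨c, hc, N₀, hcard⟩ := exists_le_card_sosIoc
  have hlog : Tendsto (fun k => Real.log (ν k)) atTop atTop :=
    tendsto_log_natCast.comp hν.tendsto
  have hu1 : Tendsto (fun k => 1 / c * (Real.log (ν k) ^ (1 / 2 : ℝ) / (ν k : ℝ) ^ (1 / 2 : ℝ)))
      atTop (𝓝 (1 / c * 0)) := by
    refine Tendsto.const_mul _ ?_
    have h1 := (isLittleO_log_rpow_rpow_atTop (1 / 2) (by norm_num : (0 : ℝ) < 1 / 2)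
      ).tendsto_div_nhds_zero
    exact h1.comp (tendsto_natCast_atTop_atTop.comp hν.tendsto)
  have hu2 : Tendsto (fun k => |C| * 2 ^ |b| / c * Real.log (ν k) ^ (-(b - a))) atTop
      (𝓝 (|C| * 2 ^ |b| / c * 0)) :=
    ((tendsto_rpow_neg_atTop (by linarith : 0 < b - a)).comp hlog).const_mul _
  refine zeroDens_of_le (by simpa using hu1.add hu2) ?_
  filter_upwards [h, hν.tendsto.eventually (eventually_ge_atTop N₀), eventually_ge_atTop 1,
    hlog.eventually_ge_atTop 1] with k hk hkN hk1 hkL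
  set N := ν k with hN
  set L := Real.log N with hL
  have hL0 : 0 < L := by linarith
  have hN0 : 0 < N := hν.pos hk1
  have hN0' : (0 : ℝ) < N := by exact_mod_cast hN0
  have hk0 : (0 : ℝ) < k := by exact_mod_cast hk1
  have hck := hcard N hkN
  rw [hN, hν.card_sosIoc k, ← hN, ← hL] at hck
  set S := {j | Real.log (ν j) ^ b < G j} with hS
  have hsplit : (countIn S k : ℝ) ≤
      (((Icc 1 k).filter fun j => ¬ N < ν j ^ 2).card : ℝ) +
        ((((Icc 1 k).filter fun j => N < ν j ^ 2).filter (· ∈ S)).card : ℝ) := by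
    have h1 := countIn_le_card (S := S) (k := k)
      (T := ((Icc 1 k).filter fun j => ¬ N < ν j ^ 2) ∪
        (((Icc 1 k).filter fun j => N < ν j ^ 2).filter (· ∈ S))) fun j hj h1 h2 => by
      rw [mem_union, mem_filter, mem_filter, mem_filter, mem_Icc]
      tauto
    exact_mod_cast h1.trans (card_union_le _ _)
  have hfirst : (((Icc 1 k).filter fun j => ¬ N < ν j ^ 2).card : ℝ) ≤ (N : ℝ) ^ (1 / 2 : ℝ) := by
    rw [← Real.sqrt_eq_rpow]
    refine le_trans ?_ (Real.nat_sqrt_le_real_sqrt (a := N))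
    have h1 : ((Icc 1 k).filter fun j => ¬ N < ν j ^ 2) ⊆ Icc 1 N.sqrt := by
      intro j hj
      rw [mem_filter, mem_Icc, not_lt] at hj
      rw [mem_Icc, Nat.le_sqrt']
      exact ⟨hj.1.1, le_trans (Nat.pow_le_pow_left (hν.le_apply j) 2) hj.2⟩
    have := card_le_card h1
    rw [Nat.card_Icc] at this
    exact_mod_cast this
  have hsecond : ((((Icc 1 k).filter fun j => N < ν j ^ 2).filter (· ∈ S)).card : ℝ) *
      (2 ^ (-|b|) * L ^ b) ≤ |C| * (N * L ^ (-(1 / 2) + a)) := by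
    calc _ = (((Icc 1 k).filter fun j => N < ν j ^ 2).filter (· ∈ S)).card •
          (2 ^ (-|b|) * L ^ b) := by rw [nsmul_eq_mul]
      _ ≤ ∑ j ∈ ((Icc 1 k).filter fun j => N < ν j ^ 2).filter (· ∈ S), G j := by
          refine card_nsmul_le_sum _ _ _ fun j hj => ?_
          rw [mem_filter, mem_filter, mem_Icc] at hj
          refine le_trans ?_ (le_of_lt hj.2)
          refine two_rpow_mul_rpow_le hL0 (half_log_le hN0 hj.1.2) ?_
          exact Real.log_le_log (by exact_mod_cast hν.pos hj.1.1.1)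
            (by exact_mod_cast hν.mono.monotone hj.1.1.2)
      _ ≤ ∑ j ∈ (Icc 1 k).filter fun j => N < ν j ^ 2, G j :=
          sum_le_sum_of_subset_of_nonneg (filter_subset _ _) fun j _ _ => hG j
      _ ≤ C * (N * L ^ (-(1 / 2) + a)) := hk
      _ ≤ |C| * (N * L ^ (-(1 / 2) + a)) := by gcongr; exact le_abs_self C
  set A := ((((Icc 1 k).filter fun j => N < ν j ^ 2).filter (· ∈ S)).card : ℝ) with hA
  have hA0 : 0 ≤ A := Nat.cast_nonneg _
  have hA2 : A ≤ |C| * 2 ^ |b| * (N * L ^ (-(1 / 2) + a - b)) := by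
    have h1 : (0 : ℝ) < 2 ^ (-|b|) * L ^ b := by positivity
    rw [← le_div_iff₀ h1] at hsecond
    refine hsecond.trans_eq ?_
    rw [Real.rpow_sub hL0, Real.rpow_neg (by norm_num : (0 : ℝ) ≤ 2)]
    field_simp
  have hbound : (countIn S k : ℝ) ≤
      (N : ℝ) ^ (1 / 2 : ℝ) + |C| * 2 ^ |b| * (N * L ^ (-(1 / 2) + a - b)) := by linarith
  have hden : 0 < c * N * L ^ (-(1 / 2) : ℝ) := by positivity
  calc _ ≤ ((N : ℝ) ^ (1 / 2 : ℝ) + |C| * 2 ^ |b| * (N * L ^ (-(1 / 2) + a - b))) /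
        (c * N * L ^ (-(1 / 2) : ℝ)) := by gcongr
    _ = _ := by
      rw [add_div]
      congr 1
      · have h1 : (N : ℝ) = (N : ℝ) ^ (1 / 2 : ℝ) * (N : ℝ) ^ (1 / 2 : ℝ) := by
          rw [← Real.rpow_add hN0']; norm_num
        rw [Real.rpow_neg hL0.le]
        have h2 : (0 : ℝ) < (N : ℝ) ^ (1 / 2 : ℝ) := by positivity
        have h3 : (0 : ℝ) < L ^ (1 / 2 : ℝ) := by positivity
        rw [div_eq_iff (by positivity)]
        field_simp
        rw [sq, ← h1]
      · have h1 : L ^ (-(1 / 2) + a - b) = L ^ (-(1 / 2) : ℝ) * L ^ (-(b - a)) := by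
          rw [← Real.rpow_add hL0]; ring_nf
        have h3 : (0 : ℝ) < L ^ (-(1 / 2) : ℝ) := by positivity
        rw [h1]
        field_simp
        rw [neg_sub]

end Density

noncomputable section Averages

open Finset Filter Topology
open scoped Classical

lemma sum_sosIoc_pow (e : ℕ → ℕ) (z : ℝ) (N : ℕ) :
    ∑ n ∈ sosIoc N, z ^ e n = ∑ n ∈ Ioc 0 N, sosWeight e z n := by
  unfold sosIoc sosWeight
  rw [sum_filter]
  refine sum_congr rfl fun n hn => ?_
  have : n ≠ 0 := (mem_Ioc.1 hn).1.ne'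
  simp [this]

namespace IsSOSEnum

lemma tendsto_log {ν : ℕ → ℕ} (hν : IsSOSEnum ν) :
    Tendsto (fun k => Real.log (ν k)) atTop atTop :=
  tendsto_log_natCast.comp hν.tendsto

lemma sum_filter_le {ν : ℕ → ℕ} (hν : IsSOSEnum ν) {f : ℕ → ℝ} (hf : ∀ n, 0 ≤ f n) (k : ℕ) :
    ∑ j ∈ (Icc 1 k).filter (fun j => ν k < ν j ^ 2), f (ν j) ≤ ∑ n ∈ sosIoc (ν k), f n := by
  rw [← hν.sum_Icc]
  exact sum_le_sum_of_subset_of_nonneg (filter_subset _ _) fun j _ _ => hf _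

/-- Almost all sums of two squares have at least `(log n) ^ (log 2 / 2 - o(1))` representations. -/
lemma zeroDens_r2_lt {ν : ℕ → ℕ} (hν : IsSOSEnum ν) {ε : ℝ} (hε : 0 < ε) (hε1 : ε < 1) :
    ZeroDens {j | (r2 (ν j) : ℝ) < Real.log (ν j) ^ ((1 - ε) ^ 2 / 2 * Real.log 2)} := by
  obtain ⟨K, hK0, hK⟩ := exists_sum_sosWeight_le
  have hz0 : 0 < 1 - ε := by linarith
  have h1 : ZeroDens {j | Real.log (ν j) ^ (-(ε / 2) * (1 - ε)) < (1 - ε) ^ omega1 (ν j)} := by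
    refine hν.zeroDens_of_sum_le (G := fun j => (1 - ε) ^ omega1 (ν j)) (a := -(ε / 2))
      (fun j => by positivity) (by nlinarith) ⟨K, ?_⟩
    filter_upwards [hν.tendsto.eventually_ge_atTop 2] with k hk
    refine (hν.sum_filter_le (f := fun n => (1 - ε) ^ omega1 n)
      (fun n => by positivity) k).trans ?_
    rw [sum_sosIoc_pow]
    refine (hK omega1 isOmegaLike_omega1 (1 - ε) hz0.le (by linarith) (ν k) hk).trans_eq ?_
    rw [mul_assoc]
    congr 3
    ring
  refine (h1.union (zeroDens_of_eventually (S := {j | ¬ 1 < Real.log (ν j)}) ?_)).mono ?_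
  · filter_upwards [hν.tendsto_log.eventually_gt_atTop 1] with j hj
    simpa using hj
  · intro j hj
    by_contra hc
    rw [Set.mem_union, not_or] at hc
    obtain ⟨hc1, hc2⟩ := hc
    simp only [Set.mem_ofPred_eq, not_lt] at hj hc1 hc2
    replace hc2 := not_le.1 hc2
    set L := Real.log (ν j) with hL
    have hL0 : 0 < L := by linarith
    have hl : 0 < Real.log L := Real.log_pos hc2
    have hn0 : 0 < ν j := Nat.pos_of_ne_zero fun h => by
      rw [h] at hL; simp at hL; linarith
    have h2 := Real.log_le_log (by positivity) hc1
    rw [Real.log_pow, Real.log_rpow hL0] at h2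
    have h3 : -Real.log (1 - ε) ≤ ε / (1 - ε) := by
      rw [← Real.log_inv]
      refine (Real.log_le_sub_one_of_pos (by positivity)).trans_eq ?_
      field_simp
      ring
    have h4 : (1 - ε) ^ 2 / 2 * Real.log L ≤ omega1 (ν j) := by
      have h5 : ε / 2 * (1 - ε) * Real.log L ≤ omega1 (ν j) * (ε / (1 - ε)) := by
        have : (omega1 (ν j) : ℝ) * -Real.log (1 - ε) ≤ omega1 (ν j) * (ε / (1 - ε)) := by gcongr
        linarith
      rw [mul_div_assoc', le_div_iff₀ hz0] at h5
      refine le_of_mul_le_mul_left (a := ε) ?_ hε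
      linarith
    refine absurd hj (not_lt.2 ?_)
    calc L ^ ((1 - ε) ^ 2 / 2 * Real.log 2)
        = (2 : ℝ) ^ ((1 - ε) ^ 2 / 2 * Real.log L) := by
          rw [Real.rpow_def_of_pos hL0, Real.rpow_def_of_pos (by norm_num)]
          ring_nf
      _ ≤ (2 : ℝ) ^ (omega1 (ν j) : ℝ) := Real.rpow_le_rpow_of_exponent_le (by norm_num) h4
      _ ≤ r2 (ν j) := by
          rw [Real.rpow_natCast]
          exact_mod_cast two_pow_omega1_le_r2 _ hn0 (hν.mem j)

end IsSOSEnum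

lemma sum_Ioc_one_div_le {H : ℕ} {L : ℝ} (hL : 1 ≤ L) (hH : (H : ℝ) ≤ L ^ 3) :
    ∑ h ∈ Ioc 0 H, 1 / (h : ℝ) ≤ 1 + 3 * Real.log L := by
  have h1 := harmonic_le_one_add_log H
  rw [harmonic_eq_sum_Icc] at h1
  push_cast at h1
  have h2 : ∑ h ∈ Ioc 0 H, 1 / (h : ℝ) = ∑ h ∈ Icc 1 H, (h : ℝ)⁻¹ :=
    sum_congr (by ext; simp only [mem_Ioc, mem_Icc]; lia) fun _ _ => one_div _
  rw [h2]
  refine h1.trans ?_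
  rcases Nat.eq_zero_or_pos H with rfl | h0
  · have := Real.log_nonneg hL
    simp only [Nat.cast_zero, Real.log_zero]
    linarith
  · have := Real.log_le_log (by exact_mod_cast h0) hH
    rw [Real.log_pow] at this
    push_cast at this
    linarith

/-- The sum of the inverse distances from `n` to the sums of two squares within `(log n) ^ 3`. -/
def gapSum (n : ℕ) : ℝ :=
  ∑ h ∈ Ioc 0 ⌊Real.log n ^ 3⌋₊, 1 / (h : ℝ) *
    ((if n + h ∈ SOS then 1 else 0) + (if h ≤ n ∧ n - h ∈ SOS then 1 else 0))

lemma gapSum_nonneg (n : ℕ) : 0 ≤ gapSum n :=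
  sum_nonneg fun h _ => mul_nonneg (by positivity)
    (add_nonneg (by split_ifs <;> norm_num) (by split_ifs <;> norm_num))

lemma log_pow_floor_mono {m n : ℕ} (hm : 0 < m) (h : m ≤ n) :
    ⌊Real.log m ^ 3⌋₊ ≤ ⌊Real.log n ^ 3⌋₊ := by
  have h1 : (1 : ℝ) ≤ m := by exact_mod_cast hm
  have h2 : Real.log m ≤ Real.log n := Real.log_le_log (by linarith) (by exact_mod_cast h)
  have h3 := Real.log_nonneg h1
  exact Nat.floor_mono (by gcongr)

lemma sum_gapSum_le {N : ℕ} {C : ℝ} (hC : ∀ h : ℕ, 0 < h → (h : ℝ) ≤ Real.log N ^ 3 →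
      (((range (N + 1)).filter fun n => n ∈ SOS ∧ n + h ∈ SOS).card : ℝ) ≤ C) :
    ∑ n ∈ sosIoc N, gapSum n ≤ (∑ h ∈ Ioc 0 ⌊Real.log N ^ 3⌋₊, 1 / (h : ℝ)) * (2 * C) := by
  have hL : 0 ≤ Real.log N ^ 3 := pow_nonneg (Real.log_natCast_nonneg N) 3
  calc _ ≤ ∑ n ∈ sosIoc N, ∑ h ∈ Ioc 0 ⌊Real.log N ^ 3⌋₊, 1 / (h : ℝ) *
        ((if n + h ∈ SOS then 1 else 0) + (if h ≤ n ∧ n - h ∈ SOS then 1 else 0)) := by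
        refine sum_le_sum fun n hn => ?_
        have hn := (mem_sosIoc.1 hn).1
        refine sum_le_sum_of_subset_of_nonneg
          (Ioc_subset_Ioc_right (log_pow_floor_mono hn.1 hn.2)) fun h _ _ =>
            mul_nonneg (by positivity)
              (add_nonneg (by split_ifs <;> norm_num) (by split_ifs <;> norm_num))
    _ = ∑ h ∈ Ioc 0 ⌊Real.log N ^ 3⌋₊, 1 / (h : ℝ) * ∑ n ∈ sosIoc N,
        ((if n + h ∈ SOS then 1 else 0) + (if h ≤ n ∧ n - h ∈ SOS then 1 else 0)) := by
        rw [sum_comm]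
        simp only [mul_sum]
    _ ≤ ∑ h ∈ Ioc 0 ⌊Real.log N ^ 3⌋₊, 1 / (h : ℝ) * (2 * C) := by
        refine sum_le_sum fun h hh => ?_
        rw [mem_Ioc] at hh
        have hCh := hC h hh.1 ((Nat.le_floor_iff hL).1 hh.2)
        gcongr
        rw [sum_add_distrib, two_mul, sum_boole, sum_boole]
        refine add_le_add (le_trans ?_ hCh) (le_trans ?_ hCh)
        · refine Nat.cast_le.2 (card_le_card fun n hn => ?_)
          rw [mem_filter, mem_sosIoc] at hn
          rw [mem_filter, mem_range]
          exact ⟨by lia, hn.1.2, hn.2⟩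
        · refine Nat.cast_le.2 (card_le_card_of_injOn (fun n => n - h) ?_ ?_)
          · intro n hn
            rw [mem_coe, mem_filter, mem_sosIoc] at hn
            rw [mem_coe, mem_filter, mem_range, Nat.sub_add_cancel hn.2.1]
            exact ⟨by lia, hn.2.2, hn.1.2⟩
          · intro n hn n' hn' hnn
            rw [mem_coe, mem_filter, mem_sosIoc] at hn hn'
            simp only at hnn
            lia
    _ = _ := by rw [sum_mul]

namespace IsSOSEnum

/-- Almost every sum of two squares `n` is isolated on the scale `(log n) ^ (1 / 2)`. -/
lemma zeroDens_gapSum {ν : ℕ → ℕ} (hν : IsSOSEnum ν) {ε : ℝ} (hε : 0 < ε) (hε1 : ε < 1) :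
    ZeroDens {j | Real.log (ν j) ^ (-(1 / 2) + ε) < gapSum (ν j)} := by
  set δ := ε / 3 with hδ
  refine hν.zeroDens_of_sum_le (G := fun j => gapSum (ν j)) (a := -(1 / 2) + 2 * δ)
    (fun j => gapSum_nonneg _) (by linarith) ⟨2, ?_⟩
  have hp := hν.tendsto.eventually
    (eventually_card_pairs_SOS_le (by positivity : 0 < δ) (by linarith) 3)
  filter_upwards [hp, hν.tendsto_log.eventually_ge_atTop 1,
    hν.tendsto_log.eventually (eventually_mul_log_le_rpow 6 (by positivity : 0 < δ)),
    hν.tendsto_log.eventually (eventually_le_rpow 2 (by positivity : 0 < δ))]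
    with k hk hL1 hL6 hL2
  refine (hν.sum_filter_le gapSum_nonneg k).trans ?_
  set N := ν k
  set L := Real.log N
  have hL0 : 0 < L := by linarith
  have h1 := sum_gapSum_le (N := N) (C := N * L ^ (-1 + δ)) fun h h0 hh => hk h h0 (by
    rw [Real.rpow_ofNat]; exact hh)
  refine h1.trans ?_
  have h2 := sum_Ioc_one_div_le hL1 (Nat.floor_le (by positivity : 0 ≤ L ^ 3))
  calc _ ≤ L ^ δ * (2 * (N * L ^ (-1 + δ))) := by
        gcongr
        linarith
    _ = 2 * (N * (L ^ δ * L ^ (-1 + δ))) := by ring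
    _ = _ := by
        rw [← Real.rpow_add hL0]
        congr 3
        ring

end IsSOSEnum

end Averages

noncomputable section NearSum

open Finset Filter Topology
open scoped Classical

/-- The representation numbers of the neighbours of `ν j`, damped by the index distance. -/
def nearSum (ν : ℕ → ℕ) (s : ℝ) (j : ℕ) : ℝ :=
  (r2 (ν j) : ℝ) ^ s + ∑ d ∈ Ioc 0 ⌊Real.log (ν j) ^ 3⌋₊, 1 / (d : ℝ) *
    ((if ν (j + d) ≤ 2 * ν j then (r2 (ν (j + d)) : ℝ) ^ s else 0) +
      (if d < j then (r2 (ν (j - d)) : ℝ) ^ s else 0))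

lemma nearSum_term_nonneg (ν : ℕ → ℕ) (s : ℝ) (j d : ℕ) :
    0 ≤ 1 / (d : ℝ) * ((if ν (j + d) ≤ 2 * ν j then (r2 (ν (j + d)) : ℝ) ^ s else 0) +
      (if d < j then (r2 (ν (j - d)) : ℝ) ^ s else 0)) :=
  mul_nonneg (by positivity) (add_nonneg (by split_ifs <;> positivity) (by split_ifs <;> positivity))

lemma nearSum_nonneg (ν : ℕ → ℕ) (s : ℝ) (j : ℕ) : 0 ≤ nearSum ν s j :=
  add_nonneg (by positivity) (sum_nonneg fun _ _ => nearSum_term_nonneg _ _ _ _)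

lemma sum_r2_rpow_le {s : ℝ} (hs : 0 ≤ s) (N : ℕ) :
    ∑ n ∈ sosIoc N, (r2 n : ℝ) ^ s ≤
      4 ^ s * ∑ n ∈ Ioc 0 N, sosWeight bigOmega1 (2 ^ s) n := by
  rw [← sum_sosIoc_pow, mul_sum]
  refine sum_le_sum fun n hn => ?_
  have h : (r2 n : ℝ) ≤ 4 * 2 ^ bigOmega1 n := by
    exact_mod_cast r2_le_two_pow n (mem_sosIoc.1 hn).1.1
  refine (Real.rpow_le_rpow (by positivity) h hs).trans_eq ?_
  rw [Real.mul_rpow (by norm_num) (by positivity), ← Real.rpow_natCast, ← Real.rpow_natCast,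
    ← Real.rpow_mul (by norm_num), ← Real.rpow_mul (by norm_num), mul_comm s]

namespace IsSOSEnum

lemma sum_nearSum_le {ν : ℕ → ℕ} (hν : IsSOSEnum ν) (s : ℝ) (k : ℕ) :
    ∑ j ∈ Icc 1 k, nearSum ν s j ≤
      (1 + 2 * ∑ d ∈ Ioc 0 ⌊Real.log (ν k) ^ 3⌋₊, 1 / (d : ℝ)) *
        ∑ n ∈ sosIoc (2 * ν k), (r2 n : ℝ) ^ s := by
  obtain ⟨k', hk'⟩ := hν.exists_eq (two_mul_mem_SOS (hν.mem k))
  have hkk : k ≤ k' := hν.mono.le_iff_le.1 (by lia)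
  set T := ∑ n ∈ sosIoc (2 * ν k), (r2 n : ℝ) ^ s with hT
  have hTk : T = ∑ i ∈ Icc 1 k', (r2 (ν i) : ℝ) ^ s := by
    rw [hT, ← hk', hν.sum_Icc k' fun n => (r2 n : ℝ) ^ s]
  have hself : ∑ j ∈ Icc 1 k, (r2 (ν j) : ℝ) ^ s ≤ T := by
    rw [hTk]
    exact sum_le_sum_of_subset_of_nonneg (Icc_subset_Icc_right hkk) fun _ _ _ => by positivity
  have hup (d : ℕ) : ∑ j ∈ Icc 1 k,
      (if ν (j + d) ≤ 2 * ν j then (r2 (ν (j + d)) : ℝ) ^ s else 0) ≤ T := by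
    rw [← sum_filter, hTk]
    refine sum_le_sum_of_injOn_of_le (fun j => j + d) (fun j hj => ?_)
      (fun a _ b _ h => Nat.add_right_cancel h) (fun j _ => le_rfl) fun _ _ => by positivity
    rw [mem_filter, mem_Icc] at hj
    rw [mem_Icc]
    have := hν.mono.monotone hj.1.2
    exact ⟨by lia, hν.mono.le_iff_le.1 (by lia)⟩
  have hdown (d : ℕ) : ∑ j ∈ Icc 1 k,
      (if d < j then (r2 (ν (j - d)) : ℝ) ^ s else 0) ≤ T := by
    rw [← sum_filter, hTk]
    refine sum_le_sum_of_injOn_of_le (fun j => j - d) (fun j hj => ?_) (fun a ha b hb h => ?_)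
      (fun j _ => le_rfl) fun _ _ => by positivity
    · rw [mem_filter, mem_Icc] at hj
      rw [mem_Icc]
      lia
    · rw [mem_coe, mem_filter, mem_Icc] at ha hb
      simp only at h
      lia
  calc _ ≤ ∑ j ∈ Icc 1 k, ((r2 (ν j) : ℝ) ^ s + ∑ d ∈ Ioc 0 ⌊Real.log (ν k) ^ 3⌋₊, 1 / (d : ℝ) *
        ((if ν (j + d) ≤ 2 * ν j then (r2 (ν (j + d)) : ℝ) ^ s else 0) +
          (if d < j then (r2 (ν (j - d)) : ℝ) ^ s else 0))) := by
        refine sum_le_sum fun j hj => add_le_add le_rfl ?_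
        rw [mem_Icc] at hj
        exact sum_le_sum_of_subset_of_nonneg (Ioc_subset_Ioc_right
          (log_pow_floor_mono (hν.pos hj.1) (hν.mono.monotone hj.2)))
          fun d _ _ => nearSum_term_nonneg _ _ _ _
    _ ≤ T + ∑ d ∈ Ioc 0 ⌊Real.log (ν k) ^ 3⌋₊, 1 / (d : ℝ) * (T + T) := by
        rw [sum_add_distrib, sum_comm]
        refine add_le_add hself (sum_le_sum fun d _ => ?_)
        rw [← mul_sum, sum_add_distrib]
        exact mul_le_mul_of_nonneg_left (add_le_add (hup d) (hdown d)) (by positivity)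
    _ = _ := by
        rw [← sum_mul]
        ring

/-- For almost every `j`, the representation numbers near `ν j` are controlled by a moment. -/
lemma zeroDens_nearSum {ν : ℕ → ℕ} (hν : IsSOSEnum ν) {s ε : ℝ} (hs : 0 ≤ s)
    (hz : (2 : ℝ) ^ s ≤ 63 / 50) (hε : 0 < ε) :
    ZeroDens {j | Real.log (ν j) ^ (((2 : ℝ) ^ s - 1) / 2 + ε) < nearSum ν s j} := by
  obtain ⟨K, hK0, hK⟩ := exists_sum_sosWeight_le
  refine hν.zeroDens_of_sum_le (G := nearSum ν s) (a := ((2 : ℝ) ^ s - 1) / 2 + ε / 2)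
    (nearSum_nonneg ν s) (by linarith) ⟨2 * (2 * (4 ^ s * K)), ?_⟩
  filter_upwards [eventually_ge_atTop 1, hν.tendsto.eventually_ge_atTop 2,
    hν.tendsto_log.eventually_ge_atTop 1,
    hν.tendsto_log.eventually (eventually_mul_log_le_rpow 6 (by positivity : 0 < ε / 2)),
    hν.tendsto_log.eventually (eventually_le_rpow 3 (by positivity : 0 < ε / 2))]
    with k hk hk2 hL1 hL6 hL3
  refine (sum_le_sum_of_subset_of_nonneg (filter_subset _ _)
    fun j _ _ => nearSum_nonneg ν s j).trans ((hν.sum_nearSum_le s k).trans ?_)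
  have h3 := (sum_r2_rpow_le hs (2 * ν k)).trans (mul_le_mul_of_nonneg_left
    (hK bigOmega1 isOmegaLike_bigOmega1 (2 ^ s) (by positivity) hz (2 * ν k) (by lia))
    (by positivity))
  set N := ν k
  set L := Real.log N
  have hN0 : (0 : ℝ) < N := by exact_mod_cast (by lia : 0 < N)
  have hL0 : 0 < L := by linarith
  have h2 := sum_Ioc_one_div_le hL1 (Nat.floor_le (by positivity : 0 ≤ L ^ 3))
  have h4 : Real.log ((2 * N : ℕ) : ℝ) ^ ((2 : ℝ) ^ s / 2 - 1) ≤ L ^ ((2 : ℝ) ^ s / 2 - 1) := by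
    refine Real.rpow_le_rpow_of_nonpos hL0 (Real.log_le_log hN0 ?_) (by linarith)
    push_cast
    linarith
  calc _ ≤ (2 * L ^ (ε / 2)) *
        (4 ^ s * (K * (2 * N : ℕ) * L ^ ((2 : ℝ) ^ s / 2 - 1))) := by
        refine mul_le_mul (by linarith) (h3.trans ?_) (sum_nonneg fun _ _ => by positivity)
          (by positivity)
        gcongr
    _ = 2 * (2 * (4 ^ s * K)) * (N * (L ^ (ε / 2) * L ^ ((2 : ℝ) ^ s / 2 - 1))) := by
        push_cast
        ring
    _ = _ := by
        rw [← Real.rpow_add hL0]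
        congr 3
        ring

end IsSOSEnum

end NearSum

noncomputable section FarSum

open Finset Filter Topology
open scoped Classical

lemma r2_le_nine_mul_sq {m : ℕ} (hm : 1 ≤ m) : (r2 m : ℝ) ≤ 9 * (m : ℝ) ^ (2 : ℝ) := by
  have h : (r2 m : ℝ) ≤ (2 * m + 1) ^ 2 := by exact_mod_cast r2_le m
  have h1 : (1 : ℝ) ≤ m := by exact_mod_cast hm
  rw [Real.rpow_two]
  nlinarith

lemma r2_mul_abs_rpow_le {p x : ℝ} (hp : 0 ≤ p) {m : ℕ} (hm : 1 ≤ m) (hx : 2 * |x| ≤ m) :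
    (r2 m : ℝ) * |(m : ℝ) - x| ^ (-p) ≤ 9 * 2 ^ p * (m : ℝ) ^ (2 - p) := by
  have h0 : (0 : ℝ) < m := by exact_mod_cast hm
  have h1 : (m : ℝ) / 2 ≤ |(m : ℝ) - x| := by
    have := le_abs_self x
    have := le_abs_self ((m : ℝ) - x)
    linarith
  calc _ ≤ 9 * (m : ℝ) ^ (2 : ℝ) * ((m : ℝ) / 2) ^ (-p) :=
        mul_le_mul (r2_le_nine_mul_sq hm)
          (Real.rpow_le_rpow_of_nonpos (by positivity) h1 (by linarith)) (by positivity)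
          (by positivity)
    _ = _ := by
        rw [Real.div_rpow h0.le (by norm_num), sub_eq_add_neg, Real.rpow_add h0,
          Real.rpow_neg (by norm_num : (0 : ℝ) ≤ 2)]
        field_simp

lemma summable_r2_mul_abs_rpow {p : ℝ} (hp : 3 < p) (x : ℝ) :
    Summable fun m : ℕ => (r2 m : ℝ) * |(m : ℝ) - x| ^ (-p) := by
  have h : Summable fun m : ℕ => 9 * 2 ^ p * (m : ℝ) ^ (2 - p) :=
    (Real.summable_nat_rpow.2 (by linarith)).mul_left _
  refine h.of_norm_bounded_eventually_nat ?_
  filter_upwards [eventually_ge_atTop 1, tendsto_natCast_atTop_atTop.eventually_ge_atTop (2 * |x|)]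
    with m hm hmx
  rw [Real.norm_of_nonneg (by positivity)]
  exact r2_mul_abs_rpow_le (by linarith) hm hmx

/-- The contribution to the spectral sum at `n` of the terms at distance more than
`(log n) ^ 3`. -/
def farTerm (p : ℝ) (n m : ℕ) : ℝ :=
  if Real.log n ^ 3 < |(m : ℝ) - n| then (r2 m : ℝ) * |(m : ℝ) - n| ^ (-p) else 0

lemma farTerm_nonneg (p : ℝ) (n m : ℕ) : 0 ≤ farTerm p n m := by
  unfold farTerm
  split_ifs <;> positivity

lemma farTerm_le (p : ℝ) (n m : ℕ) : farTerm p n m ≤ (r2 m : ℝ) * |(m : ℝ) - n| ^ (-p) := by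
  unfold farTerm
  split_ifs
  · rfl
  · positivity

lemma summable_farTerm {p : ℝ} (hp : 3 < p) (n : ℕ) : Summable (farTerm p n) :=
  (summable_r2_mul_abs_rpow hp n).of_nonneg_of_le (farTerm_nonneg p n) (farTerm_le p n)

/-- The sum of the far terms. -/
def farSum (p : ℝ) (n : ℕ) : ℝ := ∑' m, farTerm p n m

lemma farSum_nonneg (p : ℝ) (n : ℕ) : 0 ≤ farSum p n := tsum_nonneg (farTerm_nonneg p n)

lemma sum_one_div_sq_sub_le (N m : ℕ) :
    ∑ n ∈ (Ioc 0 N).filter (· ≠ m), 1 / ((m : ℝ) - n) ^ 2 ≤ 4 := by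
  have key (M : ℕ) : ∑ d ∈ Ioo 0 M, 1 / (d : ℝ) ^ 2 ≤ 2 := by
    have := sum_Ioo_inv_sq_le (α := ℝ) 0 M
    simpa using this
  rw [← sum_filter_add_sum_filter_not _ (fun n => n < m)]
  refine (add_le_add ((sum_le_sum_of_injOn_of_le (t := Ioo 0 (N + m + 1))
    (h := fun d => 1 / (d : ℝ) ^ 2) (fun n => m - n) ?_ ?_ ?_ fun _ _ => by positivity).trans
      (key _)) ((sum_le_sum_of_injOn_of_le (t := Ioo 0 (N + m + 1))
    (h := fun d => 1 / (d : ℝ) ^ 2) (fun n => n - m) ?_ ?_ ?_ fun _ _ => by positivity).trans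
      (key _))).trans_eq (by norm_num)
  · intro n hn
    simp only [mem_filter, mem_Ioc, mem_Ioo] at hn ⊢
    lia
  · intro a ha b hb h
    simp only [coe_filter, mem_filter, mem_Ioc, Set.mem_ofPred_eq] at ha hb h
    lia
  · intro n hn
    simp only [mem_filter, mem_Ioc] at hn
    rw [Nat.cast_sub hn.2.le]
  · intro n hn
    simp only [mem_filter, mem_Ioc, mem_Ioo] at hn ⊢
    lia
  · intro a ha b hb h
    simp only [coe_filter, mem_filter, mem_Ioc, Set.mem_ofPred_eq] at ha hb h
    lia
  · intro n hn
    simp only [mem_filter, mem_Ioc, not_lt] at hn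
    rw [Nat.cast_sub hn.2, ← neg_sub (n : ℝ), neg_sq]

lemma sum_sum_r2_div_sq_le {N : ℕ} (hN : 1 ≤ N) :
    ∑ n ∈ Ioc 0 N, ∑ m ∈ (range (2 * N + 1)).filter (n ≠ ·), (r2 m : ℝ) * (1 / ((m : ℝ) - n) ^ 2)
      ≤ 72 * (N : ℝ) := by
  have h := sum_r2_le (2 * N) (by lia)
  have h' : ∑ m ∈ range (2 * N + 1), (r2 m : ℝ) ≤ 9 * (2 * N) := by exact_mod_cast h
  calc _ = ∑ m ∈ range (2 * N + 1), (r2 m : ℝ) *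
        ∑ n ∈ (Ioc 0 N).filter (· ≠ m), 1 / ((m : ℝ) - n) ^ 2 := by
        simp only [sum_filter, mul_sum]
        rw [sum_comm]
        refine sum_congr rfl fun m _ => sum_congr rfl fun n _ => ?_
        split_ifs <;> simp
    _ ≤ ∑ m ∈ range (2 * N + 1), (r2 m : ℝ) * 4 := by
        gcongr
        exact sum_one_div_sq_sub_le _ _
    _ ≤ _ := by
        rw [← sum_mul]
        linarith

lemma farTerm_le_of_le {p h : ℝ} (hp : 2 ≤ p) {n N m : ℕ} (hh : 0 < h)
    (hn : h ≤ Real.log n ^ 3) (hm : m ≤ 2 * N) :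
    farTerm p n m ≤ h ^ (-(p - 2)) * (if m ∈ (range (2 * N + 1)).filter (n ≠ ·) then
      (r2 m : ℝ) * (1 / ((m : ℝ) - n) ^ 2) else 0) := by
  unfold farTerm
  split_ifs with h1 h2 h2
  · have h3 : h ≤ |(m : ℝ) - n| := hn.trans h1.le
    have h4 : 0 < |(m : ℝ) - n| := hh.trans_le h3
    have h5 : |(m : ℝ) - n| ^ (-p) = |(m : ℝ) - n| ^ (-(p - 2)) * (1 / ((m : ℝ) - n) ^ 2) := by
      rw [← sq_abs, ← Real.rpow_two, one_div, ← Real.rpow_neg h4.le, ← Real.rpow_add h4]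
      ring_nf
    rw [h5, mul_left_comm]
    exact mul_le_mul_of_nonneg_right (Real.rpow_le_rpow_of_nonpos hh h3 (by linarith))
      (by positivity)
  · exfalso
    rw [mem_filter, mem_range] at h2
    have : n = m := by
      by_contra hc
      exact h2 ⟨by lia, hc⟩
    subst this
    simp at h1
    linarith
  · positivity
  · positivity

lemma farTerm_le_of_gt {p : ℝ} (hp : 3 < p) {n N m : ℕ} (hN : 1 ≤ N) (hn : n ≤ N)
    (hm : 2 * N < m) :
    farTerm p n m ≤ 9 * 2 ^ p * (N : ℝ) ^ (-((p - 3) / 2)) * (m : ℝ) ^ (-1 - (p - 3) / 2) := by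
  have hN0 : (0 : ℝ) < N := by exact_mod_cast hN
  have hNm : (N : ℝ) ≤ m := by exact_mod_cast (by lia : N ≤ m)
  have hm0 : (0 : ℝ) < m := by linarith
  refine (farTerm_le p n m).trans ((r2_mul_abs_rpow_le (by linarith) (by lia) ?_).trans ?_)
  · rw [Nat.abs_cast]
    exact_mod_cast (by lia : 2 * n ≤ m)
  · have : (m : ℝ) ^ (2 - p) = (m : ℝ) ^ (-((p - 3) / 2)) * (m : ℝ) ^ (-1 - (p - 3) / 2) := by
      rw [← Real.rpow_add hm0]
      ring_nf
    rw [this, ← mul_assoc]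
    gcongr 9 * 2 ^ p * ?_ * _
    exact Real.rpow_le_rpow_of_nonpos hN0 hNm (by linarith)

lemma farSum_le {p h : ℝ} (hp : 3 < p) {n N : ℕ} (hN : 1 ≤ N) (hh : 0 < h)
    (hn : h ≤ Real.log n ^ 3) (hnN : n ≤ N) :
    farSum p n ≤ h ^ (-(p - 2)) * ∑ m ∈ (range (2 * N + 1)).filter (n ≠ ·),
        (r2 m : ℝ) * (1 / ((m : ℝ) - n) ^ 2) +
      9 * 2 ^ p * (∑' m : ℕ, (m : ℝ) ^ (-1 - (p - 3) / 2)) * (N : ℝ) ^ (-((p - 3) / 2)) := by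
  set T := (range (2 * N + 1)).filter (n ≠ ·) with hT
  set g : ℕ → ℝ := fun m => if m ∈ T then (r2 m : ℝ) * (1 / ((m : ℝ) - n) ^ 2) else 0 with hg
  have hg0 : ∀ m, 0 ≤ g m := fun m => by
    simp only [hg]
    split_ifs <;> positivity
  have hgs : HasSum g (∑ m ∈ T, (r2 m : ℝ) * (1 / ((m : ℝ) - n) ^ 2)) := by
    have : HasSum g (∑ m ∈ T, g m) := hasSum_sum_of_ne_finset_zero fun m hm => by simp [hg, hm]
    convert this using 1
    exact sum_congr rfl fun m hm => by simp [hg, hm]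
  have hS : Summable fun m : ℕ => (m : ℝ) ^ (-1 - (p - 3) / 2) :=
    Real.summable_nat_rpow.2 (by linarith)
  have hsum := (hgs.mul_left (h ^ (-(p - 2)))).add
    (hS.hasSum.mul_left (9 * 2 ^ p * (N : ℝ) ^ (-((p - 3) / 2))))
  refine (hasSum_le (fun m => ?_) (summable_farTerm hp n).hasSum hsum).trans_eq (by ring)
  rcases le_or_gt m (2 * N) with hm | hm
  · refine (farTerm_le_of_le (by linarith) hh hn hm).trans (le_add_of_nonneg_right ?_)
    positivity
  · exact (farTerm_le_of_gt hp hN hnN hm).trans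
      (le_add_of_nonneg_left (mul_nonneg (by positivity) (hg0 m)))

namespace IsSOSEnum

/-- For almost every `j`, the far terms contribute little. -/
lemma zeroDens_farSum {ν : ℕ → ℕ} (hν : IsSOSEnum ν) {p b : ℝ} (hp : 3 < p)
    (hb : 13 / 2 - 3 * p < b) :
    ZeroDens {j | Real.log (ν j) ^ b < farSum p (ν j)} := by
  set S := ∑' m : ℕ, (m : ℝ) ^ (-1 - (p - 3) / 2) with hS
  have hS0 : 0 ≤ S := tsum_nonneg fun m => by positivity
  refine hν.zeroDens_of_sum_le (G := fun j => farSum p (ν j)) (a := 13 / 2 - 3 * p)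
    (fun j => farSum_nonneg _ _) hb ⟨72 * 8 ^ (p - 2) + 9 * 2 ^ p * S, ?_⟩
  have hη : 0 < (p - 3) / 2 := by linarith
  have hlit := (isLittleO_log_rpow_rpow_atTop (3 * (p - 2)) hη).bound (c := 1) one_pos
  have hlit' := (tendsto_natCast_atTop_atTop.comp hν.tendsto).eventually hlit
  filter_upwards [hlit', eventually_ge_atTop 1, hν.tendsto_log.eventually_ge_atTop 1]
    with k hk hk1 hL1
  simp only [Function.comp] at hk
  have hN1 : 1 ≤ ν k := hν.pos hk1
  set N := ν k with hN
  set L := Real.log N with hL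
  have hL0 : 0 < L := by linarith
  have hN0 : (0 : ℝ) < N := by exact_mod_cast hN1
  have hh : 0 < (L / 2) ^ 3 := by positivity
  have hNη : (N : ℝ) ^ (-((p - 3) / 2)) ≤ L ^ (-(3 * (p - 2))) := by
    rw [one_mul, Real.norm_of_nonneg (by positivity), Real.norm_of_nonneg (by positivity)] at hk
    rw [Real.rpow_neg hN0.le, Real.rpow_neg hL0.le]
    exact inv_anti₀ (by positivity) hk
  have hLh : ((L / 2) ^ 3) ^ (-(p - 2)) = 8 ^ (p - 2) * L ^ (-(3 * (p - 2))) := by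
    have h8 : (L / 2) ^ 3 = L ^ (3 : ℝ) / 8 := by
      rw [show (3 : ℝ) = ((3 : ℕ) : ℝ) by norm_num, Real.rpow_natCast]
      ring
    rw [h8, Real.div_rpow (by positivity) (by norm_num), ← Real.rpow_mul hL0.le,
      Real.rpow_neg (by norm_num : (0 : ℝ) ≤ 8), div_inv_eq_mul, mul_comm]
    ring_nf
  set c := 9 * 2 ^ p * S * (N : ℝ) ^ (-((p - 3) / 2)) with hc
  have hc0 : 0 ≤ c := by positivity
  set B : ℕ → ℝ := fun n => ((L / 2) ^ 3) ^ (-(p - 2)) *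
    ∑ m ∈ (Finset.range (2 * N + 1)).filter (n ≠ ·), (r2 m : ℝ) * (1 / ((m : ℝ) - n) ^ 2) + c with hB
  have hB0 : ∀ n, 0 ≤ B n := fun n =>
    add_nonneg (mul_nonneg (by positivity) (sum_nonneg fun m _ => by positivity)) hc0
  calc _ ≤ ∑ j ∈ (Icc 1 k).filter (fun j => N < ν j ^ 2), B (ν j) := by
        refine sum_le_sum fun j hj => ?_
        rw [mem_filter, mem_Icc] at hj
        exact farSum_le hp hN1 hh (pow_le_pow_left₀ (by positivity) (half_log_le hN1 hj.2) 3)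
          (hν.mono.monotone hj.1.2)
    _ ≤ ∑ n ∈ sosIoc N, B n := hν.sum_filter_le hB0 k
    _ ≤ ∑ n ∈ Ioc 0 N, B n :=
        sum_le_sum_of_subset_of_nonneg (filter_subset _ _) fun n _ _ => hB0 n
    _ ≤ ((L / 2) ^ 3) ^ (-(p - 2)) * (72 * N) + N * c := by
        rw [hB, sum_add_distrib, ← mul_sum, sum_const, Nat.card_Ioc, nsmul_eq_mul, Nat.sub_zero]
        gcongr
        exact sum_sum_r2_div_sq_le hN1
    _ ≤ 8 ^ (p - 2) * L ^ (-(3 * (p - 2))) * (72 * N) +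
        N * (9 * 2 ^ p * S * L ^ (-(3 * (p - 2)))) := by
        rw [hLh, hc]
        gcongr
    _ = _ := by
        rw [show -(1 / 2) + (13 / 2 - 3 * p) = -(3 * (p - 2)) by ring]
        ring

end IsSOSEnum

end FarSum

noncomputable section Deterministic

open Finset Filter Topology
open scoped Classical

lemma sum_rpow_le_rpow_sum {ι : Type*} (U : Finset ι) {g : ι → ℝ} (hg : ∀ i, 0 ≤ g i) {p : ℝ}
    (hp : 1 ≤ p) : ∑ i ∈ U, g i ^ p ≤ (∑ i ∈ U, g i) ^ p := by
  induction U using Finset.induction_on with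
  | empty => simp [Real.zero_rpow (by linarith : p ≠ 0)]
  | insert a U ha ih =>
    rw [sum_insert ha, sum_insert ha]
    exact (add_le_add le_rfl ih).trans
      (Real.add_rpow_le_rpow_add (hg a) (sum_nonneg fun i _ => hg i) hp)

lemma sum_near_le {φ : ℕ → ℕ} {U : Finset ℕ} {H : ℕ} {D w v x p : ℝ} (hp : 1 ≤ p) (hD : 0 < D)
    (hw : 0 ≤ w) (hU : ∀ m ∈ U, m ∈ SOS → ∃ d ≤ H, φ d = m)
    (h0 : D ≤ |(φ 0 : ℝ) - x|)
    (hd : ∀ d ∈ Ioc 0 H, φ d ∈ U → (d : ℝ) ≤ w * |(φ d : ℝ) - x|)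
    (hv : (r2 (φ 0) : ℝ) ^ (1 / p) + ∑ d ∈ Ioc 0 H, 1 / (d : ℝ) *
      (if φ d ∈ U then (r2 (φ d) : ℝ) ^ (1 / p) else 0) ≤ v) :
    D ^ p * ∑ m ∈ U, (r2 m : ℝ) * |(m : ℝ) - x| ^ (-p) ≤ ((1 + D * w) * v) ^ p := by
  set g : ℕ → ℝ := fun m => (r2 m : ℝ) ^ (1 / p) * (D / |(m : ℝ) - x|) with hg
  have hg0 : ∀ m, 0 ≤ g m := fun m => by positivity
  have h1 : D ^ p * ∑ m ∈ U, (r2 m : ℝ) * |(m : ℝ) - x| ^ (-p) = ∑ m ∈ U, g m ^ p := by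
    rw [mul_sum]
    refine sum_congr rfl fun m _ => ?_
    simp only [hg]
    rw [Real.mul_rpow (by positivity) (by positivity), ← Real.rpow_mul (by positivity),
      one_div_mul_cancel (by linarith), Real.rpow_one, Real.div_rpow hD.le (by positivity),
      Real.rpow_neg (by positivity)]
    ring
  have h2 : ∑ m ∈ U, g m ≤ ∑ d ∈ range (H + 1), if φ d ∈ U then g (φ d) else 0 := by
    rw [← sum_filter_add_sum_filter_not U (· ∈ SOS), sum_eq_zero (s := U.filter (· ∉ SOS)),
      add_zero]
    · have hex : ∀ m, ∃ d, m ∈ U → m ∈ SOS → d ≤ H ∧ φ d = m := fun m => by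
        by_cases hm : m ∈ U ∧ m ∈ SOS
        · obtain ⟨d, hd⟩ := hU m hm.1 hm.2
          exact ⟨d, fun _ _ => hd⟩
        · exact ⟨0, fun a b => absurd ⟨a, b⟩ hm⟩
      choose ψ hψ using hex
      refine sum_le_sum_of_injOn_of_le ψ (fun m hm => ?_) (fun a ha b hb h => ?_) (fun m hm => ?_)
        fun d _ => by split_ifs <;> simp [hg0]
      · rw [mem_filter] at hm
        rw [mem_range]
        have := (hψ m hm.1 hm.2).1
        lia
      · rw [mem_coe, mem_filter] at ha hb
        rw [← (hψ a ha.1 ha.2).2, h, (hψ b hb.1 hb.2).2]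
      · rw [mem_filter] at hm
        rw [(hψ m hm.1 hm.2).2, if_pos hm.1]
    · intro m hm
      rw [mem_filter] at hm
      simp only [hg]
      rw [r2_eq_zero hm.2, Nat.cast_zero,
        Real.zero_rpow (one_div_ne_zero (by linarith : p ≠ 0)), zero_mul]
  have h3 : ∑ d ∈ range (H + 1), (if φ d ∈ U then g (φ d) else 0) ≤
      (r2 (φ 0) : ℝ) ^ (1 / p) + ∑ d ∈ Ioc 0 H, D * w * (1 / (d : ℝ) *
      (if φ d ∈ U then (r2 (φ d) : ℝ) ^ (1 / p) else 0)) := by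
    have hr : range (H + 1) = insert 0 (Ioc 0 H) := by
      ext d
      simp only [mem_range, mem_insert, mem_Ioc]
      lia
    rw [hr, sum_insert (by simp)]
    refine add_le_add ?_ (sum_le_sum fun d hdH => ?_)
    · split_ifs
      · refine mul_le_of_le_one_right (by positivity) ?_
        exact div_le_one_of_le₀ h0 (by positivity)
      · positivity
    · split_ifs with hdU
      · have h4 := hd d hdH hdU
        have h5 : (0 : ℝ) < d := by exact_mod_cast (mem_Ioc.1 hdH).1
        have h6 : 0 < |(φ d : ℝ) - x| := by
          by_contra hc
          have : |(φ d : ℝ) - x| = 0 := le_antisymm (not_lt.1 hc) (abs_nonneg _)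
          rw [this, mul_zero] at h4
          linarith
        simp only [hg]
        rw [mul_comm, ← mul_assoc]
        gcongr
        rw [div_le_iff₀ h6]
        calc D = D * (1 / d) * d := by field_simp
          _ ≤ D * (1 / d) * (w * |(φ d : ℝ) - x|) := by gcongr
          _ = _ := by ring
      · simp
  rw [h1]
  refine (sum_rpow_le_rpow_sum U hg0 hp).trans (Real.rpow_le_rpow
    (sum_nonneg fun m _ => hg0 m) (h2.trans (h3.trans ?_)) (by linarith))
  rw [← mul_sum]
  set X := (r2 (φ 0) : ℝ) ^ (1 / p)
  have hX : 0 ≤ X := by positivity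
  set Y := ∑ d ∈ Ioc 0 H, 1 / (d : ℝ) * (if φ d ∈ U then (r2 (φ d) : ℝ) ^ (1 / p) else 0)
  have hY : 0 ≤ Y := sum_nonneg fun d _ => mul_nonneg (by positivity) (by split_ifs <;> positivity)
  have hDw : 0 ≤ D * w := by positivity
  calc X + D * w * Y ≤ (1 + D * w) * (X + Y) := by nlinarith [mul_nonneg hDw hX]
    _ ≤ _ := by gcongr

namespace IsSOSEnum

lemma le_gapSum_mul_add {ν : ℕ → ℕ} (hν : IsSOSEnum ν) {i d : ℕ} (hd : 0 < d)
    (hH : ν (i + d) ≤ ν i + ⌊Real.log (ν i) ^ 3⌋₊) :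
    (d : ℝ) ≤ gapSum (ν i) * (ν (i + d) - ν i) := by
  have hlt : ν i < ν (i + d) := hν.mono (by lia)
  have hlt' : (0 : ℝ) < ν (i + d) - ν i := by
    rw [sub_pos]; exact_mod_cast hlt
  rw [← div_le_iff₀ hlt']
  calc (d : ℝ) / (ν (i + d) - ν i) = ∑ e ∈ Ioc 0 d, 1 / ((ν (i + d) : ℝ) - ν i) := by
        rw [sum_const, Nat.card_Ioc, nsmul_eq_mul, Nat.sub_zero]
        ring
    _ ≤ gapSum (ν i) := by
        refine sum_le_sum_of_injOn_of_le (fun e => ν (i + e) - ν i) (fun e he => ?_)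
          (fun a ha b hb h => ?_) (fun e he => ?_) fun h _ => mul_nonneg (by positivity)
            (add_nonneg (by split_ifs <;> norm_num) (by split_ifs <;> norm_num))
        · rw [mem_Ioc] at he ⊢
          have h1 : ν i < ν (i + e) := hν.mono (by lia)
          have h2 : ν (i + e) ≤ ν (i + d) := hν.mono.monotone (by lia)
          lia
        · simp only at h
          have h1 : ν i ≤ ν (i + a) := hν.mono.monotone (by lia)
          have h2 : ν i ≤ ν (i + b) := hν.mono.monotone (by lia)
          have h3 : ν (i + a) = ν (i + b) := by lia
          have := hν.mono.injective h3
          lia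
        · rw [mem_Ioc] at he
          have h1 : ν i < ν (i + e) := hν.mono (by lia)
          have h2 : ν (i + e) ≤ ν (i + d) := hν.mono.monotone (by lia)
          have h3 : (1 : ℝ) ≤ (if ν i + (ν (i + e) - ν i) ∈ SOS then 1 else 0) +
              (if ν (i + e) - ν i ≤ ν i ∧ ν i - (ν (i + e) - ν i) ∈ SOS then 1 else 0) := by
            rw [Nat.add_sub_cancel' h1.le, if_pos (hν.mem _)]
            exact le_add_of_nonneg_right (by split_ifs <;> norm_num)
          have h4 : (0 : ℝ) < ν (i + e) - ν i := by
            rw [sub_pos]; exact_mod_cast h1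
          have h5 : (ν (i + e) : ℝ) ≤ ν (i + d) := by exact_mod_cast h2
          refine le_trans ?_ (le_mul_of_one_le_right (by positivity) h3)
          rw [Nat.cast_sub h1.le]
          gcongr

lemma le_gapSum_mul_sub {ν : ℕ → ℕ} (hν : IsSOSEnum ν) {i d : ℕ} (hd : 0 < d) (hdi : d ≤ i)
    (hH : ν i ≤ ν (i - d) + ⌊Real.log (ν i) ^ 3⌋₊) :
    (d : ℝ) ≤ gapSum (ν i) * (ν i - ν (i - d)) := by
  have hlt : ν (i - d) < ν i := hν.mono (by lia)
  have hlt' : (0 : ℝ) < ν i - ν (i - d) := by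
    rw [sub_pos]; exact_mod_cast hlt
  rw [← div_le_iff₀ hlt']
  calc (d : ℝ) / (ν i - ν (i - d)) = ∑ e ∈ Ioc 0 d, 1 / ((ν i : ℝ) - ν (i - d)) := by
        rw [sum_const, Nat.card_Ioc, nsmul_eq_mul, Nat.sub_zero]
        ring
    _ ≤ gapSum (ν i) := by
        refine sum_le_sum_of_injOn_of_le (fun e => ν i - ν (i - e)) (fun e he => ?_)
          (fun a ha b hb h => ?_) (fun e he => ?_) fun h _ => mul_nonneg (by positivity)
            (add_nonneg (by split_ifs <;> norm_num) (by split_ifs <;> norm_num))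
        · rw [mem_Ioc] at he ⊢
          have h1 : ν (i - e) < ν i := hν.mono (by lia)
          have h2 : ν (i - d) ≤ ν (i - e) := hν.mono.monotone (by lia)
          lia
        · simp only at h
          rw [mem_coe, mem_Ioc] at ha hb
          have h1 : ν (i - a) ≤ ν i := hν.mono.monotone (by lia)
          have h2 : ν (i - b) ≤ ν i := hν.mono.monotone (by lia)
          have h3 : ν (i - a) = ν (i - b) := by lia
          have := hν.mono.injective h3
          lia
        · rw [mem_Ioc] at he
          have h1 : ν (i - e) < ν i := hν.mono (by lia)
          have h2 : ν (i - d) ≤ ν (i - e) := hν.mono.monotone (by lia)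
          have h3 : (1 : ℝ) ≤ (if ν i + (ν i - ν (i - e)) ∈ SOS then 1 else 0) +
              (if ν i - ν (i - e) ≤ ν i ∧ ν i - (ν i - ν (i - e)) ∈ SOS then 1 else 0) := by
            rw [Nat.sub_sub_self h1.le,
              if_pos (And.intro (Nat.sub_le (ν i) (ν (i - e))) (hν.mem (i - e)))]
            exact le_add_of_nonneg_left (by split_ifs <;> norm_num)
          have h4 : (0 : ℝ) < ν i - ν (i - e) := by
            rw [sub_pos]; exact_mod_cast h1
          have h5 : (ν (i - d) : ℝ) ≤ ν (i - e) := by exact_mod_cast h2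
          refine le_trans ?_ (le_mul_of_one_le_right (by positivity) h3)
          rw [Nat.cast_sub h1.le]
          gcongr

lemma sum_near_above_le {ν : ℕ → ℕ} (hν : IsSOSEnum ν) {i : ℕ} {p x D : ℝ} (hp : 1 ≤ p)
    (hD : 0 < D) (hDx : D ≤ |(ν i : ℝ) - x|) (hx : x ≤ ν i)
    (hH : ⌊Real.log (ν i) ^ 3⌋₊ < ν i) :
    D ^ p * ∑ m ∈ Icc (ν i) (ν i + ⌊Real.log (ν i) ^ 3⌋₊), (r2 m : ℝ) * |(m : ℝ) - x| ^ (-p) ≤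
      ((1 + D * gapSum (ν i)) * nearSum ν (1 / p) i) ^ p := by
  set H := ⌊Real.log (ν i) ^ 3⌋₊ with hHdef
  refine sum_near_le (φ := fun d => ν (i + d)) (H := H) hp hD (gapSum_nonneg _) ?_ hDx ?_ ?_
  · intro m hm hmS
    rw [mem_Icc] at hm
    obtain ⟨l, rfl⟩ := hν.exists_eq hmS
    have hil : i ≤ l := hν.mono.le_iff_le.1 hm.1
    obtain ⟨d, rfl⟩ := Nat.exists_eq_add_of_le hil
    have := hν.add_le i d
    exact ⟨d, by lia, rfl⟩
  · intro d hd hdU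
    rw [mem_Icc] at hdU
    refine (hν.le_gapSum_mul_add (mem_Ioc.1 hd).1 hdU.2).trans ?_
    refine mul_le_mul_of_nonneg_left ?_ (gapSum_nonneg _)
    exact le_trans (by linarith) (le_abs_self _)
  · refine add_le_add le_rfl (sum_le_sum fun d _ => mul_le_mul_of_nonneg_left ?_ (by positivity))
    refine le_trans ?_ (le_add_of_nonneg_right (by split_ifs <;> positivity))
    split_ifs with h1 h2
    · rfl
    · rw [mem_Icc] at h1
      lia
    · positivity
    · rfl

lemma sum_near_below_le {ν : ℕ → ℕ} (hν : IsSOSEnum ν) {i : ℕ} {p x D : ℝ} (hp : 1 ≤ p)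
    (hD : 0 < D) (hDx : D ≤ |(ν i : ℝ) - x|) (hx : ν i ≤ x)
    (hH : ⌊Real.log (ν i) ^ 3⌋₊ < ν i) :
    D ^ p * ∑ m ∈ Icc (ν i - ⌊Real.log (ν i) ^ 3⌋₊) (ν i), (r2 m : ℝ) * |(m : ℝ) - x| ^ (-p) ≤
      ((1 + D * gapSum (ν i)) * nearSum ν (1 / p) i) ^ p := by
  set H := ⌊Real.log (ν i) ^ 3⌋₊ with hHdef
  have hpos : ∀ d, ν (i - d) ∈ Icc (ν i - H) (ν i) → d < i := fun d hd => by
    by_contra hc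
    rw [mem_Icc, Nat.sub_eq_zero_of_le (not_lt.1 hc), hν.zero] at hd
    lia
  refine sum_near_le (φ := fun d => ν (i - d)) (H := H) hp hD (gapSum_nonneg _) ?_ hDx ?_ ?_
  · intro m hm hmS
    rw [mem_Icc] at hm
    obtain ⟨l, rfl⟩ := hν.exists_eq hmS
    have hil : l ≤ i := hν.mono.le_iff_le.1 hm.2
    obtain ⟨d, rfl⟩ := Nat.exists_eq_add_of_le hil
    have := hν.add_le l d
    exact ⟨d, by lia, by simp⟩
  · intro d hd hdU
    have hdi := hpos d hdU
    rw [mem_Icc] at hdU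
    refine (hν.le_gapSum_mul_sub (mem_Ioc.1 hd).1 hdi.le (by lia)).trans ?_
    refine mul_le_mul_of_nonneg_left ?_ (gapSum_nonneg _)
    exact le_trans (by linarith) (neg_le_abs _)
  · refine add_le_add le_rfl (sum_le_sum fun d _ => mul_le_mul_of_nonneg_left ?_ (by positivity))
    refine le_trans ?_ (le_add_of_nonneg_left (by split_ifs <;> positivity))
    split_ifs with h1 h2
    · rfl
    · exact absurd (hpos d h1) h2
    · positivity
    · rfl

/-- The moment at `x ∈ (ν (i - 1), ν i)` is controlled by the near and far sums at both
endpoints. -/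
lemma mq_le {ν : ℕ → ℕ} (hν : IsSOSEnum ν) {i : ℕ} {q x D : ℝ} (hq : 3 / 2 < q)
    (hD : 0 < D) (hDx : D ≤ |(ν i : ℝ) - x|) (hDx' : D ≤ |(ν (i + 1) : ℝ) - x|)
    (hx : ν i ≤ x) (hx' : x ≤ ν (i + 1))
    (hH : ⌊Real.log (ν i) ^ 3⌋₊ < ν i) (hH' : ⌊Real.log (ν (i + 1)) ^ 3⌋₊ < ν (i + 1)) :
    mq q x D ≤ ((1 + D * gapSum (ν i)) * nearSum ν (1 / (2 * q)) i) ^ (2 * q) +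
      ((1 + D * gapSum (ν (i + 1))) * nearSum ν (1 / (2 * q)) (i + 1)) ^ (2 * q) +
      D ^ (2 * q) * (farSum (2 * q) (ν i) + farSum (2 * q) (ν (i + 1))) := by
  have hp3 : 3 < 2 * q := by linarith
  set p := 2 * q with hp
  set g : ℕ → ℝ := fun m => (r2 m : ℝ) * |(m : ℝ) - x| ^ (-p) with hg
  have hg0 : ∀ m, 0 ≤ g m := fun m => by positivity
  have hU (U : Finset ℕ) : HasSum (fun m => if m ∈ U then g m else 0) (∑ m ∈ U, g m) := by
    have : HasSum (fun m => if m ∈ U then g m else 0) (∑ m ∈ U, if m ∈ U then g m else 0) :=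
      hasSum_sum_of_ne_finset_zero fun m hm => by simp [hm]
    convert this using 1
    exact sum_congr rfl fun m hm => by simp [hm]
  have hU0 (U : Finset ℕ) (m : ℕ) : 0 ≤ if m ∈ U then g m else 0 := by
    split_ifs
    · exact hg0 m
    · rfl
  set U := Icc (ν i - ⌊Real.log (ν i) ^ 3⌋₊) (ν i) with hUdef
  set V := Icc (ν (i + 1)) (ν (i + 1) + ⌊Real.log (ν (i + 1)) ^ 3⌋₊) with hVdef
  have hle : ∀ m, g m ≤ ((if m ∈ U then g m else 0) + (if m ∈ V then g m else 0)) +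
      (farTerm p (ν i) m + farTerm p (ν (i + 1)) m) := by
    intro m
    have hf1 := farTerm_nonneg p (ν i) m
    have hf2 := farTerm_nonneg p (ν (i + 1)) m
    have hu := hU0 U m
    have hv := hU0 V m
    have hfar : ∀ n : ℕ, Real.log n ^ 3 < |(m : ℝ) - n| → |(m : ℝ) - n| ≤ |(m : ℝ) - x| →
        g m ≤ farTerm p n m := by
      intro n h1 h2
      have h3 : 0 < |(m : ℝ) - n| :=
        (pow_nonneg (Real.log_natCast_nonneg n) 3).trans_lt h1
      rw [farTerm, if_pos h1]
      exact mul_le_mul_of_nonneg_left (Real.rpow_le_rpow_of_nonpos h3 h2 (by linarith))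
        (by positivity)
    by_cases hm : m ∈ SOS
    · obtain ⟨l, rfl⟩ := hν.exists_eq hm
      rcases le_or_gt l i with hl | hl
      · have hli := hν.mono.monotone hl
        have hli' : (ν l : ℝ) ≤ ν i := by exact_mod_cast hli
        by_cases hmU : ν l ∈ U
        · rw [if_pos hmU] at hu ⊢
          linarith
        · have h1 := hfar (ν i) ?_ ?_
          · linarith
          · rw [hUdef, mem_Icc] at hmU
            have h2 : ⌊Real.log (ν i) ^ 3⌋₊ < ν i - ν l := by lia
            have h3 := Nat.lt_of_floor_lt h2
            rw [Nat.cast_sub hli] at h3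
            exact h3.trans_le ((neg_sub (ν l : ℝ) _).symm.trans_le (neg_le_abs _))
          · rw [abs_of_nonpos (by linarith), abs_of_nonpos (by linarith)]
            linarith
      · have hli := hν.mono.monotone (show i + 1 ≤ l from hl)
        have hli' : (ν (i + 1) : ℝ) ≤ ν l := by exact_mod_cast hli
        by_cases hmV : ν l ∈ V
        · rw [if_pos hmV] at hv ⊢
          linarith
        · have h1 := hfar (ν (i + 1)) ?_ ?_
          · linarith
          · rw [hVdef, mem_Icc] at hmV
            have h2 : ⌊Real.log (ν (i + 1)) ^ 3⌋₊ < ν l - ν (i + 1) := by lia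
            have h3 := Nat.lt_of_floor_lt h2
            rw [Nat.cast_sub hli] at h3
            exact h3.trans_le (le_abs_self _)
          · rw [abs_of_nonneg (by linarith), abs_of_nonneg (by linarith)]
            linarith
    · have : g m = 0 := by simp [hg, r2_eq_zero hm]
      linarith
  have hsum := hasSum_le hle (summable_r2_mul_abs_rpow hp3 x).hasSum
    (((hU U).add (hU V)).add ((summable_farTerm hp3 (ν i)).hasSum.add
      (summable_farTerm hp3 (ν (i + 1))).hasSum))
  have h1 := hν.sum_near_below_le (p := p) (by linarith) hD hDx hx hH
  have h2 := hν.sum_near_above_le (p := p) (by linarith) hD hDx' hx' hH'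
  calc mq q x D = D ^ p * ∑' m, g m := rfl
    _ ≤ D ^ p * ((∑ m ∈ U, g m + ∑ m ∈ V, g m) + (farSum p (ν i) + farSum p (ν (i + 1)))) := by
        exact mul_le_mul_of_nonneg_left hsum (by positivity)
    _ = D ^ p * ∑ m ∈ U, g m + D ^ p * ∑ m ∈ V, g m +
        D ^ p * (farSum p (ν i) + farSum p (ν (i + 1))) := by ring
    _ ≤ _ := add_le_add (add_le_add h1 h2) le_rfl

end IsSOSEnum

/-- The nearest lattice point alone contributes `r₂` to the moment. -/
lemma r2_le_mq {q x D : ℝ} (hq : 3 / 2 < q) (hD : 0 < D) {n : ℕ} (hn : D = |(n : ℝ) - x|) :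
    (r2 n : ℝ) ≤ mq q x D := by
  have h := (summable_r2_mul_abs_rpow (p := 2 * q) (by linarith) x).le_tsum n
    fun m _ => by positivity
  rw [← hn] at h
  calc (r2 n : ℝ) = D ^ (2 * q) * (r2 n * D ^ (-(2 * q))) := by
        rw [Real.rpow_neg hD.le]
        field_simp
    _ ≤ _ := mul_le_mul_of_nonneg_left h (by positivity)

end Deterministic

noncomputable section Assembly

open Finset Filter Topology
open scoped Classical

lemma two_rpow_le_of_three_le {p : ℝ} (hp : 3 ≤ p) : (2 : ℝ) ^ (1 / p) ≤ 63 / 50 := by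
  calc (2 : ℝ) ^ (1 / p) ≤ 2 ^ (1 / 3 : ℝ) :=
        Real.rpow_le_rpow_of_exponent_le (by norm_num) (one_div_le_one_div_of_le (by norm_num) hp)
    _ ≤ ((63 / 50 : ℝ) ^ 3) ^ (1 / 3 : ℝ) :=
        Real.rpow_le_rpow (by norm_num) (by norm_num) (by norm_num)
    _ = 63 / 50 := by
        rw [← Real.rpow_natCast, ← Real.rpow_mul (by norm_num)]
        norm_num

lemma mul_two_rpow_sub_one_lt {q : ℝ} (hq : 3 / 2 < q) :
    q * ((2 : ℝ) ^ (1 / (2 * q)) - 1) < 1 / 2 * Real.log 2 + fq q := by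
  have hl : 0 < Real.log 2 := Real.log_pos (by norm_num)
  set u := Real.log 2 / (2 * q) with hu
  have h1 : (2 : ℝ) ^ (1 / (2 * q)) = Real.exp u := by
    rw [Real.rpow_def_of_pos (by norm_num), hu]
    ring_nf
  have h2 : Real.exp u - 1 ≤ u * Real.exp u := by
    have h3 := Real.one_sub_le_exp_neg u
    have h4 := Real.exp_pos u
    have h5 : Real.exp (-u) * Real.exp u = 1 := by rw [← Real.exp_add]; simp
    nlinarith
  have h6 : u < Real.log 2 / (q - 1 / 2) :=
    div_lt_div_of_pos_left hl (by linarith) (by linarith)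
  have h7 : q * u = 1 / 2 * Real.log 2 := by
    rw [hu]
    field_simp
  rw [h1, fq]
  calc _ ≤ q * (u * Real.exp u) := by gcongr
    _ = 1 / 2 * Real.log 2 * Real.exp u := by rw [← mul_assoc, h7]
    _ < 1 / 2 * Real.log 2 * Real.exp (Real.log 2 / (q - 1 / 2)) := by
        gcongr
    _ = _ := by ring

lemma eventually_rpow_le_rpow_add (b : ℝ) {ε : ℝ} (hε : 0 < ε) :
    ∀ᶠ Λ : ℝ in atTop, ∀ l, Λ / 2 ≤ l → l ≤ 2 * Λ → l ^ b ≤ Λ ^ (b + ε) := by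
  filter_upwards [eventually_gt_atTop 0, eventually_le_rpow (2 ^ |b|) hε] with Λ h0 h1 l hl hl'
  have hl0 : 0 < l := by linarith
  have h2 : l ^ b ≤ 2 ^ |b| * Λ ^ b := by
    rcases le_total 0 b with hb | hb
    · rw [abs_of_nonneg hb, ← Real.mul_rpow (by norm_num) h0.le]
      exact Real.rpow_le_rpow hl0.le hl' hb
    · rw [abs_of_nonpos hb, Real.rpow_neg (by norm_num), ← Real.inv_rpow (by norm_num),
        ← Real.mul_rpow (by norm_num) h0.le]
      exact Real.rpow_le_rpow_of_nonpos (by positivity) (by linarith) hb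
  rw [Real.rpow_add h0, mul_comm (Λ ^ b)]
  exact h2.trans (by gcongr)

/-- The moment bound in terms of the scale `Λ`. -/
lemma near_far_total_le {q ε z Λ D w₁ w₂ v₁ v₂ F₁ F₂ : ℝ} (hq : 1 ≤ q) (hε : 0 < ε) (hz : 1 ≤ z)
    (hΛ : 1 ≤ Λ) (hΛε : 4 ≤ Λ ^ ε) (hD0 : 0 ≤ D) (hD : D ≤ Λ ^ (1 / 2 + ε))
    (hw₁0 : 0 ≤ w₁) (hw₂0 : 0 ≤ w₂) (hv₁0 : 0 ≤ v₁) (hv₂0 : 0 ≤ v₂)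
    (hF₁0 : 0 ≤ F₁) (hF₂0 : 0 ≤ F₂)
    (hw₁ : w₁ ≤ Λ ^ (-(1 / 2) + 2 * ε)) (hw₂ : w₂ ≤ Λ ^ (-(1 / 2) + 2 * ε))
    (hv₁ : v₁ ≤ Λ ^ ((z - 1) / 2 + 2 * ε)) (hv₂ : v₂ ≤ Λ ^ ((z - 1) / 2 + 2 * ε))
    (hF₁ : F₁ ≤ Λ ^ (-q + ε)) (hF₂ : F₂ ≤ Λ ^ (-q + ε)) :
    ((1 + D * w₁) * v₁) ^ (2 * q) + ((1 + D * w₂) * v₂) ^ (2 * q) + D ^ (2 * q) * (F₁ + F₂) ≤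
      Λ ^ (q * (z - 1) + 13 * q * ε) := by
  have hΛ0 : 0 < Λ := by linarith
  have hqε : ε ≤ q * ε := le_mul_of_one_le_left hε.le hq
  have hqz : 0 ≤ q * (z - 1) := mul_nonneg (by linarith) (by linarith)
  set P := Λ ^ (q * (z - 1) + 12 * q * ε) with hP
  have hP0 : 0 < P := by positivity
  have key : ∀ w v : ℝ, 0 ≤ w → 0 ≤ v → w ≤ Λ ^ (-(1 / 2) + 2 * ε) →
      v ≤ Λ ^ ((z - 1) / 2 + 2 * ε) → ((1 + D * w) * v) ^ (2 * q) ≤ P := by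
    intro w v hw0 hv0 hw hv
    have h1 : D * w ≤ Λ ^ (3 * ε) := by
      calc D * w ≤ Λ ^ (1 / 2 + ε) * Λ ^ (-(1 / 2) + 2 * ε) := by gcongr
        _ = _ := by
            rw [← Real.rpow_add hΛ0]
            ring_nf
    have h2 : 1 ≤ Λ ^ (3 * ε) := Real.one_le_rpow hΛ (by positivity)
    have h3 : 1 + D * w ≤ Λ ^ (4 * ε) := by
      calc 1 + D * w ≤ Λ ^ ε * Λ ^ (3 * ε) := by nlinarith
        _ = _ := by
            rw [← Real.rpow_add hΛ0]
            ring_nf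
    calc _ ≤ (Λ ^ (4 * ε) * Λ ^ ((z - 1) / 2 + 2 * ε)) ^ (2 * q) := by gcongr
      _ = P := by
        rw [← Real.rpow_add hΛ0, ← Real.rpow_mul hΛ0.le, hP]
        ring_nf
  have h1 := key w₁ v₁ hw₁0 hv₁0 hw₁ hv₁
  have h2 := key w₂ v₂ hw₂0 hv₂0 hw₂ hv₂
  have h3 : D ^ (2 * q) * (F₁ + F₂) ≤ 2 * P := by
    calc _ ≤ (Λ ^ (1 / 2 + ε)) ^ (2 * q) * (Λ ^ (-q + ε) + Λ ^ (-q + ε)) := by gcongr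
      _ = 2 * Λ ^ (2 * q * ε + ε) := by
          rw [← Real.rpow_mul hΛ0.le, ← two_mul, mul_left_comm, ← Real.rpow_add hΛ0]
          ring_nf
      _ ≤ 2 * P := by
          gcongr 2 * ?_
          exact Real.rpow_le_rpow_of_exponent_le hΛ (by nlinarith)
  calc _ ≤ Λ ^ ε * P := by nlinarith
    _ ≤ _ := by
        rw [hP, ← Real.rpow_add hΛ0]
        exact Real.rpow_le_rpow_of_exponent_le hΛ (by linarith)

lemma eventually_floor_log_pow_lt : ∀ᶠ n : ℕ in atTop, ⌊Real.log n ^ 3⌋₊ < n := by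
  have h := (isLittleO_log_rpow_rpow_atTop 3 one_pos).bound (c := 1 / 2) (by norm_num)
  filter_upwards [tendsto_natCast_atTop_atTop.eventually h, eventually_ge_atTop 1] with n hn hn1
  have h0 : (0 : ℝ) < n := by exact_mod_cast hn1
  have hl := Real.log_natCast_nonneg n
  rw [Real.norm_of_nonneg (by positivity), Real.norm_of_nonneg (by positivity), Real.rpow_one,
    Real.rpow_ofNat] at hn
  rw [Nat.floor_lt (by positivity)]
  linarith

namespace IsSOSEnum

lemma nearest_mem {ν : ℕ → ℕ} (hν : IsSOSEnum ν) {i n : ℕ} {x : ℝ} (hx : ν i < x)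
    (hx' : x < ν (i + 1)) (hn : n ∈ SOS) (h : ∀ m ∈ SOS, |(n : ℝ) - x| ≤ |(m : ℝ) - x|) :
    n = ν i ∨ n = ν (i + 1) := by
  obtain ⟨l, rfl⟩ := hν.exists_eq hn
  rcases lt_trichotomy l i with hl | hl | hl
  · exfalso
    have h1 : (ν l : ℝ) < ν i := by exact_mod_cast hν.mono hl
    have h2 := h _ (hν.mem i)
    rw [abs_of_neg (by linarith), abs_of_neg (by linarith)] at h2
    linarith
  · exact Or.inl (by rw [hl])
  · rcases (show i + 1 ≤ l from hl).eq_or_lt with hl' | hl'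
    · exact Or.inr (by rw [hl'])
    · exfalso
      have h1 : (ν (i + 1) : ℝ) < ν l := by exact_mod_cast hν.mono hl'
      have h2 := h _ (hν.mem (i + 1))
      rw [abs_of_pos (by linarith), abs_of_pos (by linarith)] at h2
      linarith

lemma log_comparable {ν : ℕ → ℕ} (hν : IsSOSEnum ν) {i n m : ℕ} (hi : 1 ≤ i) (h2 : 2 ≤ ν i)
    (hn : n = ν i ∨ n = ν (i + 1)) (hm : m = ν i ∨ m = ν (i + 1)) :
    Real.log m ≤ 2 * Real.log n := by
  have hle := hν.succ_le_two_mul hi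
  have hmono : ν i ≤ ν (i + 1) := hν.mono.monotone (Nat.le_succ i)
  have h1 : m ≤ n ^ 2 := by
    have hm' : m ≤ 2 * ν i := by rcases hm with rfl | rfl <;> lia
    have hn' : ν i ≤ n := by rcases hn with rfl | rfl <;> lia
    nlinarith
  have h3 : 0 < m := by rcases hm with rfl | rfl <;> lia
  have h4 := Real.log_le_log (by exact_mod_cast h3) (show (m : ℝ) ≤ (n : ℝ) ^ 2 by exact_mod_cast h1)
  rw [Real.log_pow] at h4
  exact_mod_cast h4

end IsSOSEnum

end Assembly

noncomputable section MomentBounds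

open Finset Filter Topology
open scoped Classical

/-- The point `lam j` lies strictly between `ν (j - 1)` and `ν j`, and `ntil j` is a sum of two
squares nearest to it. -/
structure IsInterlacing (ν : ℕ → ℕ) (lam : ℕ → ℝ) (ntil : ℕ → ℕ) : Prop extends IsSOSEnum ν where
  between : ∀ j, 1 ≤ j → (ν (j - 1) : ℝ) < lam j ∧ lam j < ν j
  nearest_mem_SOS : ∀ j, ntil j ∈ SOS
  nearest_le : ∀ j, ∀ m ∈ SOS, |(ntil j : ℝ) - lam j| ≤ |(m : ℝ) - lam j|

namespace IsInterlacing

lemma ntil_eq {ν : ℕ → ℕ} {lam : ℕ → ℝ} {ntil : ℕ → ℕ} (h : IsInterlacing ν lam ntil) {j : ℕ}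
    (hj : 1 ≤ j) : ntil j = ν (j - 1) ∨ ntil j = ν j := by
  obtain ⟨i, rfl⟩ := Nat.exists_eq_add_of_le' hj
  exact h.toIsSOSEnum.nearest_mem (h.between _ hj).1 (h.between _ hj).2 (h.nearest_mem_SOS _)
    (h.nearest_le _)

lemma dist_pos {ν : ℕ → ℕ} {lam : ℕ → ℝ} {ntil : ℕ → ℕ} (h : IsInterlacing ν lam ntil) {j : ℕ}
    (hj : 1 ≤ j) : 0 < |(ntil j : ℝ) - lam j| := by
  have hb := h.between j hj
  rw [abs_pos, sub_ne_zero]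
  rcases h.ntil_eq hj with hn | hn <;> rw [hn]
  · exact hb.1.ne
  · exact hb.2.ne'

lemma tendsto_ntil {ν : ℕ → ℕ} {lam : ℕ → ℝ} {ntil : ℕ → ℕ} (h : IsInterlacing ν lam ntil) :
    Tendsto ntil atTop atTop := by
  refine tendsto_atTop_mono' atTop ?_ (h.tendsto.comp (tendsto_sub_atTop_nat 1))
  filter_upwards [eventually_ge_atTop 1] with j hj
  have := h.mono.monotone (Nat.sub_le j 1)
  simp only [Function.comp]
  rcases h.ntil_eq hj with hn | hn <;> rw [hn]
  exact this

lemma zeroDens_r2_ntil_lt {ν : ℕ → ℕ} {lam : ℕ → ℝ} {ntil : ℕ → ℕ} (h : IsInterlacing ν lam ntil)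
    {ε : ℝ} (hε : 0 < ε) (hε1 : ε < 1) :
    ZeroDens {j | (r2 (ntil j) : ℝ) <
      Real.log (ntil j) ^ ((1 - ε) ^ 2 / 2 * Real.log 2)} := by
  have h1 := h.zeroDens_r2_lt hε hε1
  refine ((h1.union h1.shift).union (zeroDens_of_eventually (S := {0}) ?_)).mono ?_
  · filter_upwards [eventually_ge_atTop 1] with j hj
    rw [Set.mem_singleton_iff]
    lia
  · intro j hj
    rw [Set.mem_ofPred_eq] at hj
    rcases Nat.eq_zero_or_pos j with h0 | h0
    · exact Or.inr h0
    · refine Or.inl ?_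
      rcases h.ntil_eq h0 with hn | hn <;> rw [hn] at hj
      · exact Or.inr hj
      · exact Or.inl hj

lemma one_le_mq {ν : ℕ → ℕ} {lam : ℕ → ℝ} {ntil : ℕ → ℕ} (h : IsInterlacing ν lam ntil)
    {q : ℝ} (hq : 3 / 2 < q) {j : ℕ} (hj : 1 ≤ j) :
    1 ≤ mq q (lam j) |(ntil j : ℝ) - lam j| :=
  le_trans (by exact_mod_cast r2_pos (h.nearest_mem_SOS j)) (r2_le_mq hq (h.dist_pos hj) rfl)

/-- For almost every `j`, the moment is at most a fixed power of the logarithm. -/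
lemma zeroDens_lt_mq {ν : ℕ → ℕ} {lam : ℕ → ℝ} {ntil : ℕ → ℕ} (h : IsInterlacing ν lam ntil)
    {q : ℝ} (hq : 3 / 2 < q) {eps : ℕ → ℝ} (heps : Tendsto eps atTop (𝓝 0))
    (hrigid : ∀ j, |(ntil j : ℝ) - lam j| ≤ Real.log (ntil j) ^ (1 / 2 + eps j))
    {B : ℝ} (hB : q * ((2 : ℝ) ^ (1 / (2 * q)) - 1) < B) :
    ZeroDens {j | Real.log (ntil j) ^ B < mq q (lam j) |(ntil j : ℝ) - lam j|} := by
  set z := (2 : ℝ) ^ (1 / (2 * q)) with hz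
  have hz1 : 1 ≤ z := Real.one_le_rpow (by norm_num) (by positivity)
  have hz2 : z ≤ 63 / 50 := two_rpow_le_of_three_le (by linarith)
  obtain ⟨ε, hε, hε1, hεB⟩ : ∃ ε, 0 < ε ∧ ε < 1 ∧ q * (z - 1) + 13 * q * ε ≤ B := by
    have hδ : 0 < (B - q * (z - 1)) / (13 * q) := div_pos (by linarith) (by linarith)
    refine ⟨min ((B - q * (z - 1)) / (13 * q)) (1 / 2), lt_min hδ (by norm_num),
      (min_le_right _ _).trans_lt (by norm_num), ?_⟩
    have h1 : min ((B - q * (z - 1)) / (13 * q)) (1 / 2) ≤ (B - q * (z - 1)) / (13 * q) :=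
      min_le_left _ _
    rw [le_div_iff₀ (by linarith)] at h1
    linarith
  set T : Set ℕ := ({j | Real.log (ν j) ^ (-(1 / 2) + ε) < gapSum (ν j)} ∪
    {j | Real.log (ν j) ^ ((z - 1) / 2 + ε) < nearSum ν (1 / (2 * q)) j}) ∪
    {j | Real.log (ν j) ^ (-q) < farSum (2 * q) (ν j)} with hT
  have hTd : ZeroDens T := ((h.zeroDens_gapSum hε hε1).union
    (h.zeroDens_nearSum (by positivity) hz2 hε)).union
      (h.zeroDens_farSum (by linarith) (by linarith))
  have hTn : ∀ j, j ∉ T → gapSum (ν j) ≤ Real.log (ν j) ^ (-(1 / 2) + ε) ∧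
      nearSum ν (1 / (2 * q)) j ≤ Real.log (ν j) ^ ((z - 1) / 2 + ε) ∧
      farSum (2 * q) (ν j) ≤ Real.log (ν j) ^ (-q) := by
    intro j hj
    simp only [hT, Set.mem_union, Set.mem_ofPred_eq, not_or, not_lt] at hj
    exact ⟨hj.1.1, hj.1.2, hj.2⟩
  have hE1 : ∀ᶠ Λ : ℝ in atTop, 1 ≤ Λ ∧ 4 ≤ Λ ^ ε ∧ ∀ l, Λ / 2 ≤ l → l ≤ 2 * Λ →
      l ^ (-(1 / 2) + ε) ≤ Λ ^ (-(1 / 2) + ε + ε) ∧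
      l ^ ((z - 1) / 2 + ε) ≤ Λ ^ ((z - 1) / 2 + ε + ε) ∧ l ^ (-q) ≤ Λ ^ (-q + ε) := by
    filter_upwards [eventually_ge_atTop 1, eventually_le_rpow 4 hε,
      eventually_rpow_le_rpow_add (-(1 / 2) + ε) hε, eventually_rpow_le_rpow_add ((z - 1) / 2 + ε) hε,
      eventually_rpow_le_rpow_add (-q) hε] with Λ h1 h2 h3 h4 h5
    exact ⟨h1, h2, fun l hl hl' => ⟨h3 l hl hl', h4 l hl hl', h5 l hl hl'⟩⟩
  have hE2 : ∀ᶠ i in atTop, 2 ≤ ν i ∧ ⌊Real.log (ν i) ^ 3⌋₊ < ν i := by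
    filter_upwards [h.tendsto.eventually_ge_atTop 2,
      h.tendsto.eventually eventually_floor_log_pow_lt] with i h1 h2
    exact ⟨h1, h2⟩
  have hbad : ∀ᶠ j in atTop, j ∈ {j | Real.log (ntil j) ^ B < mq q (lam j) |(ntil j : ℝ) - lam j|} →
      j ∈ T ∪ {j | j - 1 ∈ T} := by
    filter_upwards [eventually_ge_atTop 2, hE2, (tendsto_sub_atTop_nat 1).eventually hE2,
      (tendsto_log_natCast.comp h.tendsto_ntil).eventually hE1,
      heps.eventually_le_const hε] with j hj2 hj hj' hΛ heε hm
    by_contra hc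
    rw [Set.mem_union, not_or] at hc
    obtain ⟨i, rfl⟩ := Nat.exists_eq_add_of_le' (show 1 ≤ j by lia)
    simp only [Nat.add_sub_cancel, Set.mem_ofPred_eq] at hc hj' hm
    simp only [Function.comp] at hΛ
    have hb := h.between (i + 1) (by lia)
    rw [Nat.add_sub_cancel] at hb
    have hnt := h.ntil_eq (show 1 ≤ i + 1 by lia)
    rw [Nat.add_sub_cancel] at hnt
    have hD0 := h.dist_pos (show 1 ≤ i + 1 by lia)
    have hmq := h.mq_le hq hD0 (h.nearest_le (i + 1) _ (h.mem i))
      (h.nearest_le (i + 1) _ (h.mem (i + 1))) hb.1.le hb.2.le hj'.2 hj.2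
    have hrig := hrigid (i + 1)
    set D := |(ntil (i + 1) : ℝ) - lam (i + 1)|
    obtain ⟨hΛ1, hΛε, hΛl⟩ := hΛ
    have hcmp : ∀ m, m = ν i ∨ m = ν (i + 1) →
        Real.log (ntil (i + 1)) / 2 ≤ Real.log m ∧ Real.log m ≤ 2 * Real.log (ntil (i + 1)) := by
      intro m hmi
      have h1 := h.log_comparable (show 1 ≤ i by lia) hj'.1 hnt hmi
      have h2 := h.log_comparable (show 1 ≤ i by lia) hj'.1 hmi hnt
      exact ⟨by linarith, h1⟩
    set Λ := Real.log (ntil (i + 1))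
    obtain ⟨hg1, hn1, hf1⟩ := hTn i hc.2
    obtain ⟨hg2, hn2, hf2⟩ := hTn (i + 1) hc.1
    have hl1 := hcmp _ (Or.inl rfl)
    have hl2 := hcmp _ (Or.inr rfl)
    obtain ⟨ha1, hb1, hc1⟩ := hΛl _ hl1.1 hl1.2
    obtain ⟨ha2, hb2, hc2⟩ := hΛl _ hl2.1 hl2.2
    rw [add_assoc, ← two_mul] at ha1 ha2 hb1 hb2
    have htot := near_far_total_le (by linarith) hε hz1 hΛ1 hΛε hD0.le
      (hrig.trans (Real.rpow_le_rpow_of_exponent_le hΛ1 (by linarith)))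
      (gapSum_nonneg _) (gapSum_nonneg _) (nearSum_nonneg _ _ _) (nearSum_nonneg _ _ _)
      (farSum_nonneg _ _) (farSum_nonneg _ _) (hg1.trans ha1) (hg2.trans ha2) (hn1.trans hb1)
      (hn2.trans hb2) (hf1.trans hc1) (hf2.trans hc2)
    have hfin := Real.rpow_le_rpow_of_exponent_le hΛ1 hεB
    linarith
  obtain ⟨M, hM⟩ := eventually_atTop.1 hbad
  refine ((hTd.union hTd.shift).union (zeroDens_of_eventually (S := {j | j < M}) ?_)).mono ?_
  · filter_upwards [eventually_ge_atTop M] with j hj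
    simpa using hj
  · intro j hj
    rcases lt_or_ge j M with hjM | hjM
    · exact Or.inr hjM
    · exact Or.inl (hM j hjM hj)

end IsInterlacing

/-- If outside a set of density zero `u` lies between `0` and `b`, and for each `c < a` it is at
least `c` outside a set of density zero, then `a ≤ limsup u ≤ b` along the complement. -/
lemma limsup_bounds_of_zeroDens {S : Set ℕ} (hS : ZeroDens S) {u : ℕ → ℝ} {a b : ℝ}
    (hu0 : ∀ j, j ∉ S → 0 ≤ u j) (hub : ∀ j, j ∉ S → u j ≤ b)
    (hua : ∀ c, c < a → ∃ R, ZeroDens R ∧ ∀ j, j ∉ R → c ≤ u j) :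
    a ≤ limsup u (atTop ⊓ 𝓟 Sᶜ) ∧ limsup u (atTop ⊓ 𝓟 Sᶜ) ≤ b := by
  have hev : ∀ᶠ j in atTop ⊓ 𝓟 Sᶜ, j ∉ S := mem_inf_of_right (mem_principal_self _)
  have hb : ∀ᶠ j in atTop ⊓ 𝓟 Sᶜ, u j ≤ b := hev.mono hub
  have hne : (atTop ⊓ 𝓟 Sᶜ).NeBot := by
    rw [← frequently_mem_iff_neBot]
    exact hS.frequently_notMem
  have hbelow : IsBoundedUnder (· ≥ ·) (atTop ⊓ 𝓟 Sᶜ) u := ⟨0, hev.mono hu0⟩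
  constructor
  · refine le_of_forall_lt fun c hc => ?_
    obtain ⟨c', hcc', hc'⟩ := exists_between hc
    obtain ⟨R, hR, hRu⟩ := hua c' hc'
    refine hcc'.trans_le (le_limsup_of_frequently_le ?_ ⟨b, hb⟩)
    rw [frequently_inf_principal]
    refine (hS.union hR).frequently_notMem.mono fun j hj => ?_
    rw [Set.mem_union, not_or] at hj
    exact ⟨hj.1, hRu j hj.2⟩
  · exact limsup_le_of_le hbelow.isCoboundedUnder_le hb

end MomentBounds

/-- For rigid quantizations (under the Sathe–Selberg analogue) the limsup of
`log m_q(λ_j)/log log ñ_j` along a full density set of indices lies in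
`[½ log 2, ½ log 2 + f(q)]`. -/
theorem rigid_quantization_bounds (hSS : SatheSelberg) (q : ℝ) (hq : 3 / 2 < q)
    (nseq : ℕ → ℕ) (hmono : StrictMono nseq) (hrange : Set.range nseq = SOS)
    (lam : ℕ → ℝ)
    (hinter : ∀ j : ℕ, 1 ≤ j → (nseq (j - 1) : ℝ) < lam j ∧ lam j < (nseq j : ℝ))
    (ntil : ℕ → ℕ) (D : ℕ → ℝ)
    (hD : ∀ j, D j = |(ntil j : ℝ) - lam j|)
    (hnear : ∀ j, ntil j ∈ SOS ∧
      (∀ m ∈ SOS, |(ntil j : ℝ) - lam j| ≤ |(m : ℝ) - lam j|) ∧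
      (∀ m ∈ SOS, |(m : ℝ) - lam j| = |(ntil j : ℝ) - lam j| → ntil j ≤ m))
    (eps : ℕ → ℝ) (heps : Tendsto eps atTop (𝓝 0))
    (hrigid : ∀ j : ℕ, D j ≤ Real.log (ntil j) ^ (1 / 2 + eps j)) :
    ∃ J : Set ℕ, FullDensityIdx J ∧
      1 / 2 * Real.log 2 ≤
        Filter.limsup (fun j : ℕ => Real.log (mq q (lam j) (D j)) /
          Real.log (Real.log (ntil j))) (atTop ⊓ 𝓟 J) ∧
      Filter.limsup (fun j : ℕ => Real.log (mq q (lam j) (D j)) /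
          Real.log (Real.log (ntil j))) (atTop ⊓ 𝓟 J)
        ≤ 1 / 2 * Real.log 2 + fq q := by
  have h : IsInterlacing nseq lam ntil :=
    { mono := hmono, range := hrange, between := hinter,
      nearest_mem_SOS := fun j => (hnear j).1, nearest_le := fun j => (hnear j).2.1 }
  obtain rfl : D = fun j => |(ntil j : ℝ) - lam j| := funext hD
  set R : Set ℕ := {j | ¬ (1 ≤ j ∧ 1 < Real.log (ntil j))} with hRdef
  have hR : ZeroDens R := zeroDens_of_eventually (by
    filter_upwards [eventually_ge_atTop 1,
      (tendsto_log_natCast.comp h.tendsto_ntil).eventually_gt_atTop 1] with j h1 h2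
    exact fun hc => hc ⟨h1, h2⟩)
  have hRn : ∀ j, j ∉ R → 1 ≤ j ∧ 1 < Real.log (ntil j) := fun j hj => not_not.1 hj
  have hU := hR.union (h.zeroDens_lt_mq hq heps hrigid (mul_two_rpow_sub_one_lt hq))
  refine ⟨_, hU.fullDensityIdx_compl, limsup_bounds_of_zeroDens hU (fun j hj => ?_)
    (fun j hj => ?_) fun c hc => ?_⟩
  · rw [Set.mem_union, not_or] at hj
    obtain ⟨hj1, hΛ⟩ := hRn j hj.1
    exact div_nonneg (Real.log_nonneg (h.one_le_mq hq hj1)) (Real.log_pos hΛ).le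
  · rw [Set.mem_union, not_or] at hj
    obtain ⟨hj1, hΛ⟩ := hRn j hj.1
    have hm := h.one_le_mq hq hj1
    have h2 := Real.log_le_log (by linarith) (not_lt.1 hj.2)
    rw [Real.log_rpow (by linarith)] at h2
    exact (div_le_iff₀ (Real.log_pos hΛ)).2 h2
  · have hcont : Tendsto (fun ε : ℝ => (1 - ε) ^ 2 / 2 * Real.log 2) (𝓝[>] 0)
        (𝓝 ((1 - 0) ^ 2 / 2 * Real.log 2)) :=
      (Continuous.tendsto (by fun_prop) 0).mono_left nhdsWithin_le_nhds
    obtain ⟨ε, hcε, hε⟩ := ((hcont.eventually_const_lt (u := c) (by linarith)).and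
      (Ioo_mem_nhdsGT one_pos)).exists
    refine ⟨_, hR.union (h.zeroDens_r2_ntil_lt hε.1 hε.2), fun j hj => ?_⟩
    rw [Set.mem_union, not_or] at hj
    obtain ⟨hj1, hΛ⟩ := hRn j hj.1
    have h1 := (not_lt.1 hj.2).trans (r2_le_mq hq (h.dist_pos hj1) rfl)
    have h2 := Real.log_le_log (Real.rpow_pos_of_pos (by linarith) _) h1
    rw [Real.log_rpow (by linarith)] at h2
    exact hcε.le.trans ((le_div_iff₀ (Real.log_pos hΛ)).2 h2)
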